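/- The homogeneous part of degree 2 of the operator 𝒢^{(α)} is given by: 𝒢_2^{(α)} = (1/2)∑_{m≥1}∑_{m1+m2=m+2, m1,m2≥1} b(m1−1)(m2−1) q_{m1} r_{m2} Ψ (m∂/∂p_m) + (1/2)∑_{m≥1}∑_{m1+m2+m3=m+2, m1,m2,m3≥1} (m1−1)(q_{m1}r_{m2}r_{m3} + r_{m1}q_{m2}q_{m3}) Ψ (m∂/∂p_m) + (1/2)∑_{k,m≥1}∑_{i1+i2=k+m+2, i1,i2≥1} α·min(m,k,i1−1,i2−1) q_{i1} r_{i2} Ψ (m∂/∂p_m)(k∂/∂p_k) + (1/2)∑_{m,k≥1}∑_{m1+m2=m+1, m1,m2≥1}∑_{k1+k2=k+1, k1,k2≥1} q_{m1} q_{k1} r_{m2} r_{k2} Ψ (m∂/∂p_m)(k∂/∂p_k), where b := α−1. -/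

import Mathlib

open scoped Classical

noncomputable section

/-- The base field `ℚ(α)` of rational functions in the Jack parameter `α`. -/
abbrev F : Type := RatFunc ℚ

/-- The Jack deformation parameter `α`. -/
def alpha : F := RatFunc.X

/-- An integer partition, encoded as a multiset of positive integers (its parts). -/
abbrev JPartition : Type := Multiset ℕ+

/-- The size `|λ|` of a partition. -/
def psize (l : JPartition) : ℕ := (l.map fun i => (i : ℕ)).sum

/-- The length `ℓ(λ)` of a partition. -/
def plen (l : JPartition) : ℕ := Multiset.card l

/-- `m_i(λ)`, the number of parts of `λ` equal to `i`. -/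
def pmult (l : JPartition) (i : ℕ+) : ℕ := Multiset.count i l

/-- `λ ∪ 1^k`, adjoining `k` parts equal to `1`. -/
def addOnes (l : JPartition) (k : ℕ) : JPartition := l + Multiset.replicate k 1

/-- `λ̃`, the partition obtained by deleting all parts equal to `1`. -/
def removeOnes (l : JPartition) : JPartition := Multiset.filter (fun i => i ≠ 1) l

/-- Exponent vectors of monomials in the power-sum generators `p₁, p₂, …`. -/
abbrev Exp : Type := ℕ+ →₀ ℕ

/-- The exponent vector of the monomial `p_λ`. -/
def toExp (l : JPartition) : Exp := l.toFinset.sum fun i => Finsupp.single i (Multiset.count i l)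

/-- The partition corresponding to an exponent vector. -/
def toPart (m : Exp) : JPartition := m.sum fun i k => Multiset.replicate k i

/-- The weighted degree (`deg p_i = i`) of an exponent vector; this is the size of the
corresponding partition. -/
def wt (m : Exp) : ℕ := m.sum fun i k => k * (i : ℕ)

/-- The algebra `ℚ(α)[p₁, p₂, …]` of symmetric functions written in the power-sum basis. -/
abbrev SymA : Type := MvPolynomial ℕ+ F

/-- The power-sum monomial `p_λ`. -/
def pPow (l : JPartition) : SymA := (l.map fun i => MvPolynomial.X i).prod

/-- `z_λ α^{ℓ(λ)}`, attached to the exponent vector of `p_λ`. -/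
def zalpha (m : Exp) : F :=
  algebraMap ℚ F (m.prod fun i k => (Nat.factorial k : ℚ) * ((i : ℕ) : ℚ) ^ k) *
    alpha ^ (m.sum fun _ k => k)

/-- The `α`-deformed Hall scalar product: `⟨p_λ, p_μ⟩ = δ_{λμ} z_λ α^{ℓ(λ)}`. -/
def hall (f g : SymA) : F :=
  ∑ m ∈ f.support, MvPolynomial.coeff m f * MvPolynomial.coeff m g * zalpha m

/-- The parts of a partition, sorted in weakly decreasing order. -/
def sortedParts (l : JPartition) : List ℕ := ((l.map fun i => (i : ℕ)).sort (· ≤ ·)).reverse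

/-- The sum of the `k` largest parts of a partition. -/
def topSum (l : JPartition) (k : ℕ) : ℕ := ((sortedParts l).take k).sum

/-- The dominance order on partitions: `μ ⊴ λ`. -/
def dominates (mu lam : JPartition) : Prop :=
  psize mu = psize lam ∧ ∀ k, topSum mu k ≤ topSum lam k

/-- Evaluation of a symmetric function (in power-sum coordinates) in `N` variables
`x₁, …, x_N`: it sends `p_i ↦ x₁^i + ⋯ + x_N^i`. -/
def evalN (N : ℕ) : SymA →ₐ[F] MvPolynomial (Fin N) F :=
  MvPolynomial.aeval fun i : ℕ+ => ∑ j : Fin N, MvPolynomial.X j ^ (i : ℕ)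

/-- The exponent of the monomial `x₁^{μ₁} ⋯ x_s^{μ_s}` in `N` variables, for `μ` a
partition; its coefficient in a symmetric polynomial is the coefficient of the monomial
symmetric function `m_μ` (provided `N ≥ ℓ(μ)`). -/
def xexp (mu : JPartition) (N : ℕ) : Fin N →₀ ℕ :=
  Finsupp.equivFunOnFinite.symm fun j => (sortedParts mu).getD (j : ℕ) 0

/-- The defining properties of the family of Jack polynomials `J_λ^{(α)}` (Macdonald's
characterization): orthogonality for the `α`-deformed Hall product, triangularity with
respect to monomial symmetric functions in dominance order, and normalization
`[p_{1^n}] J_λ^{(α)} = 1`. -/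
structure IsJackFamily (J : JPartition → SymA) : Prop where
  orthogonal : ∀ l m : JPartition, l ≠ m → hall (J l) (J m) = 0
  triangular : ∀ l m : JPartition, ¬ dominates m l →
    MvPolynomial.coeff (xexp m (psize l + psize m + plen m))
      (evalN (psize l + psize m + plen m) (J l)) = 0
  normalized : ∀ l : JPartition, MvPolynomial.coeff (Finsupp.single 1 (psize l)) (J l) = 1

/-- The Jack character `θ_μ^{(α)}(λ)`. -/
def theta (J : JPartition → SymA) (mu lam : JPartition) : F :=
  if psize lam < psize mu then 0
  else (Nat.choose (psize lam - psize mu + pmult mu 1) (pmult mu 1) : F) *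
    MvPolynomial.coeff (toExp (addOnes mu (psize lam - psize mu))) (J lam)

/-- `g` is the family of structure coefficients of Jack characters:
`θ_μ^{(α)} θ_ν^{(α)} = ∑_π g^π_{μ,ν}(α) θ_π^{(α)}` (as functions on Young diagrams,
with finitely many nonzero terms). -/
def IsStructCoeffs (J : JPartition → SymA) (g : JPartition → JPartition → JPartition → F) :
    Prop :=
  (∀ mu nu : JPartition, {pi : JPartition | g pi mu nu ≠ 0}.Finite) ∧
  ∀ mu nu lam : JPartition,
    theta J mu lam * theta J nu lam = ∑ᶠ pi : JPartition, g pi mu nu * theta J pi lam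


/-- The polynomial algebra `ℚ(α)[q,r]` in the two alphabets `q` (left) and `r` (right). -/
abbrev QR : Type := MvPolynomial (ℕ+ ⊕ ℕ+) F

/-- The variable `q_i`. -/
def qv (i : ℕ+) : QR := MvPolynomial.X (Sum.inl i)

/-- The variable `r_i`. -/
def rv (i : ℕ+) : QR := MvPolynomial.X (Sum.inr i)

/-- The monomial `q_μ r_ν`. -/
def qrMon (mu nu : JPartition) : QR :=
  (mu.map fun i => qv i).prod * (nu.map fun i => rv i).prod

/-- The linear operator `Ψ(p,q,r) : ℚ(α)[p] → ℚ(α)[q,r]`,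
`p_π ↦ ∏_{1≤i≤ℓ(π)} (q_{π_i} + r_{π_i})`. -/
def Psi (f : SymA) : QR :=
  ∑ m ∈ f.support, MvPolynomial.coeff m f • ((toPart m).map fun i => qv i + rv i).prod

/-- The homogeneous part `𝒢_k^{(α)} : ℚ(α)[p] → ℚ(α)[q,r]` of the operator `𝒢^{(α)}`:
`𝒢_k^{(α)} ⬝ p_π = ∑_{|μ|+|ν|=|π|+k} g^π_{μ,ν}(α) q_μ r_ν`. -/
def Gk (g : JPartition → JPartition → JPartition → F) (k : ℕ) (f : SymA) : QR :=
  ∑ m ∈ f.support, MvPolynomial.coeff m f •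
    ∑ᶠ mu : JPartition, ∑ᶠ nu : JPartition,
      if psize mu + psize nu = wt m + k then g (toPart m) mu nu • qrMon mu nu else 0


section

namespace JK
open MvPolynomial

section
variable {K : Type*} [Field K] {σ : Type*} {X Y : Type*} [AddCommGroup X] [Module K X]
  [AddCommGroup Y] [Module K Y]

/-- The operator `(k+1) ∂/∂x_{ι k}`. -/
def dK (ι : ℕ ↪ σ) (k : ℕ) : MvPolynomial σ K →ₗ[K] MvPolynomial σ K :=
  ((k : K) + 1) • (pderiv (ι k)).toLinearMap

theorem dK_apply (ι : ℕ ↪ σ) (k : ℕ) (f : MvPolynomial σ K) :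
    dK ι k f = ((k : K) + 1) • pderiv (ι k) f := rfl

theorem dK_mul (ι : ℕ ↪ σ) (k : ℕ) (f g : MvPolynomial σ K) :
    dK ι k (f * g) = dK ι k f * g + f * dK ι k g := by
  simp only [dK_apply, Derivation.leibniz, smul_eq_mul, smul_add, mul_smul_comm, smul_mul_assoc]
  rw [add_comm, mul_comm g]

theorem dK_X_self (ι : ℕ ↪ σ) (k : ℕ) :
    dK ι k (MvPolynomial.X (ι k) : MvPolynomial σ K) = C ((k : K) + 1) := by
  simp [dK_apply, MvPolynomial.smul_eq_C_mul]

theorem dK_X_of_ne (ι : ℕ ↪ σ) (k : ℕ) (i : σ) (h : ι k ≠ i) :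
    dK ι k (MvPolynomial.X i : MvPolynomial σ K) = 0 := by
  rw [dK_apply, pderiv_X_of_ne (Ne.symm h), smul_zero]

theorem dK_comm (ι : ℕ ↪ σ) (k m : ℕ) (f : MvPolynomial σ K) :
    dK ι k (dK ι m f) = dK ι m (dK ι k f) := by
  have h : pderiv (ι k) (pderiv (ι m) f) = pderiv (ι m) (pderiv (ι k) f) := by
    ext e
    simp only [coeff_pderiv]
    rw [add_right_comm]
    by_cases h : ι k = ι m
    · simp [h]
    · rw [Finsupp.add_apply, Finsupp.add_apply, Finsupp.single_eq_of_ne h,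
        Finsupp.single_eq_of_ne (Ne.symm h)]
      simp
      ring
  simp only [dK_apply, Derivation.map_smul, h]
  rw [smul_comm]

theorem exists_dK_bound (ι : ℕ ↪ σ) (f : MvPolynomial σ K) :
    ∃ s : Finset ℕ, ∀ k, k ∉ s → dK ι k f = 0 := by
  refine ⟨f.vars.preimage ι ι.injective.injOn, fun k hk => ?_⟩
  rw [dK_apply, pderiv_eq_zero_of_notMem_vars (by simpa using hk), smul_zero]

theorem finsum_dK (ι : ℕ ↪ σ) (f : MvPolynomial σ K) (V : ℕ → (MvPolynomial σ K →ₗ[K] X))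
    (s : Finset ℕ) (hs : ∀ k, k ∉ s → dK ι k f = 0) :
    ∑ᶠ k, V k (dK ι k f) = ∑ k ∈ s, V k (dK ι k f) := by
  apply finsum_eq_sum_of_support_subset
  intro k hk
  by_contra h
  exact hk (by simp [hs k h])

/-- `∑_k V_k ∘ (k+1) ∂/∂x_{ι k}`, linear in the family `V`. -/
def Dsum (ι : ℕ ↪ σ) :
    (ℕ → (MvPolynomial σ K →ₗ[K] X)) →ₗ[K] (MvPolynomial σ K →ₗ[K] X) where
  toFun V :=
    { toFun := fun f => ∑ᶠ k, V k (dK ι k f)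
      map_add' := by
        intro f g
        obtain ⟨s, hs⟩ := exists_dK_bound ι f
        obtain ⟨t, ht⟩ := exists_dK_bound ι g
        rw [finsum_dK ι f V (s ∪ t) (fun k hk => hs k (by grind)),
          finsum_dK ι g V (s ∪ t) (fun k hk => ht k (by grind)),
          finsum_dK ι (f + g) V (s ∪ t) (fun k hk => by
            rw [map_add, hs k (by grind), ht k (by grind), add_zero]), ← Finset.sum_add_distrib]
        simp
      map_smul' := by
        intro c f
        obtain ⟨s, hs⟩ := exists_dK_bound ι f
        rw [finsum_dK ι f V s hs,
          finsum_dK ι (c • f) V s (fun k hk => by rw [map_smul, hs k hk, smul_zero]),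
          RingHom.id_apply, Finset.smul_sum]
        simp }
  map_add' := by
    intro V V'
    refine LinearMap.ext fun f => ?_
    obtain ⟨s, hs⟩ := exists_dK_bound ι f
    simp only [LinearMap.coe_mk, AddHom.coe_mk, LinearMap.add_apply]
    rw [finsum_dK ι f _ s hs, finsum_dK ι f _ s hs, finsum_dK ι f _ s hs,
      ← Finset.sum_add_distrib]
    simp
  map_smul' := by
    intro c V
    refine LinearMap.ext fun f => ?_
    obtain ⟨s, hs⟩ := exists_dK_bound ι f
    simp only [LinearMap.coe_mk, AddHom.coe_mk, LinearMap.smul_apply, RingHom.id_apply]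
    rw [finsum_dK ι f _ s hs, finsum_dK ι f _ s hs, Finset.smul_sum]
    simp

theorem Dsum_eq_finsum (ι : ℕ ↪ σ) (V : ℕ → (MvPolynomial σ K →ₗ[K] X)) (f : MvPolynomial σ K) :
    Dsum ι V f = ∑ᶠ k, V k (dK ι k f) := rfl

theorem Dsum_eq_sum (ι : ℕ ↪ σ) (V : ℕ → (MvPolynomial σ K →ₗ[K] X)) (f : MvPolynomial σ K)
    (s : Finset ℕ) (hs : ∀ k, k ∉ s → dK ι k f = 0) :
    Dsum ι V f = ∑ k ∈ s, V k (dK ι k f) := finsum_dK ι f V s hs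

theorem Dsum_congr (ι : ℕ ↪ σ) {V V' : ℕ → (MvPolynomial σ K →ₗ[K] X)} (f : MvPolynomial σ K)
    (h : ∀ k g, V k g = V' k g) : Dsum ι V f = Dsum ι V' f := by
  have : V = V' := by
    funext k
    exact LinearMap.ext fun g => h k g
  rw [this]

theorem Dsum_comp (ι : ℕ ↪ σ) (V : ℕ → (MvPolynomial σ K →ₗ[K] X)) (L : X →ₗ[K] Y)
    (f : MvPolynomial σ K) : L (Dsum ι V f) = Dsum ι (fun k => L ∘ₗ V k) f := by
  obtain ⟨s, hs⟩ := exists_dK_bound ι f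
  rw [Dsum_eq_sum ι _ f s hs, Dsum_eq_sum ι _ f s hs, map_sum]
  rfl

theorem Dsum_X_mul (ι : ℕ ↪ σ) (V : ℕ → (MvPolynomial σ K →ₗ[K] X)) (i : ℕ)
    (f : MvPolynomial σ K) : Dsum ι V (MvPolynomial.X (ι i) * f) =
      ((i : K) + 1) • V i f + Dsum ι (fun k => V k ∘ₗ LinearMap.mulLeft K (MvPolynomial.X (ι i))) f := by
  obtain ⟨s, hs⟩ := exists_dK_bound ι f
  have key : ∀ k, dK ι k (MvPolynomial.X (ι i) * f) =
      (if k = i then ((i : K) + 1) • f else 0) + MvPolynomial.X (ι i) * dK ι k f := by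
    intro k
    rw [dK_mul]
    split_ifs with h
    · subst h
      rw [dK_X_self, MvPolynomial.smul_eq_C_mul]
    · rw [dK_X_of_ne _ _ _ (fun e => h (ι.injective e)), zero_mul]
  rw [Dsum_eq_sum ι _ f (insert i s) (fun k hk => hs k (by grind)),
    Dsum_eq_sum ι _ _ (insert i s) (fun k hk => by
      rw [key, hs k (by grind), if_neg (by grind)]; simp)]
  simp only [key, map_add, Finset.sum_add_distrib]
  congr 1
  rw [Finset.sum_eq_single i]
  · simp
  · intro b _ hb; simp [hb]
  · intro h; simp at h

theorem Dsum_mul_of_const (ι : ℕ ↪ σ) (V : ℕ → (MvPolynomial σ K →ₗ[K] X)) (c : MvPolynomial σ K)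
    (hc : ∀ k, dK ι k c = 0)
    (f : MvPolynomial σ K) : Dsum ι V (c * f) =
      Dsum ι (fun k => V k ∘ₗ LinearMap.mulLeft K c) f := by
  obtain ⟨s, hs⟩ := exists_dK_bound ι f
  rw [Dsum_eq_sum ι _ f s hs,
    Dsum_eq_sum ι _ _ s (fun k hk => by rw [dK_mul, hc, hs k hk]; simp)]
  refine Finset.sum_congr rfl fun k _ => ?_
  rw [dK_mul, hc]; simp

theorem Dsum_swap (ι : ℕ ↪ σ) (A : ℕ → ℕ → (MvPolynomial σ K →ₗ[K] X)) (f : MvPolynomial σ K) :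
    Dsum ι (fun k => Dsum ι (fun m => A m k)) f = Dsum ι (fun m => Dsum ι (fun k => A m k)) f := by
  obtain ⟨s, hs⟩ := exists_dK_bound ι f
  have h2 : ∀ k m, k ∉ s → dK ι k (dK ι m f) = 0 := by
    intro k m hk; rw [dK_comm, hs k hk, map_zero]
  rw [Dsum_eq_sum ι _ f s hs, Dsum_eq_sum ι _ f s hs]
  simp only [fun (V : ℕ → (MvPolynomial σ K →ₗ[K] X)) m => Dsum_eq_sum ι V (dK ι m f) s (fun k => h2 k m)]
  rw [Finset.sum_comm]
  simp only [dK_comm]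

/-- transport of `Dsum` along a linear map that intertwines the derivations. -/
theorem Dsum_transport {τ : Type*} (ι : ℕ ↪ σ) (ι' : ℕ ↪ τ)
    (Φ : MvPolynomial σ K →ₗ[K] MvPolynomial τ K)
    (h : ∀ k f, dK ι' k (Φ f) = Φ (dK ι k f)) (V : ℕ → (MvPolynomial τ K →ₗ[K] X))
    (f : MvPolynomial σ K) : Dsum ι' V (Φ f) = Dsum ι (fun k => V k ∘ₗ Φ) f := by
  obtain ⟨s, hs⟩ := exists_dK_bound ι f
  rw [Dsum_eq_sum ι _ f s hs,
    Dsum_eq_sum ι' _ _ s (fun k hk => by rw [h, hs k hk, map_zero])]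
  simp only [h]; rfl

end
end JK
end

section

namespace JK
open MvPolynomial Finset

theorem sum_antidiagonal_assoc {N : Type*} [AddCommMonoid N] (n : ℕ) (f : ℕ → ℕ → ℕ → N) :
    ∑ x ∈ antidiagonal n, ∑ y ∈ antidiagonal x.1, f y.1 y.2 x.2 =
    ∑ x ∈ antidiagonal n, ∑ y ∈ antidiagonal x.2, f x.1 y.1 y.2 := by
  rw [Finset.sum_sigma', Finset.sum_sigma']
  refine Finset.sum_nbij' (fun a => ⟨(a.2.1, a.2.2 + a.1.2), (a.2.2, a.1.2)⟩)
    (fun a => ⟨(a.1.1 + a.2.1, a.2.2), (a.1.1, a.2.1)⟩) ?_ ?_ ?_ ?_ ?_ <;>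
  · simp only [Finset.mem_sigma, Finset.mem_antidiagonal]
    rintro ⟨⟨a, b⟩, ⟨c, d⟩⟩ ⟨h1, h2⟩
    simp at h1 h2 ⊢
    try omega
    try grind

theorem sum_antidiagonal_shift {N : Type*} [AddCommMonoid N] (m k : ℕ) (h : ℕ → ℕ → N) :
    ∑ x ∈ antidiagonal k, h (m + x.1) x.2 =
      ∑ x ∈ antidiagonal (m + k), if m ≤ x.1 then h x.1 x.2 else 0 := by
  rw [← Finset.sum_filter]
  refine Finset.sum_nbij' (fun a => (m + a.1, a.2)) (fun a => (a.1 - m, a.2)) ?_ ?_ ?_ ?_ ?_ <;>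
  · simp only [Finset.mem_filter, Finset.mem_antidiagonal]
    rintro ⟨a, b⟩ h1
    simp at h1 ⊢
    try omega
    try grind

section
variable {K : Type*} [Field K] (al : K) {σ : Type*}

/-- polynomials in `w` (divisible by `w`); the index `n` stands for `w^(n+1)`. -/
abbrev W (K : Type*) [Field K] (σ : Type*) : Type _ := ℕ →₀ MvPolynomial σ K

abbrev sg (n : ℕ) (f : MvPolynomial σ K) : W K σ := Finsupp.single n f

def Sop : W K σ →ₗ[K] W K σ :=
  Finsupp.lsum K (fun n => match n with
    | 0 => 0
    | n + 1 => Finsupp.lsingle n)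

@[simp] theorem Sop_zero (f : MvPolynomial σ K) : Sop (sg 0 f) = 0 := by simp [Sop]
@[simp] theorem Sop_succ (n : ℕ) (f : MvPolynomial σ K) : Sop (sg (n + 1) f) = sg n f := by
  simp [Sop]

/-- the part of `M` that multiplies by power sums -/
def pPart (ι : ℕ ↪ σ) : ℕ → (MvPolynomial σ K →ₗ[K] W K σ)
  | 0 => 0
  | n + 1 => ∑ x ∈ antidiagonal n, Finsupp.lsingle x.1 ∘ₗ LinearMap.mulLeft K (X (ι x.2))

theorem pPart_zero (ι : ℕ ↪ σ) (f : MvPolynomial σ K) : pPart ι 0 f = 0 := rfl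
theorem pPart_succ (ι : ℕ ↪ σ) (n : ℕ) (f : MvPolynomial σ K) :
    pPart ι (n + 1) f = ∑ x ∈ antidiagonal n, sg x.1 (X (ι x.2) * f) := by
  simp [pPart]

/-- the degree-preserving part of the Nazarov-Sklyanin operator -/
def Mop (ι : ℕ ↪ σ) : W K σ →ₗ[K] W K σ :=
  Finsupp.lsum K (fun n => ((al - 1) * ((n : K) + 1)) • Finsupp.lsingle n + pPart ι n +
    al • Dsum ι (fun k => Finsupp.lsingle (n + 1 + k)))

theorem Mop_sg (ι : ℕ ↪ σ) (n : ℕ) (f : MvPolynomial σ K) :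
    Mop al ι (sg n f) = ((al - 1) * ((n : K) + 1)) • sg n f + pPart ι n f +
      al • Dsum ι (fun k => Finsupp.lsingle (n + 1 + k)) f := by
  simp [Mop]

def del (ι : ℕ ↪ σ) : MvPolynomial σ K →ₗ[K] W K σ := Dsum ι (fun k => Finsupp.lsingle k)

def eps (ι : ℕ ↪ σ) : W K σ →ₗ[K] MvPolynomial σ K :=
  Finsupp.lsum K (fun n => LinearMap.mulLeft K (X (ι n)))

@[simp] theorem eps_sg (ι : ℕ ↪ σ) (n : ℕ) (f : MvPolynomial σ K) :
    eps ι (sg n f) = X (ι n) * f := by simp [eps]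

def eps1 : W K σ →ₗ[K] MvPolynomial σ K := Finsupp.lapply 0

theorem eps1_sg_zero (f : MvPolynomial σ K) : eps1 (sg 0 f) = f := by simp [eps1]
theorem eps1_sg_succ (n : ℕ) (f : MvPolynomial σ K) : eps1 (sg (n + 1) f) = 0 := by
  simp [eps1]

def mapW {τ : Type*} (L : MvPolynomial σ K →ₗ[K] MvPolynomial τ K) : W K σ →ₗ[K] W K τ :=
  Finsupp.mapRange.linearMap L

@[simp] theorem mapW_sg {τ : Type*} (L : MvPolynomial σ K →ₗ[K] MvPolynomial τ K) (n : ℕ)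
    (f : MvPolynomial σ K) : mapW L (sg n f) = sg n (L f) := by simp [mapW]

theorem W_ext {X : Type*} [AddCommGroup X] [Module K X] {A B : W K σ →ₗ[K] X}
    (h : ∀ n f, A (sg n f) = B (sg n f)) : A = B :=
  Finsupp.lhom_ext h

theorem Sop_mapW {τ : Type*} (L : MvPolynomial σ K →ₗ[K] MvPolynomial τ K) (x : W K σ) :
    Sop (mapW L x) = mapW L (Sop x) := by
  have : Sop ∘ₗ mapW L = mapW L ∘ₗ Sop := by
    apply W_ext
    rintro (_ | n) f <;> simp
  exact LinearMap.congr_fun this x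

theorem eps1_mapW {τ : Type*} (L : MvPolynomial σ K →ₗ[K] MvPolynomial τ K) (x : W K σ) :
    eps1 (mapW L x) = L (eps1 x) := by
  simp [eps1, mapW]

theorem Dsum_leibniz {Y : Type*} [AddCommGroup Y] [Module K Y] (ι : ℕ ↪ σ)
    (V : ℕ → (MvPolynomial σ K →ₗ[K] Y)) (c g : MvPolynomial σ K) :
    Dsum ι V (c * g) = Dsum ι (fun k => V k ∘ₗ LinearMap.mulRight K g) c +
      Dsum ι (fun k => V k ∘ₗ LinearMap.mulLeft K c) g := by
  obtain ⟨s, hs⟩ := exists_dK_bound ι c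
  obtain ⟨t, ht⟩ := exists_dK_bound ι g
  rw [Dsum_eq_sum ι _ c (s ∪ t) (fun k hk => hs k (by grind)),
    Dsum_eq_sum ι _ g (s ∪ t) (fun k hk => ht k (by grind)),
    Dsum_eq_sum ι _ (c * g) (s ∪ t) (fun k hk => by
      rw [dK_mul, hs k (by grind), ht k (by grind)]; simp), ← Finset.sum_add_distrib]
  simp [dK_mul]

theorem Dsum_X_self {Y : Type*} [AddCommGroup Y] [Module K Y] (ι : ℕ ↪ σ)
    (V : ℕ → (MvPolynomial σ K →ₗ[K] Y)) (i : ℕ) :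
    Dsum ι V (X (ι i)) = ((i : K) + 1) • V i 1 := by
  have := Dsum_X_mul ι V i 1
  rw [mul_one] at this
  rw [this, Dsum_eq_sum ι _ 1 ∅ (fun k _ => by simp [dK_apply])]
  simp

theorem Dsum_X_ne {Y : Type*} [AddCommGroup Y] [Module K Y] (ι : ℕ ↪ σ)
    (V : ℕ → (MvPolynomial σ K →ₗ[K] Y)) (i : σ) (h : ∀ k, ι k ≠ i) :
    Dsum ι V (X i) = 0 := by
  rw [Dsum_eq_sum ι _ _ ∅ (fun k _ => dK_X_of_ne _ _ _ (h k))]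
  simp

end

def sP : ℕ ↪ ℕ+ := ⟨Nat.succPNat, Nat.succPNat_injective⟩

section
variable {K : Type*} [Field K] (al : K) {τ : Type*} (ι κ : ℕ ↪ τ)

abbrev SP (K : Type*) [Field K] : Type _ := MvPolynomial ℕ+ K

def Ps : SP K →ₐ[K] MvPolynomial τ K :=
  aeval (fun i => X (ι (PNat.natPred i)) + X (κ (PNat.natPred i)))

abbrev PsL : SP K →ₗ[K] MvPolynomial τ K := (Ps ι κ).toLinearMap

theorem Ps_X (n : ℕ) : Ps ι κ (X (sP n) : SP K) = X (ι n) + X (κ n) := by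
  simp [Ps, sP]

theorem Ps_symm : (Ps ι κ : SP K →ₐ[K] MvPolynomial τ K) = Ps κ ι := by
  simp [Ps, add_comm]

variable (h : ∀ i j, ι i ≠ κ j)
include h

theorem dK_Ps (k : ℕ) (f : SP K) : dK ι k (Ps ι κ f) = Ps ι κ (dK sP k f) := by
  induction f using MvPolynomial.induction_on with
  | C a => simp [dK_apply]
  | add p q hp hq => simp only [map_add, hp, hq]
  | mul_X p i hp =>
    obtain ⟨n, rfl⟩ : ∃ n, i = sP n := ⟨PNat.natPred i, by simp [sP]⟩
    rw [map_mul, dK_mul, hp, dK_mul, map_add, map_mul, map_mul, Ps_X, map_add,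
      dK_X_of_ne ι k _ (h k n), add_zero]
    congr 2
    by_cases hk : k = n
    · subst hk
      rw [dK_X_self, dK_X_self]; simp
    · rw [dK_X_of_ne _ _ _ (fun e => hk (ι.injective e)),
        dK_X_of_ne _ _ _ (fun e => hk (sP.injective e)), map_zero]

theorem Dsum_Ps {Y : Type*} [AddCommGroup Y] [Module K Y]
    (V : ℕ → (MvPolynomial τ K →ₗ[K] Y)) (f : SP K) :
    Dsum ι V (Ps ι κ f) = Dsum sP (fun k => V k ∘ₗ PsL ι κ) f :=
  Dsum_transport sP ι (PsL ι κ) (dK_Ps ι κ h) V f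

omit h

def Q1 (n : ℕ) : MvPolynomial τ K := ∑ x ∈ antidiagonal n, X (ι x.1) * X (κ x.2)

theorem Q1_symm (n : ℕ) : (Q1 ι κ n : MvPolynomial τ K) = Q1 κ ι n := by
  unfold Q1
  rw [← Finset.Nat.sum_antidiagonal_swap]
  simp [mul_comm]

/-- multiply `Ψ` by a coefficient -/
abbrev cP (c : MvPolynomial τ K) : SP K →ₗ[K] MvPolynomial τ K :=
  LinearMap.mulLeft K c ∘ₗ PsL ι κ

theorem cP_apply (c : MvPolynomial τ K) (f : SP K) : cP ι κ c f = c * Ps ι κ f := rfl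

def F1 : SP K →ₗ[K] MvPolynomial τ K := Dsum sP (fun n => cP ι κ (Q1 ι κ n))

theorem F1_symm : (F1 ι κ : SP K →ₗ[K] MvPolynomial τ K) = F1 κ ι := by
  unfold F1 cP PsL
  simp only [Q1_symm ι κ, Ps_symm ι κ]

def Rop : W K ℕ+ →ₗ[K] W K τ := Finsupp.lsum K (fun n =>
  ∑ x ∈ antidiagonal n, ((x.1 : K) + 1) • (Finsupp.lsingle x.1 ∘ₗ cP ι κ (X (κ x.2))))

theorem Rop_sg (n : ℕ) (f : SP K) : Rop ι κ (sg n f) =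
    ∑ x ∈ antidiagonal n, ((x.1 : K) + 1) • sg x.1 (X (κ x.2) * Ps ι κ f) := by
  simp [Rop]

theorem F1_X_mul (n : ℕ) (f : SP K) : F1 ι κ (X (sP n) * f) =
    (X (ι n) + X (κ n)) * F1 ι κ f + ((n : K) + 1) • (Q1 ι κ n * Ps ι κ f) := by
  unfold F1
  rw [Dsum_X_mul, add_comm, ← Ps_X]
  congr 1
  have := Dsum_comp sP (fun n => cP ι κ (Q1 ι κ n)) (LinearMap.mulLeft K (Ps ι κ (X (sP n)))) f
  rw [LinearMap.mulLeft_apply] at this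
  rw [this]
  refine Dsum_congr _ _ fun k g => ?_
  simp
  ring

include h

theorem Dsum_cP {Y : Type*} [AddCommGroup Y] [Module K Y]
    (V : ℕ → (MvPolynomial τ K →ₗ[K] Y)) (c : MvPolynomial τ K) (f : SP K) :
    Dsum ι V (c * Ps ι κ f) = Dsum ι (fun k => V k ∘ₗ LinearMap.mulRight K (Ps ι κ f)) c +
      Dsum sP (fun k => V k ∘ₗ cP ι κ c) f := by
  rw [Dsum_leibniz, Dsum_Ps ι κ h]
  rfl

theorem Dsum_Q1 {Y : Type*} [AddCommGroup Y] [Module K Y]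
    (V : ℕ → (MvPolynomial τ K →ₗ[K] Y)) (n : ℕ) :
    Dsum ι V (Q1 ι κ n) = ∑ x ∈ antidiagonal n, ((x.1 : K) + 1) • V x.1 (X (κ x.2)) := by
  unfold Q1
  rw [map_sum]
  refine Finset.sum_congr rfl fun x _ => ?_
  rw [Dsum_X_mul, Dsum_X_ne _ _ _ (fun k => h k _), add_zero]

theorem Dsum_F1 {Y : Type*} [AddCommGroup Y] [Module K Y]
    (V : ℕ → (MvPolynomial τ K →ₗ[K] Y)) (f : SP K) :
    Dsum ι V (F1 ι κ f) = Dsum sP (fun k => ∑ x ∈ antidiagonal k, ((x.1 : K) + 1) •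
        (V x.1 ∘ₗ cP ι κ (X (κ x.2)))) f + Dsum sP (fun k => V k ∘ₗ F1 ι κ) f := by
  have e1 : Dsum ι V (F1 ι κ f) = Dsum sP (fun k => Dsum ι V ∘ₗ cP ι κ (Q1 ι κ k)) f := by
    unfold F1; rw [Dsum_comp]
  have e2 : (fun k => V k ∘ₗ F1 ι κ) = fun k => Dsum sP (fun m => V k ∘ₗ cP ι κ (Q1 ι κ m)) := by
    funext k
    refine LinearMap.ext fun g => ?_
    unfold F1; rw [LinearMap.comp_apply, Dsum_comp]
  rw [e1, e2, ← Dsum_swap, ← LinearMap.add_apply, ← map_add]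
  refine Dsum_congr _ _ fun k g => ?_
  rw [LinearMap.comp_apply, cP_apply, Dsum_cP ι κ h, Dsum_Q1 ι κ h]
  simp

/-- order-one relation for `δ` -/
theorem del_F1 (f : SP K) : del ι (F1 ι κ f) = mapW (F1 ι κ) (del sP f) + Rop ι κ (del sP f) := by
  unfold del
  rw [Dsum_F1 ι κ h, Dsum_comp, Dsum_comp, add_comm]
  congr 1
  · refine Dsum_congr _ _ fun k g => ?_
    simp
  · refine Dsum_congr _ _ fun k g => ?_
    simp [Rop_sg]

theorem del_Ps (f : SP K) : del ι (Ps ι κ f) = mapW (PsL ι κ) (del sP f) := by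
  unfold del
  rw [Dsum_Ps ι κ h, Dsum_comp]
  refine Dsum_congr _ _ fun k g => ?_
  simp

omit h

theorem eps_F0 (x : W K ℕ+) : eps1 (Rop ι κ x) + eps ι (mapW (PsL ι κ) x) = Ps ι κ (eps sP x) := by
  have : eps1 ∘ₗ Rop ι κ + eps ι ∘ₗ mapW (PsL ι κ) = PsL ι κ ∘ₗ (eps sP : W K ℕ+ →ₗ[K] _) := by
    apply W_ext
    intro n f
    simp only [LinearMap.add_apply, LinearMap.comp_apply, Rop_sg, mapW_sg, eps_sg]
    rw [map_sum]
    cases n with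
    | zero => simp [-Finsupp.single_mul, eps1_sg_zero, Ps_X, add_mul, add_comm]
    | succ n =>
      rw [Finset.Nat.sum_antidiagonal_succ]
      simp [-Finsupp.single_mul, eps1_sg_zero, eps1_sg_succ, Ps_X, add_mul, add_comm]
  exact LinearMap.congr_fun this x

include h

theorem Lam1 (x : W K ℕ+) : Sop (Rop ι κ x) + Mop al ι (mapW (PsL ι κ) x) =
    Rop ι κ (Sop x) + mapW (PsL ι κ) (Mop al sP x) := by
  have : Sop ∘ₗ Rop ι κ + Mop al ι ∘ₗ mapW (PsL ι κ) =
      Rop ι κ ∘ₗ Sop + mapW (PsL ι κ) ∘ₗ (Mop al sP : W K ℕ+ →ₗ[K] _) := by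
    apply W_ext
    intro n f
    simp only [LinearMap.add_apply, LinearMap.comp_apply, Rop_sg, mapW_sg, Mop_sg, map_add,
      map_smul, Dsum_comp, AlgHom.toLinearMap_apply, Dsum_Ps ι κ h]
    have e : ∀ g : SP K, (Dsum sP fun k => Finsupp.lsingle (n + 1 + k) ∘ₗ (PsL ι κ)) g =
        (Dsum sP fun k => mapW (PsL ι κ) ∘ₗ Finsupp.lsingle (n + 1 + k)) g := by
      intro g
      refine Dsum_congr _ _ fun k g => by simp
    rw [e]
    cases n with
    | zero => simp [-Finsupp.single_mul, pPart_zero]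
    | succ n =>
      rw [Finset.Nat.sum_antidiagonal_succ]
      simp only [pPart_succ, Sop_zero, smul_zero, zero_add, Sop_succ, map_add, map_smul, map_sum,
        Rop_sg, mapW_sg, AlgHom.toLinearMap_apply, map_mul, Ps_X, add_mul, Finsupp.single_add,
        Finset.sum_add_distrib, add_smul, one_smul]
      push_cast
      simp only [add_smul, one_smul, Finset.sum_add_distrib]
      abel
  exact LinearMap.congr_fun this x

end
end JK
end

section

namespace JK
open MvPolynomial Finset

def mn (n k i j : ℕ) : ℕ := min (min (n + 1) (k + 1)) (min i j)

def psiN (n k i j : ℕ) : ℕ := ∑ t ∈ range i, min (min (n + 1 - t) (k + 1)) (min (i - t) j)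

theorem psiN_zero (n k j : ℕ) : psiN n k 0 j = 0 := rfl

theorem psiN_succ (n k i j : ℕ) :
    psiN (n + 1) k (i + 1) j = psiN n k i j + min (min (n + 2) (k + 1)) (min (i + 1) j) := by
  unfold psiN
  rw [Finset.sum_range_succ']
  congr 1
  refine Finset.sum_congr rfl fun t _ => ?_
  congr 2 <;> omega

theorem psiN_zero_succ (k i j : ℕ) :
    psiN 0 k (i + 1) j = min (min 1 (k + 1)) (min (i + 1) j) := by
  unfold psiN
  rw [Finset.sum_range_succ']
  simp

theorem sum_min_aux (d c i : ℕ) (hd : d ≤ i) :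
    2 * ∑ t ∈ range i, min (d - t) c = if c ≤ d then c * (2 * d + 1 - c) else d * (d + 1) := by
  induction i generalizing d with
  | zero =>
    obtain rfl : d = 0 := by omega
    rcases c with _ | c <;> simp
  | succ i ih =>
    rw [Finset.sum_range_succ']
    cases d with
    | zero => rcases c with _ | c <;> simp
    | succ d =>
      have := ih d (by omega)
      simp only [Nat.succ_sub_succ] at this ⊢
      have e : ∀ t, d + 1 - (t + 1) = d - t := by omega
      simp only [e, Nat.sub_zero]
      rw [mul_add, this]
      split_ifs with h1 h2 h2
      · rw [min_eq_right h2]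
        obtain ⟨u, rfl⟩ := Nat.exists_eq_add_of_le h1
        have a1 : 2 * (c + u) + 1 - c = c + 2 * u + 1 := by omega
        have a2 : 2 * (c + u + 1) + 1 - c = c + 2 * u + 3 := by omega
        rw [a1, a2]; ring
      · omega
      · obtain rfl : c = d + 1 := by omega
        have a2 : 2 * (d + 1) + 1 - (d + 1) = d + 2 := by omega
        rw [a2]; simp; ring
      · rw [min_eq_left (by omega)]; ring

theorem psiN_sym (n k i j : ℕ) (hh : i + j = n + k + 2) :
    psiN n k i j + psiN k n i j = (i + 1) * mn n k i j := by
  have key : ∀ n k, i + j = n + k + 2 → 2 * psiN n k i j =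
      if min (k + 1) j ≤ min (n + 1) i then min (k + 1) j * (2 * min (n + 1) i + 1 - min (k + 1) j)
      else min (n + 1) i * (min (n + 1) i + 1) := by
    intro n k hh
    rw [← sum_min_aux _ _ i (by omega)]
    unfold psiN
    congr 1
    refine Finset.sum_congr rfl fun t _ => ?_
    omega
  have h1 := key n k hh
  have h2 := key k n (by omega)
  have : 2 * (psiN n k i j + psiN k n i j) = 2 * ((i + 1) * mn n k i j) := by
    rw [mul_add, h1, h2]
    unfold mn
    have hAB : (n + 1) + (k + 1) = i + j := by omega
    clear h1 h2 key hh
    generalize n + 1 = A at hAB ⊢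
    generalize k + 1 = B at hAB ⊢
    rcases le_total A i with hA | hA <;> rcases le_total B i with hB | hB
    · -- j is the smallest
      have hj : j ≤ B ∧ j ≤ A := by omega
      rw [min_eq_right hj.1, min_eq_left hA, min_eq_right hj.2, min_eq_left hB, if_pos hj.2,
        if_pos hj.1, min_eq_right (by omega : j ≤ i), min_eq_right (by omega : j ≤ min A B)]
      zify [show j ≤ 2 * A + 1 by omega, show j ≤ 2 * B + 1 by omega]
      have : (i : ℤ) = A + B - j := by omega
      rw [this]; ring
    · have hj : j ≤ B ∧ A ≤ j := by omega
      rw [min_eq_right hj.1, min_eq_left hA, min_eq_left hj.2, min_eq_right hB,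
        min_eq_left (by omega : A ≤ B), min_eq_left (by omega : A ≤ min i j), if_pos hA]
      split_ifs with h
      · obtain rfl : j = A := by omega
        zify [show j ≤ 2 * j + 1 by omega, show j ≤ 2 * i + 1 by omega]; ring
      · zify [show A ≤ 2 * i + 1 by omega]; ring
    · have hj : j ≤ A ∧ B ≤ j := by omega
      rw [min_eq_left hj.2, min_eq_right hA, min_eq_right hj.1, min_eq_left hB,
        min_eq_right (by omega : B ≤ A), min_eq_left (by omega : B ≤ min i j), if_pos hB]
      split_ifs with h
      · obtain rfl : j = B := by omega
        zify [show j ≤ 2 * j + 1 by omega, show j ≤ 2 * i + 1 by omega]; ring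
      · zify [show B ≤ 2 * i + 1 by omega]; ring
    · have hj : A ≤ j ∧ B ≤ j := by omega
      rw [min_eq_left hj.2, min_eq_right hA, min_eq_left hj.1, min_eq_right hB,
        min_eq_left (by omega : i ≤ j), min_eq_right (by omega : i ≤ min A B)]
      split_ifs with h h' h'
      · obtain rfl : B = i := by omega
        obtain rfl : A = B := by omega
        zify [show A ≤ 2 * A + 1 by omega]; ring
      · obtain rfl : B = i := by omega
        zify [show B ≤ 2 * B + 1 by omega]; ring
      · obtain rfl : A = i := by omega
        zify [show A ≤ 2 * A + 1 by omega]; ring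
      · ring
  omega

end JK
end

section
set_option linter.unusedSectionVars false
set_option linter.unusedSimpArgs false
namespace JK
open MvPolynomial Finset

theorem tri_swap23 {N : Type*} [AddCommMonoid N] (n : ℕ) (f : ℕ → ℕ → ℕ → N) :
    ∑ x ∈ antidiagonal n, ∑ y ∈ antidiagonal x.2, f x.1 y.2 y.1 =
    ∑ x ∈ antidiagonal n, ∑ y ∈ antidiagonal x.2, f x.1 y.1 y.2 := by
  refine Finset.sum_congr rfl fun x _ => ?_
  exact Finset.Nat.sum_antidiagonal_swap (f := fun y : ℕ × ℕ => f x.1 y.1 y.2)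

theorem tri_swap12 {N : Type*} [AddCommMonoid N] (n : ℕ) (f : ℕ → ℕ → ℕ → N) :
    ∑ x ∈ antidiagonal n, ∑ y ∈ antidiagonal x.2, f y.1 x.1 y.2 =
    ∑ x ∈ antidiagonal n, ∑ y ∈ antidiagonal x.2, f x.1 y.1 y.2 := by
  rw [← sum_antidiagonal_assoc n f, ← sum_antidiagonal_assoc n (fun a b c => f b a c)]
  refine Finset.sum_congr rfl fun x _ => ?_
  exact Finset.Nat.sum_antidiagonal_swap (f := fun y : ℕ × ℕ => f y.1 y.2 x.2)

section
variable {K : Type*} [Field K] [CharZero K] (al : K) {τ : Type*} (ι κ : ℕ ↪ τ)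

def A2c (n : ℕ) : MvPolynomial τ K :=
  (al - 1) • ∑ x ∈ antidiagonal (n + 1), ((x.1 : K) * (x.2 : K)) • (X (ι x.1) * X (κ x.2)) +
  ∑ x ∈ antidiagonal n, ∑ y ∈ antidiagonal x.2,
    (x.1 : K) • (X (ι x.1) * X (κ y.1) * X (κ y.2) + X (κ x.1) * X (ι y.1) * X (ι y.2))

def B2c (m k : ℕ) : MvPolynomial τ K :=
  al • ∑ x ∈ antidiagonal (m + k + 2), (mn m k x.1 x.2 : K) • (X (ι x.1) * X (κ x.2)) +
  Q1 ι κ m * Q1 ι κ k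

theorem A2c_symm (n : ℕ) : A2c al ι κ n = A2c al κ ι n := by
  unfold A2c
  have e1 : ∑ x ∈ antidiagonal (n + 1), ((x.1 : K) * (x.2 : K)) •
      (X (ι x.1) * X (κ x.2) : MvPolynomial τ K) =
      ∑ x ∈ antidiagonal (n + 1), ((x.1 : K) * (x.2 : K)) • (X (κ x.1) * X (ι x.2)) := by
    rw [← Finset.Nat.sum_antidiagonal_swap]
    refine Finset.sum_congr rfl fun x _ => ?_
    rw [Prod.fst_swap, Prod.snd_swap, mul_comm, mul_comm (X (ι x.2))]
  rw [e1]
  refine congrArg _ (Finset.sum_congr rfl fun x _ => Finset.sum_congr rfl fun y _ => ?_)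
  rw [add_comm]

theorem B2c_symm (m k : ℕ) : B2c al ι κ m k = B2c al κ ι m k := by
  unfold B2c
  have e1 : ∑ x ∈ antidiagonal (m + k + 2), (mn m k x.1 x.2 : K) •
      (X (ι x.1) * X (κ x.2) : MvPolynomial τ K) =
      ∑ x ∈ antidiagonal (m + k + 2), (mn m k x.1 x.2 : K) • (X (κ x.1) * X (ι x.2)) := by
    rw [← Finset.Nat.sum_antidiagonal_swap]
    refine Finset.sum_congr rfl fun x _ => ?_
    rw [Prod.fst_swap, Prod.snd_swap, mul_comm (X (ι x.2)), mn, mn, min_comm x.2]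
  rw [e1, Q1_symm ι κ, Q1_symm ι κ]

def F2a : SP K →ₗ[K] MvPolynomial τ K := Dsum sP (fun n => cP ι κ (A2c al ι κ n))
def F2b : SP K →ₗ[K] MvPolynomial τ K :=
  Dsum sP (fun k => Dsum sP (fun m => cP ι κ (B2c al ι κ m k)))
def F2 : SP K →ₗ[K] MvPolynomial τ K := (2 : K)⁻¹ • (F2a al ι κ + F2b al ι κ)

theorem F2_symm : F2 al ι κ = F2 al κ ι := by
  unfold F2 F2a F2b cP PsL
  simp only [A2c_symm al ι κ, B2c_symm al ι κ, Ps_symm ι κ]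

/-- components of `R₂` -/
def R2i (n : ℕ) : SP K →ₗ[K] W K τ := ((al - 1) / 2) • ∑ x ∈ antidiagonal (n + 1),
    (((x.1 : K) + 1) * x.1 * x.2) • (Finsupp.lsingle x.1 ∘ₗ cP ι κ (X (κ x.2)))
def R2ii (n : ℕ) : SP K →ₗ[K] W K τ := ∑ x ∈ antidiagonal n, ∑ y ∈ antidiagonal x.2,
    (((x.1 : K) + 1) * x.1 / 2) • (Finsupp.lsingle x.1 ∘ₗ cP ι κ (X (κ y.1) * X (κ y.2)))
def R2iii (n : ℕ) : SP K →ₗ[K] W K τ := ∑ x ∈ antidiagonal n, ∑ y ∈ antidiagonal x.2,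
    (((x.1 : K) + 1) * y.1) • (Finsupp.lsingle x.1 ∘ₗ cP ι κ (X (κ y.1) * X (ι y.2)))
def R2iv (n : ℕ) : SP K →ₗ[K] W K τ := al • Dsum sP (fun k =>
    ∑ x ∈ antidiagonal (n + k + 2), (psiN n k x.1 x.2 : K) •
      (Finsupp.lsingle x.1 ∘ₗ cP ι κ (X (κ x.2))))
def R2v (n : ℕ) : SP K →ₗ[K] W K τ := ∑ x ∈ antidiagonal n,
    ((x.1 : K) + 1) • (Finsupp.lsingle x.1 ∘ₗ LinearMap.mulLeft K (X (κ x.2)) ∘ₗ F1 ι κ)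

def R2 : W K ℕ+ →ₗ[K] W K τ := Finsupp.lsum K (fun n =>
  R2i al ι κ n + R2ii ι κ n + R2iii ι κ n + R2iv al ι κ n + R2v ι κ n)

theorem R2_sg (n : ℕ) (f : SP K) : R2 al ι κ (sg n f) =
    R2i al ι κ n f + R2ii ι κ n f + R2iii ι κ n f + R2iv al ι κ n f + R2v ι κ n f := by
  simp [R2]

variable (h : ∀ i j, ι i ≠ κ j)
include h

theorem Dsum_level1 {Y : Type*} [AddCommGroup Y] [Module K Y]
    (V : ℕ → (MvPolynomial τ K →ₗ[K] Y)) (c : ℕ → MvPolynomial τ K)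
    (L : ℕ → (SP K →ₗ[K] Y))
    (hL : ∀ n g, L n g = Dsum ι (fun k => V k ∘ₗ LinearMap.mulRight K (Ps ι κ g)) (c n))
    (f : SP K) :
    Dsum ι V (Dsum sP (fun n => cP ι κ (c n)) f) =
      Dsum sP L f + Dsum sP (fun k => V k ∘ₗ Dsum sP (fun n => cP ι κ (c n))) f := by
  have e2 : (fun k => V k ∘ₗ Dsum sP (fun n => cP ι κ (c n))) =
      fun k => Dsum sP (fun m => V k ∘ₗ cP ι κ (c m)) := by
    funext k
    refine LinearMap.ext fun g => ?_
    rw [LinearMap.comp_apply, Dsum_comp]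
  rw [Dsum_comp, e2, ← Dsum_swap, ← LinearMap.add_apply, ← map_add]
  refine Dsum_congr _ _ fun k g => ?_
  rw [LinearMap.comp_apply, cP_apply, Dsum_cP ι κ h, Pi.add_apply, LinearMap.add_apply, hL]

theorem Dsum_level2 {Y : Type*} [AddCommGroup Y] [Module K Y]
    (V : ℕ → (MvPolynomial τ K →ₗ[K] Y)) (c : ℕ → ℕ → MvPolynomial τ K)
    (L : ℕ → ℕ → (SP K →ₗ[K] Y))
    (hL : ∀ m k g, L m k g = Dsum ι (fun k => V k ∘ₗ LinearMap.mulRight K (Ps ι κ g)) (c m k))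
    (f : SP K) :
    Dsum ι V (Dsum sP (fun k => Dsum sP (fun m => cP ι κ (c m k))) f) =
      Dsum sP (fun k => Dsum sP (fun m => L m k)) f +
      Dsum sP (fun k => V k ∘ₗ Dsum sP (fun k => Dsum sP (fun m => cP ι κ (c m k)))) f := by
  have e2 : (fun l => V l ∘ₗ Dsum sP (fun k => Dsum sP (fun m => cP ι κ (c m k)))) =
      fun l => Dsum sP (fun k => V l ∘ₗ Dsum sP (fun m => cP ι κ (c m k))) := by
    funext k
    refine LinearMap.ext fun g => ?_
    rw [LinearMap.comp_apply, Dsum_comp]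
  rw [Dsum_comp, e2, ← Dsum_swap sP (fun l k => V l ∘ₗ Dsum sP (fun m => cP ι κ (c m k))),
    ← LinearMap.add_apply, ← map_add]
  refine Dsum_congr _ _ fun k g => ?_
  rw [LinearMap.comp_apply, Dsum_level1 ι κ h V (fun m => c m k) (fun m => L m k) (fun m => hL m k),
    Pi.add_apply, LinearMap.add_apply]

theorem Dsum_qr {Y : Type*} [AddCommGroup Y] [Module K Y]
    (V : ℕ → (MvPolynomial τ K →ₗ[K] Y)) (i j : ℕ) :
    Dsum ι V (X (ι i) * X (κ j)) = ((i : K) + 1) • V i (X (κ j)) := by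
  rw [Dsum_X_mul, Dsum_X_ne _ _ _ (fun k => h k _), add_zero]

theorem Dsum_qrr {Y : Type*} [AddCommGroup Y] [Module K Y]
    (V : ℕ → (MvPolynomial τ K →ₗ[K] Y)) (i j l : ℕ) :
    Dsum ι V (X (ι i) * X (κ j) * X (κ l)) = ((i : K) + 1) • V i (X (κ j) * X (κ l)) := by
  rw [mul_assoc, Dsum_X_mul, Dsum_mul_of_const ι _ _ (fun k => dK_X_of_ne ι k _ (h k _)),
    Dsum_X_ne _ _ _ (fun k => h k _), add_zero]

theorem Dsum_rqq {Y : Type*} [AddCommGroup Y] [Module K Y]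
    (V : ℕ → (MvPolynomial τ K →ₗ[K] Y)) (i j l : ℕ) :
    Dsum ι V (X (κ i) * X (ι j) * X (ι l)) = ((j : K) + 1) • V j (X (κ i) * X (ι l)) +
      ((l : K) + 1) • V l (X (κ i) * X (ι j)) := by
  rw [mul_assoc, Dsum_mul_of_const ι _ _ (fun k => dK_X_of_ne ι k _ (h k _)),
    Dsum_X_mul, Dsum_X_self]
  simp

theorem Dsum_A2c {Y : Type*} [AddCommGroup Y] [Module K Y]
    (V : ℕ → (MvPolynomial τ K →ₗ[K] Y)) (n : ℕ) :
    Dsum ι V (A2c al ι κ n) =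
      (al - 1) • ∑ x ∈ antidiagonal (n + 1), ((x.1 : K) * (x.2 : K)) • ((x.1 : K) + 1) •
        V x.1 (X (κ x.2)) +
      (∑ x ∈ antidiagonal n, ∑ y ∈ antidiagonal x.2,
        (x.1 : K) • ((x.1 : K) + 1) • V x.1 (X (κ y.1) * X (κ y.2)) +
      (2 : K) • ∑ x ∈ antidiagonal n, ∑ y ∈ antidiagonal x.2,
        (y.1 : K) • ((x.1 : K) + 1) • V x.1 (X (κ y.1) * X (ι y.2))) := by
  unfold A2c
  simp only [map_add, map_smul, map_sum, Dsum_qr ι κ h, Dsum_qrr ι κ h, Dsum_rqq ι κ h,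
    smul_add, Finset.sum_add_distrib]
  rw [tri_swap12 n (fun a b c => (b : K) • ((a : K) + 1) • V a (X (κ b) * X (ι c))),
    tri_swap23 n (fun a b c => (a : K) • ((b : K) + 1) • V b (X (κ a) * X (ι c))),
    tri_swap12 n (fun a b c => (b : K) • ((a : K) + 1) • V a (X (κ b) * X (ι c))), two_smul]

theorem del_F2a (f : SP K) : del ι (F2a al ι κ f) =
    (2 : K) • Dsum sP (fun n => R2i al ι κ n + R2ii ι κ n + R2iii ι κ n) f +
      mapW (F2a al ι κ) (del sP f) := by
  have two : (2 : K) ≠ 0 := two_ne_zero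
  unfold del F2a
  rw [Dsum_level1 ι κ h _ _ (fun n => (2 : K) • (R2i al ι κ n + R2ii ι κ n + R2iii ι κ n))]
  · rw [Dsum_comp]
    have e1 : Dsum sP (fun n => (2 : K) • (R2i al ι κ n + R2ii ι κ n + R2iii ι κ n)) f =
      (2 : K) • Dsum sP (fun n => R2i al ι κ n + R2ii ι κ n + R2iii ι κ n) f := by
      rw [← LinearMap.smul_apply, ← map_smul]
      rfl
    rw [e1]
    refine congrArg _ (Dsum_congr _ _ fun k g => ?_)
    rw [LinearMap.comp_apply, LinearMap.comp_apply, Finsupp.lsingle_apply, Finsupp.lsingle_apply,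
      mapW_sg]
  · intro n g
    rw [Dsum_A2c al ι κ h, LinearMap.smul_apply, LinearMap.add_apply, LinearMap.add_apply, smul_add,
      smul_add, add_assoc]
    have e1 : (2 : K) • R2i al ι κ n g = (al - 1) • ∑ x ∈ antidiagonal (n + 1),
        ((x.1 : K) * (x.2 : K)) • ((x.1 : K) + 1) • sg x.1 (X (κ x.2) * Ps ι κ g) := by
      rw [R2i, LinearMap.smul_apply, LinearMap.sum_apply, smul_smul, mul_div_cancel₀ _ two]
      refine congrArg _ (Finset.sum_congr rfl fun x _ => ?_)
      rw [LinearMap.smul_apply, LinearMap.comp_apply, Finsupp.lsingle_apply, cP_apply, smul_smul]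
      congr 1
      ring
    have e2 : (2 : K) • R2ii ι κ n g = ∑ x ∈ antidiagonal n, ∑ y ∈ antidiagonal x.2,
        (x.1 : K) • ((x.1 : K) + 1) • sg x.1 (X (κ y.1) * X (κ y.2) * Ps ι κ g) := by
      rw [R2ii, LinearMap.sum_apply, Finset.smul_sum]
      refine Finset.sum_congr rfl fun x _ => ?_
      rw [LinearMap.sum_apply, Finset.smul_sum]
      refine Finset.sum_congr rfl fun y _ => ?_
      rw [LinearMap.smul_apply, LinearMap.comp_apply, Finsupp.lsingle_apply, cP_apply, smul_smul,
        smul_smul]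
      congr 1
      field_simp
    have e3 : R2iii ι κ n g = ∑ x ∈ antidiagonal n, ∑ y ∈ antidiagonal x.2,
        (y.1 : K) • ((x.1 : K) + 1) • sg x.1 (X (κ y.1) * X (ι y.2) * Ps ι κ g) := by
      rw [R2iii, LinearMap.sum_apply]
      refine Finset.sum_congr rfl fun x _ => ?_
      rw [LinearMap.sum_apply]
      refine Finset.sum_congr rfl fun y _ => ?_
      rw [LinearMap.smul_apply, LinearMap.comp_apply, Finsupp.lsingle_apply, cP_apply,
        smul_smul]
      congr 1
      ring
    rw [e1, e2, e3]
    rfl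

/-- the basic summand of `Dsum` applied to `F2b`. -/
def Tmk (m k : ℕ) : SP K →ₗ[K] W K τ :=
  al • ∑ x ∈ antidiagonal (m + k + 2), (psiN m k x.1 x.2 : K) •
      (Finsupp.lsingle x.1 ∘ₗ cP ι κ (X (κ x.2))) +
  ∑ x ∈ antidiagonal m, ((x.1 : K) + 1) • (Finsupp.lsingle x.1 ∘ₗ cP ι κ (X (κ x.2) * Q1 ι κ k))

theorem Dsum_B2c {Y : Type*} [AddCommGroup Y] [Module K Y]
    (V : ℕ → (MvPolynomial τ K →ₗ[K] Y)) (m k : ℕ) :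
    Dsum ι V (B2c al ι κ m k) =
      al • ∑ x ∈ antidiagonal (m + k + 2), (mn m k x.1 x.2 : K) • ((x.1 : K) + 1) •
        V x.1 (X (κ x.2)) +
      (∑ x ∈ antidiagonal m, ((x.1 : K) + 1) • V x.1 (X (κ x.2) * Q1 ι κ k) +
      ∑ x ∈ antidiagonal k, ((x.1 : K) + 1) • V x.1 (X (κ x.2) * Q1 ι κ m)) := by
  unfold B2c
  rw [map_add, Dsum_leibniz, Dsum_Q1 ι κ h, Dsum_Q1 ι κ h]
  simp only [map_smul, map_sum, Dsum_qr ι κ h]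
  simp only [LinearMap.comp_apply, LinearMap.mulRight_apply, LinearMap.mulLeft_apply,
    mul_comm (Q1 ι κ m)]

theorem del_F2b (f : SP K) : del ι (F2b al ι κ f) =
    (2 : K) • Dsum sP (fun n => R2iv al ι κ n + R2v ι κ n) f +
      mapW (F2b al ι κ) (del sP f) := by
  have e0 : ∀ f, Dsum sP (fun n => R2iv al ι κ n + R2v ι κ n) f =
      Dsum sP (fun m => Dsum sP (fun k => Tmk al ι κ m k)) f := by
    intro f
    refine Dsum_congr _ _ fun m g => ?_
    have : (fun k => Tmk al ι κ m k) = al • (fun k => ∑ x ∈ antidiagonal (m + k + 2),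
        (psiN m k x.1 x.2 : K) • (Finsupp.lsingle x.1 ∘ₗ cP ι κ (X (κ x.2)))) +
        ∑ x ∈ antidiagonal m, ((x.1 : K) + 1) •
          (fun k => Finsupp.lsingle x.1 ∘ₗ cP ι κ (X (κ x.2) * Q1 ι κ k)) := by
      funext k
      simp [Tmk]
    rw [this, map_add, map_smul, LinearMap.add_apply, LinearMap.add_apply, R2iv]
    refine congrArg _ ?_
    rw [R2v, map_sum, LinearMap.sum_apply, LinearMap.sum_apply]
    refine Finset.sum_congr rfl fun x _ => ?_
    rw [LinearMap.smul_apply, map_smul, LinearMap.smul_apply, F1, LinearMap.comp_apply,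
      LinearMap.comp_apply, Dsum_comp, Dsum_comp]
    refine congrArg _ (Dsum_congr _ _ fun k g => ?_)
    simp only [LinearMap.comp_apply, LinearMap.mulLeft_apply, mul_assoc]
  unfold del F2b
  rw [Dsum_level2 ι κ h _ _ (fun m k => Tmk al ι κ m k + Tmk al ι κ k m)]
  · rw [Dsum_comp]
    have e1 : Dsum sP (fun k => Dsum sP (fun m => Tmk al ι κ m k + Tmk al ι κ k m)) f =
      (2 : K) • Dsum sP (fun n => R2iv al ι κ n + R2v ι κ n) f := by
      have e : (fun k => Dsum sP (fun m => Tmk al ι κ m k + Tmk al ι κ k m)) =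
          (fun k => Dsum sP (fun m => Tmk al ι κ m k)) +
          (fun k => Dsum sP (fun m => Tmk al ι κ k m)) := by
        funext k
        rw [Pi.add_apply, ← map_add]
        rfl
      rw [e, map_add, LinearMap.add_apply, Dsum_swap sP (fun m k => Tmk al ι κ m k), e0, two_smul]
    rw [e1]
    refine congrArg _ (Dsum_congr _ _ fun k g => ?_)
    rw [LinearMap.comp_apply, LinearMap.comp_apply, Finsupp.lsingle_apply, Finsupp.lsingle_apply,
      mapW_sg]
  · intro m k g
    rw [Dsum_B2c al ι κ h, LinearMap.add_apply]
    have e1 : ∀ m k, Tmk al ι κ m k g = al • ∑ x ∈ antidiagonal (m + k + 2),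
        (psiN m k x.1 x.2 : K) • sg x.1 (X (κ x.2) * Ps ι κ g) +
        ∑ x ∈ antidiagonal m, ((x.1 : K) + 1) • sg x.1 (X (κ x.2) * Q1 ι κ k * Ps ι κ g) := by
      intro m k
      simp [Tmk, -Finsupp.single_mul, mul_assoc]
    rw [e1, e1, add_add_add_comm, ← smul_add, add_comm k m, ← Finset.sum_add_distrib]
    have e2 : ∑ x ∈ antidiagonal (m + k + 2), ((psiN m k x.1 x.2 : K) •
        sg x.1 (X (κ x.2) * Ps ι κ g) + (psiN k m x.1 x.2 : K) •
        sg x.1 (X (κ x.2) * Ps ι κ g)) = ∑ x ∈ antidiagonal (m + k + 2),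
        (mn m k x.1 x.2 : K) • ((x.1 : K) + 1) • sg x.1 (X (κ x.2) * Ps ι κ g) := by
      refine Finset.sum_congr rfl fun x hx => ?_
      rw [← add_smul, smul_smul]
      congr 1
      have := psiN_sym m k x.1 x.2 (by simpa using hx)
      have := congrArg (Nat.cast : ℕ → K) this
      push_cast at this
      rw [this]; ring
    rw [e2]
    rfl

theorem del_F2 (f : SP K) : del ι (F2 al ι κ f) =
    mapW (F2 al ι κ) (del sP f) + R2 al ι κ (del sP f) := by
  have two : (2 : K) ≠ 0 := two_ne_zero
  have e : R2 al ι κ (del sP f) = Dsum sP (fun n => R2i al ι κ n + R2ii ι κ n + R2iii ι κ n) f +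
      Dsum sP (fun n => R2iv al ι κ n + R2v ι κ n) f := by
    unfold del
    rw [Dsum_comp, ← LinearMap.add_apply, ← map_add]
    refine Dsum_congr _ _ fun k g => ?_
    simp only [LinearMap.comp_apply, Finsupp.lsingle_apply, R2_sg, Pi.add_apply,
      LinearMap.add_apply]
    abel
  have e2 : mapW (F2 al ι κ) (del sP f) = (2 : K)⁻¹ • (mapW (F2a al ι κ) (del sP f) +
      mapW (F2b al ι κ) (del sP f)) := by
    ext1 n
    simp [mapW, F2]
  rw [e, e2]
  unfold F2
  rw [LinearMap.smul_apply, LinearMap.add_apply, map_smul, map_add, del_F2a al ι κ h,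
    del_F2b al ι κ h]
  simp only [smul_add, smul_smul, inv_mul_cancel₀ two, one_smul]
  abel

end
end JK
end

section
set_option linter.unusedSectionVars false
set_option linter.unusedSimpArgs false
namespace JK
open MvPolynomial Finset

section
variable {K : Type*} [Field K] [CharZero K] (al : K) {τ : Type*} (ι κ : ℕ ↪ τ)

abbrev lw {X : Type*} [AddCommGroup X] [Module K X] (A : ℕ → (SP K →ₗ[K] X)) : W K ℕ+ →ₗ[K] X :=
  Finsupp.lsum K A

theorem lw_sg {X : Type*} [AddCommGroup X] [Module K X] (A : ℕ → (SP K →ₗ[K] X)) (n : ℕ)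
    (f : SP K) : lw A (sg n f) = A n f := by simp [lw]

theorem sg_add (n : ℕ) {σ : Type*} (f g : MvPolynomial σ K) : sg n (f + g) = sg n f + sg n g :=
  Finsupp.single_add n f g

theorem Lam2_i (n : ℕ) (f : SP K) :
    Sop (R2i al ι κ n f) + ∑ x ∈ antidiagonal n, ((x.1 : K) + 1) • ((al - 1) * ((x.1 : K) + 1)) •
      sg x.1 (X (κ x.2) * Ps ι κ f) =
    lw (R2i al ι κ) (Sop (sg n f)) + ((al - 1) * ((n : K) + 1)) • ∑ x ∈ antidiagonal n,
      ((x.1 : K) + 1) • sg x.1 (X (κ x.2) * Ps ι κ f) := by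
  have two : (2 : K) ≠ 0 := two_ne_zero
  have e : ∀ n, R2i al ι κ n f = ∑ x ∈ antidiagonal (n + 1),
      ((al - 1) / 2 * (((x.1 : K) + 1) * x.1 * x.2)) • sg x.1 (X (κ x.2) * Ps ι κ f) := by
    intro n
    simp only [R2i, LinearMap.smul_apply, LinearMap.sum_apply, LinearMap.comp_apply,
      Finsupp.lsingle_apply, Finset.smul_sum, smul_smul, LinearMap.mulLeft_apply]
    rfl
  rw [e, Finset.Nat.sum_antidiagonal_succ]
  simp only [map_add, map_sum, map_smul, Sop_zero, Sop_succ, smul_zero, zero_add]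
  cases n with
  | zero => 
    simp [-Finsupp.single_mul]
  | succ n =>
    rw [Sop_succ, lw_sg, e, Finset.smul_sum, ← Finset.sum_add_distrib, ← Finset.sum_add_distrib]
    refine Finset.sum_congr rfl fun x hx => ?_
    have hx' : ((x.1 : K) + x.2) = n + 1 := by
      have := Finset.HasAntidiagonal.mem_antidiagonal.1 hx
      exact_mod_cast congrArg (Nat.cast : ℕ → K) this
    simp only [smul_smul, ← add_smul]
    congr 1
    push_cast
    rw [← hx']
    field_simp
    ring

theorem Lam2_ii (n : ℕ) (f : SP K) :
    Sop (R2ii ι κ n f) + Sop (R2iii ι κ n f) + Sop (R2v ι κ n f) + pPart ι n (F1 ι κ f) +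
      ∑ x ∈ antidiagonal n, ((x.1 : K) + 1) • pPart ι x.1 (X (κ x.2) * Ps ι κ f) =
    lw (R2ii ι κ) (Sop (sg n f)) + lw (R2iii ι κ) (Sop (sg n f)) + lw (R2v ι κ) (Sop (sg n f)) +
      mapW (F1 ι κ) (pPart sP n f) + Rop ι κ (pPart sP n f) := by
  have two : (2 : K) ≠ 0 := two_ne_zero
  cases n with
  | zero =>
    simp [pPart_zero, R2ii, R2iii, R2v, -Finsupp.single_mul, Rop_sg]
  | succ n =>
    rw [Sop_succ, lw_sg, lw_sg, lw_sg]
    have h2 : Sop (R2ii ι κ (n + 1) f) = R2ii ι κ n f +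
        ∑ x ∈ antidiagonal n, ∑ y ∈ antidiagonal x.2,
          ((x.1 : K) + 1) • sg x.1 (X (κ y.1) * X (κ y.2) * Ps ι κ f) := by
      unfold R2ii
      rw [Finset.Nat.sum_antidiagonal_succ]
      simp only [LinearMap.add_apply, LinearMap.sum_apply, LinearMap.smul_apply,
        LinearMap.comp_apply, Finsupp.lsingle_apply, map_add, map_sum, map_smul, Sop_zero, Sop_succ,
        smul_zero, Finset.sum_const_zero, zero_add, ← Finset.sum_add_distrib]
      refine Finset.sum_congr rfl fun x _ => Finset.sum_congr rfl fun y _ => ?_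
      simp only [LinearMap.mulLeft_apply, AlgHom.toLinearMap_apply, ← add_smul]
      congr 1
      push_cast
      field_simp
      ring
    have h3 : Sop (R2iii ι κ (n + 1) f) = R2iii ι κ n f +
        ∑ x ∈ antidiagonal n, ∑ y ∈ antidiagonal x.2,
          (y.1 : K) • sg x.1 (X (κ y.1) * X (ι y.2) * Ps ι κ f) := by
      unfold R2iii
      rw [Finset.Nat.sum_antidiagonal_succ]
      simp only [LinearMap.add_apply, LinearMap.sum_apply, LinearMap.smul_apply,
        LinearMap.comp_apply, Finsupp.lsingle_apply, map_add, map_sum, map_smul, Sop_zero, Sop_succ,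
        smul_zero, Finset.sum_const_zero, zero_add, ← Finset.sum_add_distrib]
      refine Finset.sum_congr rfl fun x _ => Finset.sum_congr rfl fun y _ => ?_
      simp only [LinearMap.mulLeft_apply, AlgHom.toLinearMap_apply, ← add_smul]
      congr 1
      push_cast
      ring
    have h5 : Sop (R2v ι κ (n + 1) f) = R2v ι κ n f +
        ∑ x ∈ antidiagonal n, sg x.1 (X (κ x.2) * F1 ι κ f) := by
      unfold R2v
      rw [Finset.Nat.sum_antidiagonal_succ]
      simp only [LinearMap.add_apply, LinearMap.sum_apply, LinearMap.smul_apply,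
        LinearMap.comp_apply, Finsupp.lsingle_apply, map_add, map_sum, map_smul, Sop_zero, Sop_succ,
        smul_zero, Finset.sum_const_zero, zero_add, ← Finset.sum_add_distrib]
      refine Finset.sum_congr rfl fun x _ => ?_
      simp only [LinearMap.mulLeft_apply]
      push_cast
      module
    have h6 : ∑ x ∈ antidiagonal (n + 1), ((x.1 : K) + 1) • pPart ι x.1 (X (κ x.2) * Ps ι κ f) =
        ∑ x ∈ antidiagonal n, ∑ y ∈ antidiagonal x.2, 
          ((x.1 : K) + y.2 + 2) • sg x.1 (X (κ y.1) * X (ι y.2) * Ps ι κ f) := by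
      rw [Finset.Nat.sum_antidiagonal_succ, pPart_zero, smul_zero, zero_add,
        ← tri_swap23 n (fun a b c => ((a : K) + c + 2) • sg a (X (κ b) * X (ι c) * Ps ι κ f)),
        ← sum_antidiagonal_assoc n (fun a b c => ((a : K) + b + 2) • sg a (X (κ c) * X (ι b) * Ps ι κ f))]
      refine Finset.sum_congr rfl fun x _ => ?_
      rw [pPart_succ, Finset.smul_sum]
      refine Finset.sum_congr rfl fun y hy => ?_
      have hy' : ((y.1 : K) + y.2) = x.1 := by
        have := Finset.HasAntidiagonal.mem_antidiagonal.1 hy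
        exact_mod_cast congrArg (Nat.cast : ℕ → K) this
      rw [Nat.cast_add, ← hy', mul_comm (X (κ x.2)) (X (ι y.2)), ← mul_assoc]
      congr 1
      push_cast
      ring
    have h7 : mapW (F1 ι κ) (pPart sP (n + 1) f) = pPart ι (n + 1) (F1 ι κ f) +
        ∑ x ∈ antidiagonal n, sg x.1 (X (κ x.2) * F1 ι κ f) +
        ∑ x ∈ antidiagonal n, ∑ y ∈ antidiagonal x.2, 
          ((y.1 : K) + y.2 + 1) • sg x.1 (X (κ y.1) * X (ι y.2) * Ps ι κ f) := by
      rw [pPart_succ, pPart_succ, map_sum, ← Finset.sum_add_distrib, ← Finset.sum_add_distrib]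
      refine Finset.sum_congr rfl fun x _ => ?_
      rw [mapW_sg, F1_X_mul, add_mul, sg_add, sg_add]
      refine congrArg _ ?_
      rw [Q1_symm, Q1, Finset.sum_mul, Finset.smul_sum]
      change (Finsupp.lsingle x.1 : MvPolynomial τ K →ₗ[K] W K τ) _ = _
      rw [map_sum]
      refine Finset.sum_congr rfl fun y hy => ?_
      have hy' : ((y.1 : K) + y.2) = x.2 := by
        have := Finset.HasAntidiagonal.mem_antidiagonal.1 hy
        exact_mod_cast congrArg (Nat.cast : ℕ → K) this
      rw [← hy', map_smul]
      rfl
    have h8 : Rop ι κ (pPart sP (n + 1) f) = 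
        ∑ x ∈ antidiagonal n, ∑ y ∈ antidiagonal x.2, 
          ((x.1 : K) + 1) • sg x.1 (X (κ y.1) * X (κ y.2) * Ps ι κ f) +
        ∑ x ∈ antidiagonal n, ∑ y ∈ antidiagonal x.2, 
          ((x.1 : K) + 1) • sg x.1 (X (κ y.1) * X (ι y.2) * Ps ι κ f) := by
      rw [pPart_succ, map_sum, ← sum_antidiagonal_assoc n (fun a b c => ((a : K) + 1) • sg a (X (κ b) * X (κ c) * Ps ι κ f)),
       ← sum_antidiagonal_assoc n (fun a b c => ((a : K) + 1) • sg a (X (κ b) * X (ι c) * Ps ι κ f)), ← Finset.sum_add_distrib]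
      refine Finset.sum_congr rfl fun x _ => ?_
      rw [Rop_sg, ← Finset.sum_add_distrib]
      refine Finset.sum_congr rfl fun y _ => ?_
      rw [← smul_add, ← Finsupp.single_add, map_mul, Ps_X]
      congr 2
      ring
    have h9 : ∑ x ∈ antidiagonal n, ∑ y ∈ antidiagonal x.2,
          (y.1 : K) • sg x.1 (X (κ y.1) * X (ι y.2) * Ps ι κ f) + 
        ∑ x ∈ antidiagonal n, ∑ y ∈ antidiagonal x.2, 
          ((x.1 : K) + y.2 + 2) • sg x.1 (X (κ y.1) * X (ι y.2) * Ps ι κ f) =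
        ∑ x ∈ antidiagonal n, ∑ y ∈ antidiagonal x.2, 
          ((y.1 : K) + y.2 + 1) • sg x.1 (X (κ y.1) * X (ι y.2) * Ps ι κ f) +
        ∑ x ∈ antidiagonal n, ∑ y ∈ antidiagonal x.2, 
          ((x.1 : K) + 1) • sg x.1 (X (κ y.1) * X (ι y.2) * Ps ι κ f) := by
      rw [← Finset.sum_add_distrib, ← Finset.sum_add_distrib]
      refine Finset.sum_congr rfl fun x _ => ?_
      rw [← Finset.sum_add_distrib, ← Finset.sum_add_distrib]
      refine Finset.sum_congr rfl fun y _ => ?_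
      rw [← add_smul, ← add_smul]
      congr 1
      ring
    rw [h2, h3, h5, h6, h7, h8]
    linear_combination (norm := abel) h9

theorem mn_aux {Y : Type*} [AddCommGroup Y] [Module K Y] (n k : ℕ) (T : ℕ → ℕ → Y) :
    ∑ x ∈ antidiagonal (n + 1 + k), (mn n k (x.1 + 1) x.2 : K) • T x.1 x.2 +
    ∑ x ∈ antidiagonal k, ((x.1 : K) + 1) • T (n + 1 + x.1) x.2 +
    ∑ x ∈ antidiagonal n, ((x.1 : K) + 1) • T (x.1 + 1 + k) x.2 =
    ∑ x ∈ antidiagonal (n + 1 + k), ((x.1 : K) + 1) • T x.1 x.2 := by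
  have e1 : ∑ x ∈ antidiagonal k, ((x.1 : K) + 1) • T (n + 1 + x.1) x.2 = 
      ∑ x ∈ antidiagonal (n + 1 + k), if n + 1 ≤ x.1 then ((x.1 - n : ℕ) : K) • T x.1 x.2 else 0 := by
    rw [← sum_antidiagonal_shift (n + 1) k (fun i j => ((i - n : ℕ) : K) • T i j)]
    refine Finset.sum_congr rfl fun x _ => ?_
    rw [show n + 1 + x.1 - n = x.1 + 1 by omega]
    push_cast
    rfl
  have e2 : ∑ x ∈ antidiagonal n, ((x.1 : K) + 1) • T (x.1 + 1 + k) x.2 = 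
      ∑ x ∈ antidiagonal (n + 1 + k), if k + 1 ≤ x.1 then ((x.1 - k : ℕ) : K) • T x.1 x.2 else 0 := by
    rw [show n + 1 + k = k + 1 + n by omega,
      ← sum_antidiagonal_shift (k + 1) n (fun i j => ((i - k : ℕ) : K) • T i j)]
    refine Finset.sum_congr rfl fun x _ => ?_
    rw [show k + 1 + x.1 - k = x.1 + 1 by omega, show x.1 + 1 + k = k + 1 + x.1 by omega]
    push_cast
    rfl
  rw [e1, e2, ← Finset.sum_add_distrib, ← Finset.sum_add_distrib]
  refine Finset.sum_congr rfl fun x hx => ?_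
  have hx := Finset.HasAntidiagonal.mem_antidiagonal.1 hx
  have e : ∀ (p : Prop) [Decidable p] (a : ℕ) (y : Y), (if p then (a : K) • y else 0) =
      ((if p then a else 0 : ℕ) : K) • y := by
    intro p _ a y; split_ifs <;> simp
  rw [e, e, ← add_smul, ← add_smul]
  congr 1
  norm_cast
  unfold mn
  split_ifs <;> omega

variable (h : ∀ i j, ι i ≠ κ j)
include h

theorem Lam2_iv (n : ℕ) (f : SP K) :
    Sop (R2iv al ι κ n f) + al • Dsum ι (fun k => Finsupp.lsingle (n + 1 + k)) (F1 ι κ f) +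
      ∑ x ∈ antidiagonal n, ((x.1 : K) + 1) •
        al • Dsum ι (fun k => Finsupp.lsingle (x.1 + 1 + k)) (X (κ x.2) * Ps ι κ f) =
    lw (R2iv al ι κ) (Sop (sg n f)) +
      mapW (F1 ι κ) (al • Dsum sP (fun k => Finsupp.lsingle (n + 1 + k)) f) +
      Rop ι κ (al • Dsum sP (fun k => Finsupp.lsingle (n + 1 + k)) f) := by
  have h1 : Sop (R2iv al ι κ n f) = lw (R2iv al ι κ) (Sop (sg n f)) +
      al • Dsum sP (fun k => ∑ x ∈ antidiagonal (n + 1 + k), (mn n k (x.1 + 1) x.2 : K) •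
        (Finsupp.lsingle x.1 ∘ₗ cP ι κ (X (κ x.2)))) f := by
    have e1 : Sop (R2iv al ι κ n f) = al • Dsum sP (fun k => ∑ x ∈ antidiagonal (n + 1 + k),
        (psiN n k (x.1 + 1) x.2 : K) • (Finsupp.lsingle x.1 ∘ₗ cP ι κ (X (κ x.2)))) f := by
      rw [R2iv, LinearMap.smul_apply, map_smul, Dsum_comp]
      refine congrArg _ (Dsum_congr _ _ fun k g => ?_)
      rw [show n + k + 2 = n + 1 + k + 1 by omega, Finset.Nat.sum_antidiagonal_succ]
      simp only [psiN_zero, LinearMap.comp_apply, LinearMap.add_apply, LinearMap.sum_apply,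
        LinearMap.smul_apply, Finsupp.lsingle_apply, map_add, map_sum, map_smul, Sop_zero, Sop_succ,
        smul_zero, zero_add]
    rw [e1]
    cases n with
    | zero =>
      rw [Sop_zero, map_zero, zero_add]
      simp only [psiN_zero_succ, mn, zero_add]
    | succ n =>
      rw [Sop_succ, lw_sg, R2iv, LinearMap.smul_apply, ← smul_add, ← LinearMap.add_apply, ← map_add]
      refine congrArg _ (Dsum_congr _ _ fun k g => ?_)
      rw [Pi.add_apply, show n + 1 + 1 + k = n + k + 2 by omega, ← Finset.sum_add_distrib]
      simp only [psiN_succ, Nat.cast_add, add_smul]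
      rfl
  rw [h1, Dsum_F1 ι κ h, map_smul, map_smul, Dsum_comp, Dsum_comp]
  have h2 : ∑ x ∈ antidiagonal n, ((x.1 : K) + 1) •
        al • Dsum ι (fun k => Finsupp.lsingle (x.1 + 1 + k)) (X (κ x.2) * Ps ι κ f) =
      al • Dsum sP (fun k => ∑ x ∈ antidiagonal n, ((x.1 : K) + 1) • 
        (Finsupp.lsingle (x.1 + 1 + k) ∘ₗ cP ι κ (X (κ x.2)))) f := by
    have : (fun k => ∑ x ∈ antidiagonal n, ((x.1 : K) + 1) • 
        (Finsupp.lsingle (x.1 + 1 + k) ∘ₗ cP ι κ (X (κ x.2)))) =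
        ∑ x ∈ antidiagonal n, ((x.1 : K) + 1) • 
        (fun k => (Finsupp.lsingle (x.1 + 1 + k) ∘ₗ cP ι κ (X (κ x.2)) : SP K →ₗ[K] W K τ)) := by
      funext k
      simp
    rw [this, map_sum, LinearMap.sum_apply, Finset.smul_sum]
    refine Finset.sum_congr rfl fun x _ => ?_
    rw [map_smul, LinearMap.smul_apply, smul_comm, Dsum_cP ι κ h, Dsum_X_ne _ _ _ (fun k => h k _),
      zero_add]
  have h3 : Dsum sP (fun k => mapW (F1 ι κ) ∘ₗ Finsupp.lsingle (n + 1 + k)) f =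
      Dsum sP (fun k => Finsupp.lsingle (n + 1 + k) ∘ₗ F1 ι κ) f := by
    refine Dsum_congr _ _ fun k g => ?_
    rw [LinearMap.comp_apply, LinearMap.comp_apply, Finsupp.lsingle_apply, Finsupp.lsingle_apply,
      mapW_sg]
  have h4 : Dsum sP (fun k => Rop ι κ ∘ₗ Finsupp.lsingle (n + 1 + k)) f =
      Dsum sP (fun k => ∑ x ∈ antidiagonal (n + 1 + k), ((x.1 : K) + 1) •
        (Finsupp.lsingle x.1 ∘ₗ cP ι κ (X (κ x.2)))) f := by
    refine Dsum_congr _ _ fun k g => ?_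
    simp only [LinearMap.comp_apply, Finsupp.lsingle_apply, Rop_sg, LinearMap.sum_apply,
      LinearMap.smul_apply, LinearMap.mulLeft_apply, AlgHom.toLinearMap_apply]
  rw [h2, h3, h4]
  have h5 := Dsum_congr sP (V' := fun k => ∑ x ∈ antidiagonal (n + 1 + k), ((x.1 : K) + 1) •
        (Finsupp.lsingle x.1 ∘ₗ cP ι κ (X (κ x.2)))) f (fun k g => LinearMap.congr_fun
          (mn_aux n k (fun i j => Finsupp.lsingle i ∘ₗ cP ι κ (X (κ j)))) g)
  have h6 := congrArg (fun z => al • z) h5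
  simp only [← Pi.add_def, map_add, LinearMap.add_apply, smul_add] at h6 ⊢
  linear_combination (norm := abel) h6

theorem Lam2 (x : W K ℕ+) : Sop (R2 al ι κ x) + Mop al ι (mapW (F1 ι κ) x + Rop ι κ x) =
    R2 al ι κ (Sop x) + (mapW (F1 ι κ) (Mop al sP x) + Rop ι κ (Mop al sP x)) := by
  have : Sop ∘ₗ R2 al ι κ + Mop al ι ∘ₗ (mapW (F1 ι κ) + Rop ι κ) =
      R2 al ι κ ∘ₗ Sop + (mapW (F1 ι κ) ∘ₗ Mop al sP + Rop ι κ ∘ₗ Mop al sP) := by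
    apply W_ext
    intro n f
    have e : ∀ y, R2 al ι κ y = lw (R2i al ι κ) y + lw (R2ii ι κ) y + lw (R2iii ι κ) y +
        lw (R2iv al ι κ) y + lw (R2v ι κ) y := by
      intro y
      have : R2 al ι κ = lw (R2i al ι κ) + lw (R2ii ι κ) + lw (R2iii ι κ) +
        lw (R2iv al ι κ) + lw (R2v ι κ) := by
        apply W_ext
        intro n f
        simp only [LinearMap.add_apply, lw_sg, R2_sg]
      rw [this]; rfl
    simp only [LinearMap.add_apply, LinearMap.comp_apply, e (Sop _), R2_sg, map_add, mapW_sg, Rop_sg,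
      Mop_sg, map_sum, map_smul (Mop al ι), smul_add, Finset.sum_add_distrib]
    have l1 := Lam2_i al ι κ n f
    have l2 := Lam2_ii ι κ n f
    have l4 := Lam2_iv al ι κ h n f
    have s1 : Rop ι κ (((al - 1) * ((n : K) + 1)) • sg n f) = ((al - 1) * ((n : K) + 1)) •
        ∑ x ∈ antidiagonal n, ((x.1 : K) + 1) • sg x.1 (X (κ x.2) * Ps ι κ f) := by
      rw [map_smul, Rop_sg]
    have s2 : mapW (F1 ι κ) (((al - 1) * ((n : K) + 1)) • sg n f) = ((al - 1) * ((n : K) + 1)) •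
        sg n (F1 ι κ f) := by
      rw [map_smul, mapW_sg]
    rw [s1, s2]
    linear_combination (norm := abel) l1 + l2 + l4
  exact LinearMap.congr_fun this x

omit h
theorem eps_F1 (x : W K ℕ+) : eps1 (R2 al ι κ x) + eps ι (mapW (F1 ι κ) x + Rop ι κ x) =
    F1 ι κ (eps sP x) := by
  have : eps1 ∘ₗ R2 al ι κ + eps ι ∘ₗ (mapW (F1 ι κ) + Rop ι κ) =
      F1 ι κ ∘ₗ (eps sP : W K ℕ+ →ₗ[K] _) := by
    apply W_ext
    intro n f
    have e0 : ∀ c (v : MvPolynomial τ K), eps1 (sg c v) = if c = 0 then v else 0 := by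
      intro c v
      cases c with
      | zero => simp [eps1_sg_zero]
      | succ c => simp [eps1_sg_succ]
    have s0 : ∀ (m : ℕ) (t : ℕ × ℕ → MvPolynomial τ K), (∀ x, x.1 ≠ 0 → t x = 0) →
        ∑ x ∈ antidiagonal m, t x = t (0, m) := by
      intro m t ht
      rw [Finset.sum_eq_single (0, m)]
      · intro b hb hb0
        apply ht
        intro hb1
        apply hb0
        have := Finset.HasAntidiagonal.mem_antidiagonal.1 hb
        ext <;> simp <;> omega
      · intro hh; simp at hh
    have h1 : eps1 (R2i al ι κ n f) = 0 := by
      simp only [R2i, LinearMap.smul_apply, LinearMap.sum_apply, map_smul, map_sum,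
        LinearMap.comp_apply, Finsupp.lsingle_apply]
      rw [Finset.sum_eq_zero, smul_zero]
      intro x _
      rw [e0]; split_ifs with hx <;> simp [hx]
    have h2 : eps1 (R2ii ι κ n f) = 0 := by
      simp only [R2ii, LinearMap.smul_apply, LinearMap.sum_apply, map_smul, map_sum,
        LinearMap.comp_apply, Finsupp.lsingle_apply]
      refine Finset.sum_eq_zero fun x _ => Finset.sum_eq_zero fun y _ => ?_
      rw [e0]; split_ifs with hx <;> simp [hx]
    have h4 : eps1 (R2iv al ι κ n f) = 0 := by
      rw [R2iv, LinearMap.smul_apply, map_smul, Dsum_comp]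
      have : (fun k => (eps1 : W K τ →ₗ[K] _) ∘ₗ ∑ x ∈ antidiagonal (n + k + 2), (psiN n k x.1 x.2 : K) •
        (Finsupp.lsingle x.1 ∘ₗ cP ι κ (X (κ x.2)))) = 0 := by
        funext k
        refine LinearMap.ext fun g => ?_
        simp only [LinearMap.smul_apply, LinearMap.sum_apply, map_smul, map_sum,
          LinearMap.comp_apply, Finsupp.lsingle_apply]
        refine Finset.sum_eq_zero fun x _ => ?_
        rw [e0]; split_ifs with hx <;> simp [hx, psiN_zero]
      rw [this, map_zero]; simp
    have h3 : eps1 (R2iii ι κ n f) = ∑ y ∈ antidiagonal n, (y.1 : K) •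
        (X (κ y.1) * X (ι y.2) * Ps ι κ f) := by
      simp only [R2iii, LinearMap.smul_apply, LinearMap.sum_apply, map_smul, map_sum,
        LinearMap.comp_apply, Finsupp.lsingle_apply]
      rw [s0]
      · refine Finset.sum_congr rfl fun y _ => ?_
        rw [e0, if_pos rfl]; simp [mul_assoc]
      · intro x hx
        refine Finset.sum_eq_zero fun y _ => ?_
        rw [e0, if_neg hx, smul_zero]
    have h5 : eps1 (R2v ι κ n f) = X (κ n) * F1 ι κ f := by
      simp only [R2v, LinearMap.smul_apply, LinearMap.sum_apply, map_smul, map_sum,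
        LinearMap.comp_apply, Finsupp.lsingle_apply]
      rw [s0]
      · rw [e0, if_pos rfl]; simp [mul_assoc]
      · intro x hx
        rw [e0, if_neg hx, smul_zero]
    simp only [LinearMap.add_apply, LinearMap.comp_apply, R2_sg, map_add, mapW_sg, Rop_sg, eps_sg,
      map_sum, map_smul, h1, h2, h3, h4, h5, F1_X_mul]
    have h6 : ∑ y ∈ antidiagonal n, (y.1 : K) • (X (κ y.1) * X (ι y.2) * Ps ι κ f) +
       ∑ x ∈ antidiagonal n, ((x.1 : K) + 1) • (X (ι x.1) * (X (κ x.2) * Ps ι κ f)) =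
       ((n : K) + 1) • (Q1 ι κ n * Ps ι κ f) := by
      rw [← Finset.Nat.sum_antidiagonal_swap, ← Finset.sum_add_distrib, Q1, Finset.sum_mul,
        Finset.smul_sum]
      refine Finset.sum_congr rfl fun x hx => ?_
      have hx' : ((x.1 : K) + x.2) = n := by
        have := Finset.HasAntidiagonal.mem_antidiagonal.1 hx
        exact_mod_cast congrArg (Nat.cast : ℕ → K) this
      rw [Prod.fst_swap, Prod.snd_swap, mul_comm (X (κ x.2)), mul_assoc, ← add_smul, ← hx']
      congr 1
      ring
    rw [← h6]
    ring
  exact LinearMap.congr_fun this x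

end
end JK
end

section
set_option linter.unusedSectionVars false
set_option linter.unusedSimpArgs false
namespace JK
open MvPolynomial Finset

section
variable {K : Type*} [Field K] {X Y Z : Type*} [AddCommGroup X] [Module K X]
  [AddCommGroup Y] [Module K Y] [AddCommGroup Z] [Module K Z]
  {A : ℤ → Submodule K X} {B : ℤ → Submodule K Y} {D : ℤ → Submodule K Z}

/-- `L` raises the filtration degree by at least `d`. -/
def Op (A : ℤ → Submodule K X) (B : ℤ → Submodule K Y) (d : ℤ) (L : X →ₗ[K] Y) : Prop :=
  ∀ k, ∀ f ∈ A k, L f ∈ B (k + d)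

theorem Op.add {d : ℤ} {L L' : X →ₗ[K] Y} (h : Op A B d L) (h' : Op A B d L') :
    Op A B d (L + L') := fun k f hf => (B (k + d)).add_mem (h k f hf) (h' k f hf)

theorem Op.sub {d : ℤ} {L L' : X →ₗ[K] Y} (h : Op A B d L) (h' : Op A B d L') :
    Op A B d (L - L') := fun k f hf => (B (k + d)).sub_mem (h k f hf) (h' k f hf)

theorem Op.smul {d : ℤ} {L : X →ₗ[K] Y} (c : K) (h : Op A B d L) :
    Op A B d (c • L) := fun k f hf => (B (k + d)).smul_mem c (h k f hf)

theorem Op.zero {d : ℤ} : Op A B d (0 : X →ₗ[K] Y) := fun k _ _ => (B (k + d)).zero_mem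

theorem Op.sum {ι : Type*} {d : ℤ} (s : Finset ι) {L : ι → (X →ₗ[K] Y)}
    (h : ∀ i ∈ s, Op A B d (L i)) : Op A B d (∑ i ∈ s, L i) := by
  intro k f hf
  rw [LinearMap.sum_apply]
  exact (B (k + d)).sum_mem fun i hi => h i hi k f hf

theorem Op.comp {d e : ℤ} {L : X →ₗ[K] Y} {M : Y →ₗ[K] Z} (hM : Op B D e M) (hL : Op A B d L) :
    Op A D (d + e) (M ∘ₗ L) := fun k f hf => by
  have := hM _ _ (hL k f hf)
  rwa [add_assoc] at this

theorem Op.comp' {d e c : ℤ} {L : X →ₗ[K] Y} {M : Y →ₗ[K] Z} (hM : Op B D e M) (hL : Op A B d L)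
    (h : c = d + e) : Op A D c (M ∘ₗ L) := h ▸ hM.comp hL

theorem Op.mono (hB : Antitone B) {d e : ℤ} (h : e ≤ d) {L : X →ₗ[K] Y} (hL : Op A B d L) :
    Op A B e L := fun k f hf => hB (by omega) (hL k f hf)

theorem Op.id : Op A A 0 (LinearMap.id : X →ₗ[K] X) := fun k f hf => by simpa using hf

end

section
variable {K : Type*} [Field K] {σ τ : Type*}

/-- polynomials all of whose monomials have weight at least `k`. -/
def Fil (K : Type*) [Field K] {σ : Type*} (v : σ → ℤ) (k : ℤ) : Submodule K (MvPolynomial σ K) where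
  carrier := {f | ∀ m, coeff m f ≠ 0 → k ≤ Finsupp.weight v m}
  add_mem' := by
    intro f g hf hg m hm
    by_cases h : coeff m f = 0
    · exact hg m (by simpa [h] using hm)
    · exact hf m h
  zero_mem' := by intro m hm; simp at hm
  smul_mem' := by
    intro c f hf m hm
    exact hf m (by intro h; simp [h] at hm)

theorem mem_Fil (v : σ → ℤ) (k : ℤ) (f : MvPolynomial σ K) :
    f ∈ Fil K v k ↔ ∀ m, coeff m f ≠ 0 → k ≤ Finsupp.weight v m := Iff.rfl

theorem Fil_antitone (v : σ → ℤ) : Antitone (Fil K v) := fun _ _ h _ hf m hm => h.trans (hf m hm)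

theorem monomial_mem_Fil (v : σ → ℤ) (m : σ →₀ ℕ) (a : K) :
    monomial m a ∈ Fil K v (Finsupp.weight v m) := by
  intro m' hm'
  rw [coeff_monomial] at hm'
  split_ifs at hm' with h
  · rw [h]
  · simp at hm'

theorem X_mem_Fil (v : σ → ℤ) (i : σ) : (MvPolynomial.X i : MvPolynomial σ K) ∈ Fil K v (v i) := by
  have := monomial_mem_Fil (K := K) v (Finsupp.single i 1) 1
  rw [Finsupp.weight_single, one_smul] at this
  exact this

theorem C_mem_Fil (v : σ → ℤ) (a : K) : (C a : MvPolynomial σ K) ∈ Fil K v 0 := by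
  have := monomial_mem_Fil (K := K) v 0 a
  simpa using this

theorem mul_mem_Fil (v : σ → ℤ) {a b : ℤ} {f g : MvPolynomial σ K} (hf : f ∈ Fil K v a)
    (hg : g ∈ Fil K v b) : f * g ∈ Fil K v (a + b) := by
  intro m hm
  rw [coeff_mul] at hm
  obtain ⟨x, hx, hx'⟩ := Finset.exists_ne_zero_of_sum_ne_zero hm
  rw [← Finset.HasAntidiagonal.mem_antidiagonal.1 hx, map_add]
  exact add_le_add (hf _ (left_ne_zero_of_mul hx')) (hg _ (right_ne_zero_of_mul hx'))

theorem prod_mem_Fil (v : σ → ℤ) {ρ : Type*} (s : Finset ρ) (f : ρ → MvPolynomial σ K) (a : ρ → ℤ)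
    (h : ∀ i ∈ s, f i ∈ Fil K v (a i)) : ∏ i ∈ s, f i ∈ Fil K v (∑ i ∈ s, a i) := by
  induction s using Finset.induction_on with
  | empty => simpa using C_mem_Fil (K := K) v 1
  | insert i s hi ih =>
    rw [Finset.prod_insert hi, Finset.sum_insert hi]
    exact mul_mem_Fil v (h i (by simp)) (ih fun j hj => h j (by simp [hj]))

theorem pow_mem_Fil (v : σ → ℤ) (f : MvPolynomial σ K) (a : ℤ)
    (h : f ∈ Fil K v a) (n : ℕ) : f ^ n ∈ Fil K v (n * a) := by
  have := prod_mem_Fil v (Finset.range n) (fun _ => f) (fun _ => a) (fun _ _ => h)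
  simpa using this

theorem Op_of_monomial (v : σ → ℤ) {Y : Type*} [AddCommGroup Y] [Module K Y]
    (B : ℤ → Submodule K Y) (hB : Antitone B) (d : ℤ) (L : MvPolynomial σ K →ₗ[K] Y)
    (h : ∀ m, L (monomial m 1) ∈ B (Finsupp.weight v m + d)) : Op (Fil K v) B d L := by
  intro k f hf
  rw [f.as_sum, map_sum]
  refine Submodule.sum_mem _ fun m hm => ?_
  have e : monomial m (coeff m f) = coeff m f • monomial m (1 : K) := by
    rw [smul_monomial, smul_eq_mul, mul_one]
  rw [e, map_smul]
  refine Submodule.smul_mem _ _ (hB ?_ (h m))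
  have := hf m (by simpa using hm)
  omega

theorem Op_aeval (v : σ → ℤ) (w : τ → ℤ) (φ : σ → MvPolynomial τ K)
    (h : ∀ i, φ i ∈ Fil K w (v i)) :
    Op (Fil K v) (Fil K w) 0 (aeval φ : MvPolynomial σ K →ₐ[K] _).toLinearMap := by
  apply Op_of_monomial _ _ (Fil_antitone w)
  intro m
  rw [AlgHom.toLinearMap_apply, aeval_monomial, map_one, one_mul, Finsupp.prod, add_zero,
    Finsupp.weight_apply, Finsupp.sum]
  refine prod_mem_Fil w _ _ _ fun i _ => ?_
  rw [nsmul_eq_mul]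
  exact pow_mem_Fil w _ _ (h i) _

theorem Op_mulLeft (v : σ → ℤ) (a : ℤ) (c : MvPolynomial σ K) (hc : c ∈ Fil K v a) :
    Op (Fil K v) (Fil K v) a (LinearMap.mulLeft K c) := by
  intro k f hf
  rw [add_comm]
  exact mul_mem_Fil v hc hf

theorem Op_dK (v : σ → ℤ) (ι : ℕ ↪ σ) (k : ℕ) :
    Op (Fil K v) (Fil K v) (- v (ι k)) (dK ι k : MvPolynomial σ K →ₗ[K] _) := by
  apply Op_of_monomial _ _ (Fil_antitone v)
  intro m
  rw [dK_apply, pderiv_monomial]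
  refine Submodule.smul_mem _ _ ?_
  by_cases h : m (ι k) = 0
  · simp [h]
  · have e : Finsupp.weight v m + - v (ι k) = Finsupp.weight v (m - Finsupp.single (ι k) 1) := by
      have : m = (m - Finsupp.single (ι k) 1) + Finsupp.single (ι k) 1 := by
        rw [tsub_add_cancel_of_le]
        rw [Finsupp.single_le_iff]
        omega
      conv_lhs => rw [this]
      rw [map_add, Finsupp.weight_single]
      simp
    rw [e]
    exact monomial_mem_Fil _ _ _

theorem Op_Dsum {Y : Type*} [AddCommGroup Y] [Module K Y]
    (B : ℤ → Submodule K Y) (v : σ → ℤ) (ι : ℕ ↪ σ) (V : ℕ → (MvPolynomial σ K →ₗ[K] Y)) (d : ℤ)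
    (h : ∀ k, Op (Fil K v) B (d + v (ι k)) (V k)) : Op (Fil K v) B d (Dsum ι V) := by
  intro n f hf
  obtain ⟨s, hs⟩ := exists_dK_bound ι f
  rw [Dsum_eq_sum ι _ f s hs]
  refine Submodule.sum_mem _ fun k _ => ?_
  have := h k _ _ (Op_dK v ι k n f hf)
  convert this using 2
  ring

/-- the filtration on polynomials in `w`. -/
def FilW (K : Type*) [Field K] {σ : Type*} (s : ℤ) (v : σ → ℤ) (k : ℤ) : Submodule K (W K σ) where
  carrier := {x | ∀ n : ℕ, x n ∈ Fil K v (k - s * ((n : ℤ) + 1))}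
  add_mem' := fun hx hy n => Submodule.add_mem _ (hx n) (hy n)
  zero_mem' := fun _ => Submodule.zero_mem _
  smul_mem' := fun c _ hx n => Submodule.smul_mem _ c (hx n)

theorem FilW_antitone (s : ℤ) (v : σ → ℤ) : Antitone (FilW K s v) :=
  fun _ _ h _ hf n => Fil_antitone v (by omega) (hf n)

theorem Op_lsingle (s : ℤ) (v : σ → ℤ) (n : ℕ) :
    Op (Fil K v) (FilW K s v) (s * (n + 1)) (Finsupp.lsingle n : MvPolynomial σ K →ₗ[K] W K σ) := by
  intro k f hf m
  rw [Finsupp.lsingle_apply, Finsupp.single_apply]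
  split_ifs with h
  · subst h; simpa using hf
  · exact Submodule.zero_mem _

theorem Op_lsingle' (s : ℤ) (v : σ → ℤ) (n : ℕ) (d : ℤ) (h : d = s * (n + 1)) :
    Op (Fil K v) (FilW K s v) d (Finsupp.lsingle n : MvPolynomial σ K →ₗ[K] W K σ) :=
  h ▸ Op_lsingle s v n

theorem Op_W {Y : Type*} [AddCommGroup Y] [Module K Y]
    (B : ℤ → Submodule K Y) (s : ℤ) (v : σ → ℤ) (V : ℕ → (MvPolynomial σ K →ₗ[K] Y)) (d : ℤ)
    (h : ∀ n : ℕ, Op (Fil K v) B (d + s * ((n : ℤ) + 1)) (V n)) : Op (FilW K s v) B d (Finsupp.lsum K V) := by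
  intro k x hx
  rw [Finsupp.lsum_apply, Finsupp.sum]
  refine Submodule.sum_mem _ fun n _ => ?_
  have := h n _ _ (hx n)
  convert this using 2
  ring

theorem Op_mapW (s : ℤ) (v : σ → ℤ) (w : τ → ℤ) (d : ℤ)
    (L : MvPolynomial σ K →ₗ[K] MvPolynomial τ K)
    (h : Op (Fil K v) (Fil K w) d L) : Op (FilW K s v) (FilW K s w) d (mapW L) := by
  intro k x hx n
  have := h _ _ (hx n)
  simp only [mapW, Finsupp.mapRange.linearMap_apply, Finsupp.mapRange_apply]
  convert this using 2
  ring

variable (al : K) (s : ℤ) (v : σ → ℤ) (ι : ℕ ↪ σ) (hv : ∀ n : ℕ, v (ι n) = s * ((n : ℤ) + 1))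

theorem Op_Sop : Op (FilW K s v) (FilW K s v) (-s) (Sop : W K σ →ₗ[K] _) := by
  apply Op_W
  rintro (_ | n)
  · exact Op.zero
  · apply Op_lsingle'
    push_cast
    ring

theorem Op_eps1 : Op (FilW K s v) (Fil K v) (-s) (eps1 : W K σ →ₗ[K] _) := by
  intro k x hx
  have := hx 0
  simpa [eps1, sub_eq_add_neg] using this

include hv

theorem Op_eps : Op (FilW K s v) (Fil K v) 0 (eps ι : W K σ →ₗ[K] _) := by
  apply Op_W
  intro n
  apply Op_mulLeft
  rw [zero_add, ← hv]
  exact X_mem_Fil _ _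

theorem Op_del : Op (Fil K v) (FilW K s v) 0 (del ι : MvPolynomial σ K →ₗ[K] _) := by
  apply Op_Dsum
  intro k
  apply Op_lsingle'
  rw [hv, zero_add]

theorem Op_Mop : Op (FilW K s v) (FilW K s v) 0 (Mop al ι) := by
  apply Op_W
  intro n
  refine Op.add (Op.add (Op.smul _ ?_) ?_) (Op.smul _ ?_)
  · apply Op_lsingle'
    ring
  · cases n with
    | zero => exact Op.zero
    | succ n =>
      refine Op.sum _ fun x hx => ?_
      refine Op.comp' (Op_lsingle s v x.1) (Op_mulLeft v _ _ (X_mem_Fil v _)) ?_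
      have := Finset.HasAntidiagonal.mem_antidiagonal.1 hx
      rw [hv, ← this]
      push_cast
      ring
  · apply Op_Dsum
    intro k
    apply Op_lsingle'
    rw [hv]
    push_cast
    ring

end

section
variable {K : Type*} [Field K] {τ : Type*} (al : K) (s : ℤ) (v : τ → ℤ) (ι κ : ℕ ↪ τ)
  (hι : ∀ n : ℕ, v (ι n) = s * ((n : ℤ) + 1)) (hκ : ∀ n : ℕ, v (κ n) = s * ((n : ℤ) + 1))

/-- weights for the source variables -/
def vP (s : ℤ) : ℕ+ → ℤ := fun i => s * (i : ℕ)

theorem vP_sP (s : ℤ) (n : ℕ) : vP s (sP n) = s * (n + 1) := by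
  simp [vP, sP]

include hι hκ

theorem Op_Ps : Op (Fil K (vP s)) (Fil K v) 0 (PsL ι κ) := by
  apply Op_aeval
  intro i
  obtain ⟨n, rfl⟩ : ∃ n, i = sP n := ⟨PNat.natPred i, by simp [sP]⟩
  have e : PNat.natPred (sP n) = n := by simp [sP]
  rw [vP_sP, e]
  refine Submodule.add_mem _ ?_ ?_
  · rw [← hι]; exact X_mem_Fil _ _
  · rw [← hκ]; exact X_mem_Fil _ _

theorem Op_cP (c : MvPolynomial τ K) (d : ℤ) (hc : c ∈ Fil K v d) :
    Op (Fil K (vP s)) (Fil K v) d (cP ι κ c) :=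
  Op.comp' (Op_mulLeft v d c hc) (Op_Ps s v ι κ hι hκ) (by ring)

theorem Q1_mem (n : ℕ) : (Q1 ι κ n : MvPolynomial τ K) ∈ Fil K v (s * (n + 2)) := by
  refine Submodule.sum_mem _ fun x hx => ?_
  have := Finset.HasAntidiagonal.mem_antidiagonal.1 hx
  have e : s * ((n : ℤ) + 2) = v (ι x.1) + v (κ x.2) := by
    rw [hι, hκ, ← this]; push_cast; ring
  rw [e]
  exact mul_mem_Fil _ (X_mem_Fil _ _) (X_mem_Fil _ _)

theorem Op_F1 : Op (Fil K (vP s)) (Fil K v) s (F1 ι κ) := by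
  apply Op_Dsum
  intro k
  apply Op_cP s v ι κ hι hκ
  have := Q1_mem (K := K) s v ι κ hι hκ k
  rw [vP_sP]
  convert this using 2
  ring

theorem A2c_mem (n : ℕ) : A2c al ι κ n ∈ Fil K v (s * (n + 3)) := by
  refine Submodule.add_mem _ (Submodule.smul_mem _ _ (Submodule.sum_mem _ fun x hx =>
    Submodule.smul_mem _ _ ?_)) (Submodule.sum_mem _ fun x hx => Submodule.sum_mem _ fun y hy =>
    Submodule.smul_mem _ _ (Submodule.add_mem _ ?_ ?_))
  · have := Finset.HasAntidiagonal.mem_antidiagonal.1 hx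
    have e : s * ((n : ℤ) + 3) = v (ι x.1) + v (κ x.2) := by
      rw [hι, hκ, show (n : ℤ) = x.1 + x.2 - 1 by omega]; ring
    rw [e]
    exact mul_mem_Fil _ (X_mem_Fil _ _) (X_mem_Fil _ _)
  · have h1 := Finset.HasAntidiagonal.mem_antidiagonal.1 hx
    have h2 := Finset.HasAntidiagonal.mem_antidiagonal.1 hy
    have e : s * ((n : ℤ) + 3) = v (ι x.1) + v (κ y.1) + v (κ y.2) := by
      rw [hι, hκ, hκ, show (n : ℤ) = x.1 + y.1 + y.2 by omega]; ring
    rw [e]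
    exact mul_mem_Fil _ (mul_mem_Fil _ (X_mem_Fil _ _) (X_mem_Fil _ _)) (X_mem_Fil _ _)
  · have h1 := Finset.HasAntidiagonal.mem_antidiagonal.1 hx
    have h2 := Finset.HasAntidiagonal.mem_antidiagonal.1 hy
    have e : s * ((n : ℤ) + 3) = v (κ x.1) + v (ι y.1) + v (ι y.2) := by
      rw [hκ, hι, hι, show (n : ℤ) = x.1 + y.1 + y.2 by omega]; ring
    rw [e]
    exact mul_mem_Fil _ (mul_mem_Fil _ (X_mem_Fil _ _) (X_mem_Fil _ _)) (X_mem_Fil _ _)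

theorem B2c_mem (m k : ℕ) : B2c al ι κ m k ∈ Fil K v (s * (m + k + 4)) := by
  refine Submodule.add_mem _ (Submodule.smul_mem _ _ (Submodule.sum_mem _ fun x hx =>
    Submodule.smul_mem _ _ ?_)) ?_
  · have := Finset.HasAntidiagonal.mem_antidiagonal.1 hx
    have e : s * ((m : ℤ) + k + 4) = v (ι x.1) + v (κ x.2) := by
      rw [hι, hκ, show (m : ℤ) = x.1 + x.2 - k - 2 by omega]; ring
    rw [e]
    exact mul_mem_Fil _ (X_mem_Fil _ _) (X_mem_Fil _ _)
  · have := mul_mem_Fil _ (Q1_mem (K := K) s v ι κ hι hκ m) (Q1_mem (K := K) s v ι κ hι hκ k)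
    convert this using 2
    ring

theorem Op_F2 : Op (Fil K (vP s)) (Fil K v) (2 * s) (F2 al ι κ) := by
  refine Op.smul _ (Op.add ?_ ?_)
  · apply Op_Dsum
    intro n
    apply Op_cP s v ι κ hι hκ
    have := A2c_mem al s v ι κ hι hκ n
    rw [vP_sP]
    convert this using 2
    ring
  · apply Op_Dsum
    intro k
    apply Op_Dsum
    intro m
    apply Op_cP s v ι κ hι hκ
    have := B2c_mem al s v ι κ hι hκ m k
    rw [vP_sP, vP_sP]
    convert this using 2
    ring

theorem Op_Rop : Op (FilW K s (vP s)) (FilW K s v) s (Rop ι κ) := by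
  apply Op_W
  intro n
  refine Op.sum _ fun x hx => Op.smul _ ?_
  refine Op.comp' (Op_lsingle s v x.1) (Op_cP s v ι κ hι hκ _ _ (X_mem_Fil v _)) ?_
  have := Finset.HasAntidiagonal.mem_antidiagonal.1 hx
  rw [hκ, ← this]
  push_cast
  ring

theorem Op_R2 : Op (FilW K s (vP s)) (FilW K s v) (2 * s) (R2 al ι κ) := by
  apply Op_W
  intro n
  refine Op.add (Op.add (Op.add (Op.add ?_ ?_) ?_) ?_) ?_
  · refine Op.smul _ (Op.sum _ fun x hx => Op.smul _ ?_)
    refine Op.comp' (Op_lsingle s v x.1) (Op_cP s v ι κ hι hκ _ _ (X_mem_Fil v _)) ?_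
    have := Finset.HasAntidiagonal.mem_antidiagonal.1 hx
    rw [hκ, show (n : ℤ) = x.1 + x.2 - 1 by omega]
    ring
  · refine Op.sum _ fun x hx => Op.sum _ fun y hy => Op.smul _ ?_
    refine Op.comp' (Op_lsingle s v x.1) (Op_cP s v ι κ hι hκ _ _
      (mul_mem_Fil _ (X_mem_Fil v _) (X_mem_Fil v _))) ?_
    have h1 := Finset.HasAntidiagonal.mem_antidiagonal.1 hx
    have h2 := Finset.HasAntidiagonal.mem_antidiagonal.1 hy
    rw [hκ, hκ, show (n : ℤ) = x.1 + y.1 + y.2 by omega]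
    ring
  · refine Op.sum _ fun x hx => Op.sum _ fun y hy => Op.smul _ ?_
    refine Op.comp' (Op_lsingle s v x.1) (Op_cP s v ι κ hι hκ _ _
      (mul_mem_Fil _ (X_mem_Fil v _) (X_mem_Fil v _))) ?_
    have h1 := Finset.HasAntidiagonal.mem_antidiagonal.1 hx
    have h2 := Finset.HasAntidiagonal.mem_antidiagonal.1 hy
    rw [hκ, hι, show (n : ℤ) = x.1 + y.1 + y.2 by omega]
    ring
  · refine Op.smul _ (Op_Dsum _ _ _ _ _ fun k => Op.sum _ fun x hx => Op.smul _ ?_)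
    refine Op.comp' (Op_lsingle s v x.1) (Op_cP s v ι κ hι hκ _ _ (X_mem_Fil v _)) ?_
    have := Finset.HasAntidiagonal.mem_antidiagonal.1 hx
    rw [hκ, vP_sP, show (n : ℤ) = x.1 + x.2 - k - 2 by omega]
    ring
  · refine Op.sum _ fun x hx => Op.smul _ ?_
    refine Op.comp' (Op_lsingle s v x.1) (Op.comp (Op_mulLeft v _ _ (X_mem_Fil v _))
      (Op_F1 s v ι κ hι hκ)) ?_
    have := Finset.HasAntidiagonal.mem_antidiagonal.1 hx
    rw [hκ, ← this]
    push_cast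
    ring

end
end JK
end

section
set_option linter.unusedSectionVars false
set_option linter.unusedSimpArgs false
namespace JK
open MvPolynomial Finset

section
variable {K : Type*} [Field K] (al : K) {σ : Type*} (ι : ℕ ↪ σ)

/-- The full Nazarov-Sklyanin type operator. -/
def LamP : W K σ →ₗ[K] W K σ := Sop + Mop al ι
def epsP : W K σ →ₗ[K] MvPolynomial σ K := eps ι + eps1
def Hop (j : ℕ) : MvPolynomial σ K →ₗ[K] MvPolynomial σ K :=
  epsP ι ∘ₗ (LamP al ι ^ j) ∘ₗ del ι

variable (v : σ → ℤ)

theorem Op_pow {s : ℤ} {d : ℤ} {L : W K σ →ₗ[K] W K σ} (h : Op (FilW K s v) (FilW K s v) d L)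
    (j : ℕ) : Op (FilW K s v) (FilW K s v) (j * d) (L ^ j) := by
  induction j with
  | zero =>
    rw [pow_zero, Nat.cast_zero, zero_mul]
    exact Op.id
  | succ j ih =>
    rw [pow_succ']
    refine Op.comp' h ih ?_
    push_cast; ring

theorem Op_Hop_neg (hv : ∀ n : ℕ, v (ι n) = (-1) * ((n : ℤ) + 1)) (j : ℕ) :
    Op (Fil K v) (Fil K v) 0 (Hop al ι j) := by
  have h1 : Op (FilW K (-1) v) (FilW K (-1) v) 0 (LamP al ι) :=
    Op.add ((Op_Sop (-1) v).mono (FilW_antitone _ _) (by norm_num)) (Op_Mop al (-1) v ι hv)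
  have h2 : Op (FilW K (-1) v) (Fil K v) 0 (epsP ι) :=
    Op.add (Op_eps (-1) v ι hv) ((Op_eps1 (-1) v).mono (Fil_antitone _) (by norm_num))
  exact Op.comp' h2 (Op.comp' (Op_pow v h1 j) (Op_del (-1) v ι hv) rfl) (by ring)

variable (hv : ∀ n : ℕ, v (ι n) = 1 * ((n : ℤ) + 1))
include hv

theorem Op_LamP : Op (FilW K 1 v) (FilW K 1 v) (-1) (LamP al ι) :=
  Op.add (Op_Sop 1 v) ((Op_Mop al 1 v ι hv).mono (FilW_antitone _ _) (by norm_num))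

theorem Op_epsP : Op (FilW K 1 v) (Fil K v) (-1) (epsP ι : W K σ →ₗ[K] _) :=
  Op.add ((Op_eps 1 v ι hv).mono (Fil_antitone _) (by norm_num)) (Op_eps1 1 v)

theorem Op_LamP_pow_sub (j : ℕ) :
    Op (FilW K 1 v) (FilW K 1 v) (1 - j) (LamP al ι ^ j - Sop ^ j) := by
  induction j with
  | zero =>
    have e : (LamP al ι ^ 0 - Sop ^ 0) = 0 := LinearMap.ext fun x => sub_self x
    rw [e]
    exact Op.zero
  | succ j ih =>
    have e : (LamP al ι ^ (j + 1) - Sop ^ (j + 1)) =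
        LamP al ι ∘ₗ (LamP al ι ^ j - Sop ^ j) + Mop al ι ∘ₗ (Sop ^ j) := by
      refine LinearMap.ext fun x => ?_
      rw [pow_succ', pow_succ']
      simp only [LinearMap.sub_apply, LinearMap.add_apply, LinearMap.comp_apply,
        Module.End.mul_apply, map_sub]
      generalize (LamP al ι ^ j) x = y
      generalize (Sop ^ j) x = z
      have : LamP al ι z = Sop z + Mop al ι z := rfl
      rw [this]
      abel
    rw [e]
    refine Op.add (Op.comp' (Op_LamP al ι v hv) ih ?_)
      (Op.comp' (Op_Mop al 1 v ι hv) (Op_pow v (Op_Sop 1 v) j) ?_)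
    · push_cast; ring
    · push_cast; ring

omit hv in
theorem eps1_Sop_pow (j : ℕ) (x : W K σ) : eps1 ((Sop ^ j) x) = x j := by
  induction j generalizing x with
  | zero => rfl
  | succ j ih =>
    rw [pow_succ, Module.End.mul_apply, ih]
    induction x using Finsupp.induction_linear with
    | zero => simp
    | add a b ha hb => simp only [map_add, Finsupp.add_apply, ha, hb]
    | single n f =>
      cases n with
      | zero => rw [Sop_zero]; simp
      | succ n => rw [Sop_succ]; simp [Finsupp.single_apply]

omit hv in
theorem del_apply (f : MvPolynomial σ K) (j : ℕ) : del ι f j = dK ι j f := by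
  have : (Finsupp.lapply j : W K σ →ₗ[K] _) (del ι f) = dK ι j f := by
    obtain ⟨s, hs⟩ := exists_dK_bound ι f
    rw [del, Dsum_eq_sum ι _ f (insert j s) (fun k hk => hs k (by grind)), map_sum]
    rw [Finset.sum_eq_single j]
    · simp
    · intro b _ hb; simp [hb]
    · intro h; simp at h
  exact this

theorem Op_Hop_sub (j : ℕ) : Op (Fil K v) (Fil K v) (-j) (Hop al ι j - dK ι j) := by
  have e : Hop al ι j - dK ι j = epsP ι ∘ₗ (LamP al ι ^ j - Sop ^ j) ∘ₗ del ι +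
      eps ι ∘ₗ (Sop ^ j) ∘ₗ del ι := by
    refine LinearMap.ext fun f => ?_
    simp only [Hop, LinearMap.sub_apply, LinearMap.comp_apply, LinearMap.add_apply, map_sub]
    rw [← del_apply, ← eps1_Sop_pow]
    simp only [epsP, LinearMap.add_apply]
    abel
  rw [e]
  refine Op.add (Op.comp' (Op_epsP ι v hv) (Op.comp' (Op_LamP_pow_sub al ι v hv j)
    (Op_del 1 v ι hv) rfl) ?_) (Op.comp' (Op_eps 1 v ι hv) (Op.comp' (Op_pow v (Op_Sop 1 v) j)
    (Op_del 1 v ι hv) rfl) ?_)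
  · ring
  · ring
end

section
variable {K : Type*} [Field K] [CharZero K] (al : K) {τ : Type*} (ι κ : ℕ ↪ τ)

def F2h : W K ℕ+ →ₗ[K] W K τ := mapW (F2 al ι κ) + R2 al ι κ
def Fh : W K ℕ+ →ₗ[K] W K τ := mapW (PsL ι κ) + (mapW (F1 ι κ) + Rop ι κ) + F2h al ι κ
def Ft : SP K →ₗ[K] MvPolynomial τ K := PsL ι κ + F1 ι κ + F2 al ι κ

theorem Ft_symm : Ft al ι κ = Ft al κ ι := by
  rw [Ft, Ft, PsL, PsL, Ps_symm, F1_symm, F2_symm]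

variable (h : ∀ i j, ι i ≠ κ j)
include h

theorem del_Ft (f : SP K) : del ι (Ft al ι κ f) = Fh al ι κ (del sP f) := by
  simp only [Ft, Fh, F2h, LinearMap.add_apply, map_add]
  rw [del_F1 ι κ h, del_F2 al ι κ h]
  have := del_Ps ι κ h f
  rw [← this]; rfl

theorem LamP_Fh (x : W K ℕ+) : LamP al ι (Fh al ι κ x) - Fh al ι κ (LamP al sP x) =
    Mop al ι (F2h al ι κ x) - F2h al ι κ (Mop al sP x) := by
  have h0 := Sop_mapW (PsL ι κ) x
  have h1 := Lam1 al ι κ h x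
  have h1' := Sop_mapW (F1 ι κ) x
  have h2 := Lam2 al ι κ h x
  have h2' := Sop_mapW (F2 al ι κ) x
  simp only [LamP, Fh, F2h, LinearMap.add_apply, map_add] at *
  linear_combination (norm := abel) h0 + h1 + h1' + h2 + h2'

theorem epsP_Fh (x : W K ℕ+) : epsP ι (Fh al ι κ x) - Ft al ι κ (epsP sP x) =
    eps ι (F2h al ι κ x) - F2 al ι κ (eps sP x) := by
  have h0 := eps1_mapW (PsL ι κ) x
  have h1 := eps_F0 ι κ x
  have h1' := eps1_mapW (F1 ι κ) x
  have h2 := eps_F1 al ι κ x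
  have h2' := eps1_mapW (F2 al ι κ) x
  simp only [epsP, Ft, Fh, F2h, LinearMap.add_apply, map_add, AlgHom.toLinearMap_apply] at *
  linear_combination (norm := abel) h0 + h1 + h1' + h2 + h2'

variable (v : τ → ℤ) (hι : ∀ n : ℕ, v (ι n) = 1 * ((n : ℤ) + 1))
  (hκ : ∀ n : ℕ, v (κ n) = 1 * ((n : ℤ) + 1))
include hι hκ

omit h in
theorem Op_F2h : Op (FilW K 1 (vP 1)) (FilW K 1 v) 2 (F2h al ι κ) :=
  Op.add (Op_mapW _ _ _ _ _ (Op_F2 al 1 v ι κ hι hκ)) (Op_R2 al 1 v ι κ hι hκ)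

omit h in
theorem Op_Fh : Op (FilW K 1 (vP 1)) (FilW K 1 v) 0 (Fh al ι κ) := by
  refine Op.add (Op.add ?_ (Op.add ?_ ?_)) ?_
  · exact Op_mapW _ _ _ _ _ (Op_Ps 1 v ι κ hι hκ)
  · exact Op_mapW _ _ _ _ _ ((Op_F1 1 v ι κ hι hκ).mono (Fil_antitone _) (by norm_num))
  · exact (Op_Rop 1 v ι κ hι hκ).mono (FilW_antitone _ _) (by norm_num)
  · exact (Op_F2h al ι κ v hι hκ).mono (FilW_antitone _ _) (by norm_num)

omit h in
theorem Op_Ft : Op (Fil K (vP 1)) (Fil K v) 0 (Ft al ι κ) := by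
  refine Op.add (Op.add ?_ ?_) ?_
  · exact (Op_Ps 1 v ι κ hι hκ)
  · exact ((Op_F1 1 v ι κ hι hκ).mono (Fil_antitone _) (by norm_num))
  · exact ((Op_F2 al 1 v ι κ hι hκ).mono (Fil_antitone _) (by norm_num))

theorem Op_LamP_Fh : Op (FilW K 1 (vP 1)) (FilW K 1 v) 2
    (LamP al ι ∘ₗ Fh al ι κ - Fh al ι κ ∘ₗ LamP al sP) := by
  have e : LamP al ι ∘ₗ Fh al ι κ - Fh al ι κ ∘ₗ LamP al sP =
      Mop al ι ∘ₗ F2h al ι κ - F2h al ι κ ∘ₗ Mop al sP :=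
    LinearMap.ext fun x => LamP_Fh al ι κ h x
  rw [e]
  exact Op.sub (Op.comp' (Op_Mop al 1 v ι hι) (Op_F2h al ι κ v hι hκ) rfl)
    (Op.comp' (Op_F2h al ι κ v hι hκ) (Op_Mop al 1 (vP 1) sP (vP_sP 1)) rfl)

theorem Op_LamP_pow_Fh (j : ℕ) : Op (FilW K 1 (vP 1)) (FilW K 1 v) (3 - j)
    ((LamP al ι ^ j) ∘ₗ Fh al ι κ - Fh al ι κ ∘ₗ (LamP al sP ^ j)) := by
  induction j with
  | zero =>
    have e : (LamP al ι ^ 0) ∘ₗ Fh al ι κ - Fh al ι κ ∘ₗ (LamP al sP ^ 0) = 0 :=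
      LinearMap.ext fun x => sub_self _
    rw [e]
    exact Op.zero
  | succ j ih =>
    have e : ((LamP al ι ^ (j + 1)) ∘ₗ Fh al ι κ - Fh al ι κ ∘ₗ (LamP al sP ^ (j + 1))) =
        LamP al ι ∘ₗ ((LamP al ι ^ j) ∘ₗ Fh al ι κ - Fh al ι κ ∘ₗ (LamP al sP ^ j)) +
        (LamP al ι ∘ₗ Fh al ι κ - Fh al ι κ ∘ₗ LamP al sP) ∘ₗ (LamP al sP ^ j) := by
      refine LinearMap.ext fun x => ?_
      simp only [pow_succ', LinearMap.sub_apply, LinearMap.add_apply, LinearMap.comp_apply,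
        Module.End.mul_apply, map_sub]
      abel
    rw [e]
    refine Op.add (Op.comp' (Op_LamP al ι v hι) ih ?_)
      (Op.comp' (Op_LamP_Fh al ι κ h v hι hκ)
        (Op_pow (vP 1) (Op_LamP al sP (vP 1) (vP_sP 1)) j) ?_)
    · push_cast; ring
    · push_cast; ring

theorem Op_Hop_Ft (j : ℕ) : Op (Fil K (vP 1)) (Fil K v) (2 - j)
    (Hop al ι j ∘ₗ Ft al ι κ - Ft al ι κ ∘ₗ Hop al sP j) := by
  have e : Hop al ι j ∘ₗ Ft al ι κ - Ft al ι κ ∘ₗ Hop al sP j =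
      epsP ι ∘ₗ ((LamP al ι ^ j) ∘ₗ Fh al ι κ - Fh al ι κ ∘ₗ (LamP al sP ^ j)) ∘ₗ del sP +
      (eps ι ∘ₗ F2h al ι κ - F2 al ι κ ∘ₗ eps sP) ∘ₗ (LamP al sP ^ j) ∘ₗ del sP := by
    refine LinearMap.ext fun f => ?_
    simp only [Hop, LinearMap.sub_apply, LinearMap.comp_apply, LinearMap.add_apply, map_sub]
    rw [← epsP_Fh al ι κ h, del_Ft al ι κ h]
    abel
  rw [e]
  have hp := Op_pow (vP 1) (Op_LamP al sP (vP 1) (vP_sP 1)) j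
  refine Op.add (Op.comp' (Op_epsP ι v hι) (Op.comp' (Op_LamP_pow_Fh al ι κ h v hι hκ j)
    (Op_del 1 (vP 1) sP (vP_sP 1)) rfl) ?_)
    (Op.comp' (d := -j) (e := 2) (Op.sub (Op.comp' (Op_eps 1 v ι hι) (Op_F2h al ι κ v hι hκ) rfl)
    (Op.comp' (Op_F2 al 1 v ι κ hι hκ) (Op_eps 1 (vP 1) sP (vP_sP 1)) rfl))
    (Op.comp' hp (Op_del 1 (vP 1) sP (vP_sP 1)) ?_) ?_)
  all_goals ring
end
end JK
end

section
set_option linter.unusedSectionVars false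
set_option linter.unusedSimpArgs false
namespace JK
open MvPolynomial Finset

theorem hall_eq_sum (f g : SymA) (s : Finset Exp) (hs : f.support ⊆ s) :
    hall f g = ∑ m ∈ s, coeff m f * coeff m g * zalpha m := by
  refine Finset.sum_subset hs fun m _ hm => ?_
  rw [notMem_support_iff.1 hm, zero_mul, zero_mul]

/-- the Hall product as a bilinear map -/
def hallB : SymA →ₗ[F] SymA →ₗ[F] F := LinearMap.mk₂ F hall
  (by
    intro f f' g
    rw [hall_eq_sum f g (f.support ∪ f'.support ∪ (f + f').support) (by grind),
      hall_eq_sum f' g (f.support ∪ f'.support ∪ (f + f').support) (by grind),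
      hall_eq_sum (f + f') g (f.support ∪ f'.support ∪ (f + f').support) (by grind),
      ← Finset.sum_add_distrib]
    refine Finset.sum_congr rfl fun m _ => ?_
    rw [coeff_add]; ring)
  (by
    intro c f g
    rw [hall_eq_sum f g (f.support ∪ (c • f).support) (by grind),
      hall_eq_sum (c • f) g (f.support ∪ (c • f).support) (by grind), Finset.smul_sum]
    refine Finset.sum_congr rfl fun m _ => ?_
    rw [coeff_smul, smul_eq_mul, smul_eq_mul]; ring)
  (by
    intro f g g'
    simp only [hall, ← Finset.sum_add_distrib]
    refine Finset.sum_congr rfl fun m _ => ?_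
    rw [coeff_add]; ring)
  (by
    intro c f g
    simp only [hall, Finset.smul_sum]
    refine Finset.sum_congr rfl fun m _ => ?_
    rw [coeff_smul, smul_eq_mul, smul_eq_mul]; ring)

theorem hallB_apply (f g : SymA) : hallB f g = hall f g := rfl

theorem hall_comm (f g : SymA) : hall f g = hall g f := by
  rw [hall_eq_sum f g (f.support ∪ g.support) (by grind),
    hall_eq_sum g f (f.support ∪ g.support) (by grind)]
  refine Finset.sum_congr rfl fun m _ => ?_
  ring

theorem hallB_comm (f g : SymA) : hallB f g = hallB g f := hall_comm f g

theorem hallB_monomial (m : Exp) (a : F) (g : SymA) :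
    hallB (monomial m a) g = a * coeff m g * zalpha m := by
  rw [hallB_apply, hall_eq_sum _ g {m} support_monomial_subset]
  simp

theorem zalpha_add_single (m : Exp) (k : ℕ) : zalpha (m + Finsupp.single (sP k) 1) =
    zalpha m * (alpha * (((m (sP k) : F) + 1) * ((k : F) + 1))) := by
  unfold zalpha
  have hsum : ((m + Finsupp.single (sP k) 1).sum fun _ k => k) = (m.sum fun _ k => k) + 1 := by
    rw [Finsupp.sum_add_index' (by simp) (by simp)]
    simp
  have hprod : ((m + Finsupp.single (sP k) 1).prod fun i k =>
      (Nat.factorial k : ℚ) * ((i : ℕ) : ℚ) ^ k) = (m.prod fun i k =>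
      (Nat.factorial k : ℚ) * ((i : ℕ) : ℚ) ^ k) * (((m (sP k) : ℚ) + 1) * ((k : ℚ) + 1)) := by
    set s : Finset ℕ+ := insert (sP k) m.support with hs
    rw [Finsupp.prod_of_support_subset m (s := s) (by grind) _ (by simp),
      Finsupp.prod_of_support_subset (m + Finsupp.single (sP k) 1) (s := s) (by
        intro i hi
        by_contra hc
        simp only [hs, Finset.mem_insert, not_or, Finsupp.mem_support_iff, not_not] at hc
        simp [hc.2, Finsupp.single_apply, hc.1, Ne.symm hc.1] at hi
        ) _ (by simp)]
    have hm : sP k ∈ s := by simp [hs]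
    rw [← Finset.mul_prod_erase s _ hm, ← Finset.mul_prod_erase s _ hm]
    have e : ∏ x ∈ s.erase (sP k), ((Nat.factorial ((m + Finsupp.single (sP k) 1 : Exp) x) : ℚ) *
        ((x : ℕ) : ℚ) ^ ((m + Finsupp.single (sP k) 1 : Exp) x)) =
        ∏ x ∈ s.erase (sP k), ((Nat.factorial (m x) : ℚ) * ((x : ℕ) : ℚ) ^ (m x)) := by
      refine Finset.prod_congr rfl fun x hx => ?_
      have : (m + Finsupp.single (sP k) 1 : Exp) x = m x := by
        simp [Finsupp.single_apply, (Finset.ne_of_mem_erase hx).symm]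
      rw [this]
    rw [e]
    have e2 : (m + Finsupp.single (sP k) 1 : Exp) (sP k) = m (sP k) + 1 := by simp
    rw [e2, Nat.factorial_succ, pow_succ]
    have e3 : ((sP k : ℕ+) : ℕ) = k + 1 := rfl
    rw [e3]
    push_cast
    ring
  rw [hsum, hprod, map_mul, pow_succ]
  simp only [map_mul, map_add, map_natCast, map_one]
  ring

theorem hallB_X_mul (k : ℕ) (f g : SymA) :
    hallB (X (sP k) * f) g = alpha * hallB f (dK sP k g) := by
  have : hallB.flip g ∘ₗ LinearMap.mulLeft F (X (sP k)) =
      alpha • (hallB.flip (dK sP k g)) := by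
    refine MvPolynomial.linearMap_ext fun m => LinearMap.ext_ring ?_
    simp only [LinearMap.comp_apply, LinearMap.mulLeft_apply, LinearMap.flip_apply,
      LinearMap.smul_apply, smul_eq_mul]
    rw [mul_comm (X (sP k)), show monomial m (1 : F) * X (sP k) = monomial (m + Finsupp.single (sP k) 1) 1 by
      rw [monomial_add_single, pow_one]]
    rw [hallB_monomial, hallB_monomial, zalpha_add_single, dK_apply, coeff_smul, coeff_pderiv]
    simp only [smul_eq_mul]
    ring
  have := LinearMap.congr_fun this f
  simpa using this

/-- the induced bilinear form on `W` -/
def wB : W F ℕ+ →ₗ[F] W F ℕ+ →ₗ[F] F :=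
  Finsupp.lsum F (fun n => hallB.compl₂ (Finsupp.lapply n))

theorem wB_sg (n : ℕ) (f : SymA) (y : W F ℕ+) : wB (sg n f) y = hallB f (y n) := by
  simp [wB]

theorem wB_sg_right (n : ℕ) (f : SymA) (x : W F ℕ+) : wB x (sg n f) = hallB (x n) f := by
  induction x using Finsupp.induction_linear with
  | zero => simp
  | add a b ha hb => rw [map_add, LinearMap.add_apply, ha, hb]; simp
  | single m g =>
    rw [wB_sg, Finsupp.single_apply, Finsupp.single_apply]
    split_ifs with h1 h2 h2
    · rfl
    · exact absurd h1.symm h2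
    · exact absurd h2.symm h1
    · simp

theorem Mop_coeff (n m : ℕ) (f : SymA) : Mop alpha sP (sg n f) m =
    if m = n then ((alpha - 1) * ((n : F) + 1)) • f else
      if m < n then X (sP (n - 1 - m)) * f else alpha • dK sP (m - n - 1) f := by
  rw [Mop_sg]
  have h3 : (Dsum sP (fun k => (Finsupp.lsingle (n + 1 + k) : SymA →ₗ[F] W F ℕ+)) f) m =
      if n < m then dK sP (m - n - 1) f else 0 := by
    have : (Finsupp.lapply m : W F ℕ+ →ₗ[F] _)
        (Dsum sP (fun k => (Finsupp.lsingle (n + 1 + k) : SymA →ₗ[F] W F ℕ+)) f) =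
        if n < m then dK sP (m - n - 1) f else 0 := by
      obtain ⟨s, hs⟩ := exists_dK_bound sP f
      rw [Dsum_eq_sum sP _ f (insert (m - n - 1) s) (fun k hk => hs k (by grind)), map_sum]
      rw [Finset.sum_eq_single (m - n - 1)]
      · simp only [Finsupp.lsingle_apply, Finsupp.lapply_apply, Finsupp.single_apply]
        split_ifs <;> first | rfl | omega
      · intro b _ hb
        simp only [Finsupp.lsingle_apply, Finsupp.lapply_apply, Finsupp.single_apply]
        rw [if_neg (by omega)]
      · intro h; simp at h
    exact this
  have h2 : (pPart sP n f : W F ℕ+) m = if m < n then X (sP (n - 1 - m)) * f else 0 := by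
    cases n with
    | zero => rw [pPart_zero]; simp
    | succ n =>
      rw [pPart_succ, Finsupp.finsetSum_apply]
      split_ifs with h
      · rw [Finset.sum_eq_single (m, n - m)]
        · simp only [Finsupp.single_apply, if_true]; rw [show n + 1 - 1 - m = n - m by omega]
        · intro b hb hb'
          have := Finset.HasAntidiagonal.mem_antidiagonal.1 hb
          rw [Finsupp.single_apply, if_neg]
          intro e; apply hb'; ext <;> simp <;> omega
        · intro h'
          exact absurd (Finset.HasAntidiagonal.mem_antidiagonal.2 (by simp; omega)) h'
      · refine Finset.sum_eq_zero fun b hb => ?_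
        have := Finset.HasAntidiagonal.mem_antidiagonal.1 hb
        rw [Finsupp.single_apply, if_neg (by omega)]
  simp only [Finsupp.add_apply, Finsupp.smul_apply, h2, h3, Finsupp.single_apply]
  rcases lt_trichotomy m n with h | h | h
  · rw [if_neg (by omega), if_pos h, if_neg (by omega), if_neg (by omega), if_pos h]; simp
  · subst h; simp
  · rw [if_neg (by omega), if_neg (by omega), if_pos h, if_neg (by omega), if_neg (by omega)]; simp

theorem wB_Mop (x y : W F ℕ+) : wB (Mop alpha sP x) y = wB x (Mop alpha sP y) := by
  have : wB ∘ₗ Mop alpha sP = wB.compl₂ (Mop alpha sP) := by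
    refine W_ext fun n f => W_ext fun m g => ?_
    simp only [LinearMap.comp_apply, LinearMap.compl₂_apply]
    rw [wB_sg, wB_sg_right, Mop_coeff, Mop_coeff]
    rcases lt_trichotomy m n with h | h | h
    · rw [if_neg (by omega), if_pos h, if_neg (by omega), if_neg (by omega), hallB_X_mul,
        map_smul, smul_eq_mul, show n - 1 - m = n - m - 1 by omega]
    · subst h; simp
    · rw [if_neg (by omega), if_neg (by omega), if_neg (by omega), if_pos (by omega),
        hallB_comm f, hallB_X_mul, map_smul, LinearMap.smul_apply, smul_eq_mul, hallB_comm g,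
        show m - 1 - n = m - n - 1 by omega]
  exact LinearMap.congr_fun (LinearMap.congr_fun this x) y

theorem hallB_eps (f : SymA) (y : W F ℕ+) : hallB f (eps sP y) = alpha * wB (del sP f) y := by
  have : hallB f ∘ₗ eps sP = alpha • wB (del sP f) := by
    refine W_ext fun n g => ?_
    rw [LinearMap.comp_apply, eps_sg, hallB_comm, hallB_X_mul, LinearMap.smul_apply, wB_sg_right,
      del_apply, smul_eq_mul, hallB_comm]
  exact LinearMap.congr_fun this y

theorem wB_comm (x y : W F ℕ+) : wB x y = wB y x := by
  have : wB = wB.flip := by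
    refine W_ext fun n f => LinearMap.ext fun y => ?_
    rw [LinearMap.flip_apply, wB_sg, wB_sg_right, hallB_comm]
  exact LinearMap.congr_fun (LinearMap.congr_fun this x) y

/-- commuting operators diagonalised by Jack polynomials -/
def Top (j : ℕ) : SymA →ₗ[F] SymA := eps sP ∘ₗ (Mop alpha sP ^ j) ∘ₗ del sP

theorem wB_Mop_pow (j : ℕ) (x y : W F ℕ+) :
    wB ((Mop alpha sP ^ j) x) y = wB x ((Mop alpha sP ^ j) y) := by
  induction j generalizing x y with
  | zero => rfl
  | succ j ih =>
    rw [pow_succ', Module.End.mul_apply, wB_Mop, ih, ← Module.End.mul_apply, ← pow_succ, pow_succ']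

theorem hallB_Top (j : ℕ) (f g : SymA) : hallB (Top j f) g = hallB f (Top j g) := by
  rw [hallB_comm]
  simp only [Top, LinearMap.comp_apply]
  rw [hallB_eps, hallB_eps, wB_comm, wB_Mop_pow]

/-! definiteness -/

def Pos (x : F) : Prop := ∃ p q : Polynomial ℚ, 0 < p.leadingCoeff ∧ 0 < q.leadingCoeff ∧
  x = algebraMap (Polynomial ℚ) F p / algebraMap (Polynomial ℚ) F q

theorem lc_add_pos {p q : Polynomial ℚ} (hp : 0 < p.leadingCoeff) (hq : 0 < q.leadingCoeff) :
    0 < (p + q).leadingCoeff := by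
  rcases lt_trichotomy p.degree q.degree with h | h | h
  · rwa [Polynomial.leadingCoeff_add_of_degree_lt h]
  · rw [Polynomial.leadingCoeff_add_of_degree_eq h (by positivity)]; positivity
  · rwa [Polynomial.leadingCoeff_add_of_degree_lt' h]

theorem am_ne {p : Polynomial ℚ} (hp : 0 < p.leadingCoeff) : algebraMap (Polynomial ℚ) F p ≠ 0 := by
  intro h
  have : p = 0 := by
    apply RatFunc.algebraMap_injective ℚ
    rw [h, map_zero]
  simp [this] at hp

theorem Pos.ne_zero {x : F} (h : Pos x) : x ≠ 0 := by
  obtain ⟨p, q, hp, hq, rfl⟩ := h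
  exact div_ne_zero (am_ne hp) (am_ne hq)

theorem Pos.mul {x y : F} (hx : Pos x) (hy : Pos y) : Pos (x * y) := by
  obtain ⟨p, q, hp, hq, rfl⟩ := hx
  obtain ⟨p', q', hp', hq', rfl⟩ := hy
  refine ⟨p * p', q * q', ?_, ?_, ?_⟩
  · rw [Polynomial.leadingCoeff_mul]; positivity
  · rw [Polynomial.leadingCoeff_mul]; positivity
  · rw [map_mul, map_mul, div_mul_div_comm]

theorem Pos.add {x y : F} (hx : Pos x) (hy : Pos y) : Pos (x + y) := by
  obtain ⟨p, q, hp, hq, rfl⟩ := hx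
  obtain ⟨p', q', hp', hq', rfl⟩ := hy
  refine ⟨p * q' + q * p', q * q', ?_, ?_, ?_⟩
  · apply lc_add_pos <;> rw [Polynomial.leadingCoeff_mul] <;> positivity
  · rw [Polynomial.leadingCoeff_mul]; positivity
  · rw [map_mul, map_add, map_mul, map_mul, div_add_div _ _ (am_ne hq) (am_ne hq')]

theorem Pos_alpha : Pos alpha := by
  refine ⟨Polynomial.X, 1, by simp, by simp, ?_⟩
  simp [alpha]

theorem Pos_rat (c : ℚ) (hc : 0 < c) : Pos (algebraMap ℚ F c) := by
  refine ⟨Polynomial.C c, 1, by simpa, by simp, ?_⟩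
  simp [RatFunc.algebraMap_eq_C]

theorem Pos_one : Pos 1 := by
  have := Pos_rat 1 one_pos
  rwa [map_one] at this

theorem Pos.pow {x : F} (h : Pos x) (n : ℕ) : Pos (x ^ n) := by
  induction n with
  | zero => rw [pow_zero]; exact Pos_one
  | succ n ih => rw [pow_succ]; exact ih.mul h

theorem Pos_sq {x : F} (h : x ≠ 0) : Pos (x * x) := by
  have h1 : x.num ≠ 0 := RatFunc.num_ne_zero h
  refine ⟨x.num * x.num, x.denom * x.denom, ?_, ?_, ?_⟩
  · rw [Polynomial.leadingCoeff_mul]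
    have : x.num.leadingCoeff ≠ 0 := by simpa using h1
    exact mul_self_pos.2 this
  · rw [Polynomial.leadingCoeff_mul]
    have : x.denom.leadingCoeff ≠ 0 := by simpa using x.denom_ne_zero
    exact mul_self_pos.2 this
  · rw [map_mul, map_mul, ← div_mul_div_comm, RatFunc.num_div_denom]

theorem Pos_zalpha (m : Exp) : Pos (zalpha m) := by
  refine (Pos_rat _ ?_).mul (Pos_alpha.pow _)
  refine Finset.prod_pos fun i _ => ?_
  have := i.pos
  positivity

theorem Pos_sum {ι : Type*} (s : Finset ι) (hs : s.Nonempty) (f : ι → F) (h : ∀ i ∈ s, Pos (f i)) :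
    Pos (∑ i ∈ s, f i) := by
  induction hs using Finset.Nonempty.cons_induction with
  | singleton a => simpa using h a (by simp)
  | cons a s ha hs ih =>
    rw [Finset.sum_cons]
    exact (h a (by simp)).add (ih fun i hi => h i (by simp [hi]))

theorem hall_self_ne_zero {f : SymA} (hf : f ≠ 0) : hall f f ≠ 0 := by
  apply Pos.ne_zero
  refine Pos_sum _ ?_ _ fun m hm => ?_
  · rwa [Finset.nonempty_iff_ne_empty, Ne, MvPolynomial.support_eq_empty]
  · exact (Pos_sq (by simpa using hm)).mul (Pos_zalpha m)

end JK
end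

section
set_option linter.unusedSectionVars false
set_option linter.unusedSimpArgs false
namespace JK
open MvPolynomial Finset

/-- The partition formed by the nonzero entries of an exponent vector. -/
def partOf {N : ℕ} (η : Fin N →₀ ℕ) : JPartition := η.support.val.map (fun i => (η i).toPNat')

theorem partOf_coe {N : ℕ} (η : Fin N →₀ ℕ) :
    (partOf η).map (fun i : ℕ+ => (i : ℕ)) = η.support.val.map η := by
  rw [partOf, Multiset.map_map]
  refine Multiset.map_congr rfl fun i hi => ?_
  have : 0 < η i := Nat.pos_of_ne_zero (by simpa using hi)
  simp [PNat.toPNat'_coe, this]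

theorem part_ext {l m : JPartition}
    (h : l.map (fun i : ℕ+ => (i : ℕ)) = m.map (fun i : ℕ+ => (i : ℕ))) : l = m :=
  Multiset.map_injective PNat.coe_injective h

theorem coe_aux (l : JPartition) :
    (Multiset.map (fun i => i) (do let a ← l; pure (a : ℕ)) : Multiset ℕ) =
      l.map (fun i : ℕ+ => (i : ℕ)) := by
  simp only [Multiset.bind_def, Multiset.pure_def, Multiset.bind_singleton, Multiset.map_id']

theorem psize_eq (l : JPartition) : psize l = (l.map (fun i : ℕ+ => (i : ℕ))).sum := by
  rw [psize]
  exact congrArg Multiset.sum (coe_aux l)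

theorem sortedParts_coe (l : JPartition) :
    (sortedParts l : Multiset ℕ) = l.map (fun i : ℕ+ => (i : ℕ)) := by
  rw [sortedParts, Multiset.coe_reverse, Multiset.sort_eq]
  exact coe_aux l

theorem sortedParts_pairwise (l : JPartition) : (sortedParts l).Pairwise (fun a b => b ≤ a) := by
  rw [sortedParts, List.pairwise_reverse]
  exact Multiset.pairwise_sort _ _

theorem sortedParts_length (l : JPartition) : (sortedParts l).length = plen l := by
  rw [← Multiset.coe_card, sortedParts_coe, Multiset.card_map, plen]

theorem sortedParts_pos (l : JPartition) : ∀ a ∈ sortedParts l, 0 < a := by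
  intro a ha
  rw [← Multiset.mem_coe, sortedParts_coe, Multiset.mem_map] at ha
  obtain ⟨i, _, rfl⟩ := ha
  exact i.pos

theorem sum_le_take (L : List ℕ) (hL : L.Pairwise (fun a b => b ≤ a)) (k : ℕ) (t : Multiset ℕ)
    (ht : t ≤ (L : Multiset ℕ)) (hk : Multiset.card t ≤ k) : t.sum ≤ (L.take k).sum := by
  induction L generalizing k t with
  | nil =>
    have : t = 0 := by simpa using ht
    simp [this]
  | cons a L ih =>
    rw [List.pairwise_cons] at hL
    cases k with
    | zero =>
      have : t = 0 := by simpa using hk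
      simp [this]
    | succ k =>
      rw [List.take_succ_cons, List.sum_cons]
      rw [← Multiset.cons_coe] at ht
      by_cases ha : a ∈ t
      · obtain ⟨t', rfl⟩ := Multiset.exists_cons_of_mem ha
        rw [Multiset.sum_cons]
        have := ih hL.2 k t' ((Multiset.cons_le_cons_iff a).1 ht) (by simpa using hk)
        omega
      · have ht' := (Multiset.le_cons_of_notMem ha).1 ht
        rcases Multiset.empty_or_exists_mem t with h0 | ⟨x, hx⟩
        · simp [h0]
        · obtain ⟨t', rfl⟩ := Multiset.exists_cons_of_mem hx
          rw [Multiset.sum_cons]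
          have := ih hL.2 k t' ((Multiset.le_cons_self _ _).trans ht') (by simpa using hk)
          have hxa := hL.1 x (by simpa using Multiset.mem_of_le ht' hx)
          omega

theorem sum_le_topSum (l : JPartition) (k : ℕ) (t : Multiset ℕ)
    (ht : t ≤ l.map (fun i : ℕ+ => (i : ℕ))) (hk : Multiset.card t ≤ k) :
    t.sum ≤ topSum l k :=
  sum_le_take _ (sortedParts_pairwise l) k t (by rwa [sortedParts_coe]) hk

theorem topSum_mono (l : JPartition) {j k : ℕ} (h : j ≤ k) : topSum l j ≤ topSum l k := by
  have := sum_le_topSum l k (((sortedParts l).take j : List ℕ) : Multiset ℕ) ?_ ?_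
  · simpa [topSum] using this
  · rw [← sortedParts_coe, Multiset.coe_le]
    exact ⟨_, List.Perm.refl _, List.take_sublist _ _⟩
  · simp; omega

theorem exists_map_eq {α β : Type*} (f : α → β) (s : Multiset α) (t : Multiset β)
    (h : t ≤ s.map f) : ∃ u ≤ s, u.map f = t := by
  induction s using Quotient.inductionOn with
  | _ l =>
  induction t using Quotient.inductionOn with
  | _ k =>
  obtain ⟨k', hk, hk'⟩ : List.Subperm k (l.map f) := h
  obtain ⟨l', hl', rfl⟩ := List.sublist_map_iff.1 hk'
  exact ⟨l', Multiset.coe_le.2 ⟨l', List.Perm.refl _, hl'⟩, Quotient.sound hk⟩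

theorem partOf_psize {N : ℕ} (η : Fin N →₀ ℕ) : psize (partOf η) = ∑ i, η i := by
  rw [psize_eq, partOf_coe]
  change ∑ i ∈ η.support, η i = _
  refine Finset.sum_subset (Finset.subset_univ _) fun i _ hi => by simpa using hi

theorem sum_le_topSum_partOf {N : ℕ} (η : Fin N →₀ ℕ) (S : Finset (Fin N)) :
    ∑ i ∈ S, η i ≤ topSum (partOf η) S.card := by
  have h1 : ∑ i ∈ S, η i = ∑ i ∈ S ∩ η.support, η i := by
    symm
    refine Finset.sum_subset Finset.inter_subset_left fun i hi hi' => ?_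
    by_contra h
    exact hi' (by simp [hi, h])
  rw [h1]
  apply sum_le_topSum
  · rw [partOf_coe]
    exact Multiset.map_le_map (Finset.val_le_iff.2 Finset.inter_subset_right)
  · rw [Multiset.card_map]
    exact Finset.card_le_card Finset.inter_subset_left

theorem exists_topSum_partOf {N : ℕ} (η : Fin N →₀ ℕ) (k : ℕ) :
    ∃ S : Finset (Fin N), S.card ≤ k ∧ ∑ i ∈ S, η i = topSum (partOf η) k := by
  have : (((sortedParts (partOf η)).take k : List ℕ) : Multiset ℕ) ≤ η.support.val.map η := by
    rw [← partOf_coe, ← sortedParts_coe, Multiset.coe_le]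
    exact ⟨_, List.Perm.refl _, List.take_sublist _ _⟩
  obtain ⟨u, hu, hu'⟩ := exists_map_eq _ _ _ this
  refine ⟨⟨u, Multiset.nodup_of_le hu η.support.nodup⟩, ?_, ?_⟩
  · change Multiset.card u ≤ k
    have := congrArg Multiset.card hu'
    rw [Multiset.card_map] at this
    rw [this]; simp
  · change (u.map η).sum = _
    rw [hu', topSum]; simp

/-- Dominance condition on exponent vectors. -/
def PD (lam : JPartition) {N : ℕ} (η : Fin N →₀ ℕ) : Prop :=
  ∑ i, η i = psize lam ∧ ∀ S : Finset (Fin N), ∑ i ∈ S, η i ≤ topSum lam S.card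

theorem dominates_iff {N : ℕ} (η : Fin N →₀ ℕ) (lam : JPartition) :
    dominates (partOf η) lam ↔ PD lam η := by
  constructor
  · rintro ⟨h1, h2⟩
    exact ⟨by rw [← partOf_psize, h1], fun S => (sum_le_topSum_partOf η S).trans (h2 _)⟩
  · rintro ⟨h1, h2⟩
    refine ⟨by rw [partOf_psize, h1], fun k => ?_⟩
    obtain ⟨S, hS, hS'⟩ := exists_topSum_partOf η k
    rw [← hS']
    exact (h2 S).trans (topSum_mono _ hS)

theorem list_eq_of_take_sum (L M : List ℕ) (hL : ∀ a ∈ L, 0 < a) (hM : ∀ a ∈ M, 0 < a)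
    (h : ∀ k, (L.take k).sum = (M.take k).sum) : L = M := by
  induction L generalizing M with
  | nil =>
    cases M with
    | nil => rfl
    | cons b M =>
      have := h 1
      have := hM b (by simp)
      simp at *
      omega
  | cons a L ih =>
    cases M with
    | nil =>
      have := h 1
      have := hL a (by simp)
      simp at *
      omega
    | cons b M =>
      have h1 := h 1
      simp at h1
      subst h1
      congr 1
      apply ih
      · intro x hx; exact hL x (by simp [hx])
      · intro x hx; exact hM x (by simp [hx])
      · intro k
        have := h (k + 1)
        simpa using this

theorem dominates_antisymm {l m : JPartition} (h : dominates l m) (h' : dominates m l) : l = m := by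
  apply part_ext
  rw [← sortedParts_coe, ← sortedParts_coe]
  congr 1
  exact list_eq_of_take_sum _ _ (sortedParts_pos l) (sortedParts_pos m)
    (fun k => le_antisymm (h.2 k) (h'.2 k))

theorem dominates_refl (l : JPartition) : dominates l l := ⟨rfl, fun _ => le_rfl⟩

theorem dominates_trans {l m n : JPartition} (h : dominates l m) (h' : dominates m n) :
    dominates l n := ⟨h.1.trans h'.1, fun k => (h.2 k).trans (h'.2 k)⟩

theorem partOf_xexp (m : JPartition) (N : ℕ) (hN : plen m ≤ N) : partOf (xexp m N) = m := by
  apply part_ext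
  rw [partOf_coe, ← sortedParts_coe]
  set L := sortedParts m with hL
  have hlen : L.length ≤ N := by rw [sortedParts_length]; exact hN
  have e1 : (xexp m N).support.val.map (xexp m N) =
      ((Finset.univ : Finset (Fin N)).val.map (xexp m N)).filter (fun x => x ≠ 0) := by
    rw [Multiset.filter_map]
    congr 1
    have : (xexp m N).support = Finset.univ.filter (fun i => xexp m N i ≠ 0) := by
      ext i; simp
    rw [this]; rfl
  have e2 : ((Finset.univ : Finset (Fin N)).val.map (xexp m N)) =
      ((L ++ List.replicate (N - L.length) 0 : List ℕ) : Multiset ℕ) := by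
    have : (Finset.univ : Finset (Fin N)).val.map (xexp m N) =
        ((List.ofFn (fun j : Fin N => L.getD j 0) : List ℕ) : Multiset ℕ) := by
      rw [Fin.univ_val_map]; rfl
    rw [this]
    congr 1
    apply List.ext_getElem
    · simp; omega
    · intro i h1 h2
      simp only [List.getElem_ofFn]
      by_cases hi : i < L.length
      · rw [List.getElem_append_left hi]; simp [hi]
      · rw [List.getElem_append_right (by omega)]; simp [hi]
  rw [e1, e2, Multiset.filter_coe, List.filter_append]
  have e3 : (List.replicate (N - L.length) 0).filter (fun x : ℕ => decide (x ≠ 0)) = [] := by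
    rw [List.filter_eq_nil_iff]; intro a ha; simp at ha; simp [ha.2]
  have e4 : L.filter (fun x : ℕ => decide (x ≠ 0)) = L := by
    rw [List.filter_eq_self]; intro a ha
    have := sortedParts_pos m a ha
    simp; omega
  rw [e3, e4, List.append_nil]

/-- monomial coefficient functional -/
def mc (m : JPartition) : SymA →ₗ[F] F :=
  (MvPolynomial.lcoeff F (xexp m (plen m))) ∘ₗ (evalN (plen m)).toLinearMap

theorem mc_apply (m : JPartition) (f : SymA) :
    mc m f = coeff (xexp m (plen m)) (evalN (plen m) f) := rfl

theorem evalN_X (N : ℕ) (i : ℕ+) : evalN N (X i) = ∑ j : Fin N, X j ^ (i : ℕ) := by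
  simp [evalN]

theorem killCompl_evalN {M N : ℕ} (e : Fin M → Fin N) (he : Function.Injective e) (f : SymA) :
    killCompl he (evalN N f) = evalN M f := by
  have : (killCompl he).comp (evalN N) = evalN M := by
    apply MvPolynomial.algHom_ext
    intro i
    rw [AlgHom.comp_apply, evalN_X, evalN_X, map_sum]
    have hs : ∑ j : Fin N, killCompl he (X j ^ (i : ℕ) : MvPolynomial (Fin N) F) =
        ∑ j ∈ Finset.univ.map ⟨e, he⟩, killCompl he (X j ^ (i : ℕ) : MvPolynomial (Fin N) F) := by
      symm
      refine Finset.sum_subset (Finset.subset_univ _) fun j _ hj => ?_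
      have : killCompl he (X j : MvPolynomial (Fin N) F) = 0 := by
        rw [killCompl, aeval_X, dif_neg]
        intro ⟨k, hk⟩
        exact hj (by simp [← hk])
      rw [map_pow, this, zero_pow i.ne_zero]
    rw [hs, Finset.sum_map]
    refine Finset.sum_congr rfl fun j _ => ?_
    have : killCompl he (X (e j) : MvPolynomial (Fin N) F) = X j := by
      rw [← rename_X, killCompl_rename_app]
    simp [this]
  exact AlgHom.congr_fun this f

theorem coeff_evalN {N : ℕ} (η : Fin N →₀ ℕ) (f : SymA) :
    coeff η (evalN N f) = mc (partOf η) f := by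
  set m := partOf η with hm
  let L : List (Fin N) := η.support.toList.mergeSort (fun a b => decide (η b ≤ η a))
  have hperm : L.Perm η.support.toList := List.mergeSort_perm _ _
  have hsorted : L.Pairwise (fun a b => η b ≤ η a) := by
    have := List.pairwise_mergeSort (le := fun a b => decide (η b ≤ η a))
      (by intro a b c; simp; omega) (by intro a b; simp; omega) η.support.toList
    refine this.imp ?_
    intro a b h; simpa using h
  have hmap : L.map η = sortedParts m := by
    have hp : (L.map η).Perm (sortedParts m) := by
      rw [← Multiset.coe_eq_coe, sortedParts_coe, partOf_coe, ← Multiset.map_coe]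
      congr 1
      rw [Multiset.coe_eq_coe.2 hperm, Finset.coe_toList]
    refine hp.eq_of_pairwise' (r := fun a b => b ≤ a) ?_ (sortedParts_pairwise m)
    rw [List.pairwise_map]; exact hsorted
  have hlen : L.length = plen m := by
    rw [← sortedParts_length, ← hmap, List.length_map]
  have hnd : L.Nodup := hperm.nodup_iff.2 (Finset.nodup_toList _)
  let e : Fin (plen m) → Fin N := fun j => L[(j : ℕ)]'(by rw [hlen]; exact j.2)
  have he : Function.Injective e := by
    intro a b hab
    have := (hnd.getElem_inj_iff).1 hab
    exact Fin.ext this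
  rw [mc_apply, ← killCompl_evalN e he, coeff_killCompl]
  congr 1
  ext i
  by_cases hi : i ∈ Set.range e
  · obtain ⟨j, rfl⟩ := hi
    rw [Finsupp.mapDomain_apply he]
    change η (L[(j : ℕ)]'_) = (sortedParts m).getD (j : ℕ) 0
    rw [← hmap]
    rw [List.getD_eq_getElem _ _ (by rw [List.length_map, hlen]; exact j.2)]
    simp
  · rw [Finsupp.mapDomain_of_notMem_range _ _ hi]
    by_contra h
    apply hi
    have : i ∈ L := hperm.mem_iff.2 (by simpa using h)
    obtain ⟨j, hj, hj'⟩ := List.getElem_of_mem this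
    exact ⟨⟨j, by omega⟩, hj'⟩

end JK
end

section
set_option linter.unusedSectionVars false
set_option linter.unusedSimpArgs false
namespace JK
open MvPolynomial Finset

theorem PD_of_swap (lam : JPartition) {N : ℕ} (η ζ : Fin N →₀ ℕ) (i j : Fin N) (hij : i ≠ j)
    (h : PD lam η) (h0 : ∀ k, k ≠ i → k ≠ j → ζ k = η k) (h1 : ζ i + ζ j = η i + η j)
    (h2 : ζ i ≤ max (η i) (η j)) (h3 : ζ j ≤ max (η i) (η j)) : PD lam ζ := by
  have both : ∀ S : Finset (Fin N), i ∈ S → j ∈ S → ∑ k ∈ S, ζ k = ∑ k ∈ S, η k := by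
    intro S hi hj
    rw [← Finset.add_sum_erase S _ hi, ← Finset.add_sum_erase S _ hi,
      ← Finset.add_sum_erase (S.erase i) _ (show j ∈ S.erase i by simp [hj, hij.symm]),
      ← Finset.add_sum_erase (S.erase i) _ (show j ∈ S.erase i by simp [hj, hij.symm])]
    have : ∑ k ∈ (S.erase i).erase j, ζ k = ∑ k ∈ (S.erase i).erase j, η k := by
      refine Finset.sum_congr rfl fun k hk => h0 k ?_ ?_
      · grind
      · grind
    omega
  have one : ∀ S : Finset (Fin N), ∀ a b : Fin N, a ≠ b → ζ a ≤ max (η a) (η b) →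
      (∀ k, k ≠ a → k ≠ b → ζ k = η k) → a ∈ S → b ∉ S → ∑ k ∈ S, ζ k ≤ topSum lam S.card := by
    intro S a b hab hle hoff ha hb
    have e : ∑ k ∈ S.erase a, ζ k = ∑ k ∈ S.erase a, η k := by
      refine Finset.sum_congr rfl fun k hk => hoff k ?_ ?_
      · grind
      · grind
    have hS := h.2 S
    have hS' := h.2 (insert b (S.erase a))
    have hb' : b ∉ S.erase a := by grind
    rw [Finset.sum_insert hb', Finset.card_insert_of_notMem hb', Finset.card_erase_of_mem ha] at hS'
    have hc : S.card - 1 + 1 = S.card := Nat.sub_add_cancel (Finset.card_pos.2 ⟨a, ha⟩)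
    rw [hc] at hS'
    rw [← Finset.add_sum_erase S _ ha] at hS ⊢
    rcases le_max_iff.1 hle with h' | h' <;> omega
  refine ⟨by rw [both _ (mem_univ i) (mem_univ j), h.1], fun S => ?_⟩
  by_cases hi : i ∈ S <;> by_cases hj : j ∈ S
  · rw [both S hi hj]; exact h.2 S
  · exact one S i j hij h2 h0 hi hj
  · exact one S j i hij.symm (by rwa [max_comm]) (fun k a b => h0 k b a) hj hi
  · have : ∑ k ∈ S, ζ k = ∑ k ∈ S, η k := by
      refine Finset.sum_congr rfl fun k hk => h0 k ?_ ?_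
      · rintro rfl; exact hi hk
      · rintro rfl; exact hj hk
    rw [this]; exact h.2 S

/-- polynomials whose exponents are dominated by `lam` -/
def Vd (lam : JPartition) (N : ℕ) : Submodule F (MvPolynomial (Fin N) F) where
  carrier := {g | ∀ η, coeff η g ≠ 0 → PD lam η}
  zero_mem' := by intro η h; simp at h
  add_mem' := by
    intro a b ha hb η h
    rw [coeff_add] at h
    by_cases h' : coeff η a = 0
    · exact hb η (by rwa [h', zero_add] at h)
    · exact ha η h'
  smul_mem' := by
    intro c a ha η h
    rw [coeff_smul] at h
    exact ha η (fun h' => h (by rw [h', smul_zero]))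

theorem mem_Vd {lam : JPartition} {N : ℕ} {g : MvPolynomial (Fin N) F} :
    g ∈ Vd lam N ↔ ∀ η, coeff η g ≠ 0 → PD lam η := Iff.rfl

theorem monomial_mem_Vd {lam : JPartition} {N : ℕ} {η : Fin N →₀ ℕ} (c : F) (h : PD lam η) :
    monomial η c ∈ Vd lam N := by
  intro ζ hz
  rw [coeff_monomial] at hz
  split_ifs at hz with he
  · exact he ▸ h
  · exact absurd rfl hz

theorem X_pderiv_mem_Vd {lam : JPartition} {N : ℕ} {g : MvPolynomial (Fin N) F} (i : Fin N)
    (hg : g ∈ Vd lam N) : X i * pderiv i g ∈ Vd lam N := by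
  rw [g.as_sum, map_sum, Finset.mul_sum]
  refine Submodule.sum_mem _ fun η hη => ?_
  rw [X_mul_pderiv_monomial]
  exact Submodule.smul_of_tower_mem _ _ (monomial_mem_Vd _ (hg η (mem_support_iff.1 hη)))

theorem dd_monomial {lam : JPartition} {N : ℕ} (i j : Fin N) (hij : i ≠ j) (η : Fin N →₀ ℕ)
    (hη : PD lam η) : ∃ h ∈ Vd lam N, (X i - X j) * h =
      X i * (monomial η (1 : F) - rename (Equiv.swap i j) (monomial η (1 : F))) := by
  set R : Fin N →₀ ℕ := (η.erase i).erase j with hR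
  have hdec : η = R + Finsupp.single i (η i) + Finsupp.single j (η j) := by
    ext k
    by_cases hki : k = i
    · subst hki; simp [hR, hij, Finsupp.erase_apply]
    · by_cases hkj : k = j
      · subst hkj; simp [hR, hij, Finsupp.erase_apply]
      · simp [hR, Finsupp.erase_apply, hki, hkj, Ne.symm hki, Ne.symm hkj]
  have hRi : R i = 0 := by simp [hR, hij, Finsupp.erase_apply]
  have hRj : R j = 0 := by simp [hR, hij, Finsupp.erase_apply]
  have hmul : ∀ u v : ℕ, (monomial (R + Finsupp.single i u + Finsupp.single j v) (1 : F)) =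
      monomial R 1 * X i ^ u * X j ^ v := by
    intro u v
    rw [X_pow_eq_monomial, X_pow_eq_monomial, monomial_mul, monomial_mul, one_mul, one_mul]
  have hren : rename (Equiv.swap i j) (monomial R (1 : F)) = monomial R 1 := by
    rw [rename_monomial]
    refine congrArg (fun t => monomial t (1 : F)) ?_
    refine Finsupp.ext fun k => ?_
    rw [Finsupp.mapDomain_equiv_apply, Equiv.symm_swap]
    by_cases hki : k = i
    · subst hki; rw [Equiv.swap_apply_left, hRi, hRj]
    · by_cases hkj : k = j
      · subst hkj; rw [Equiv.swap_apply_right, hRi, hRj]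
      · rw [Equiv.swap_apply_of_ne_of_ne hki hkj]
  have hsw : rename (Equiv.swap i j) (monomial η (1 : F)) =
      monomial R 1 * X j ^ (η i) * X i ^ (η j) := by
    conv_lhs => rw [hdec]
    rw [hmul, map_mul, map_mul, map_pow, map_pow, rename_X, rename_X, hren,
      Equiv.swap_apply_left, Equiv.swap_apply_right]
  have hη' : monomial η (1 : F) = monomial R 1 * X i ^ (η i) * X j ^ (η j) := by
    conv_lhs => rw [hdec]
    rw [hmul]
  have hPD : ∀ u v : ℕ, u + v = η i + η j → u ≤ max (η i) (η j) → v ≤ max (η i) (η j) →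
      monomial R (1 : F) * X i ^ u * X j ^ v ∈ Vd lam N := by
    intro u v h1 h2 h3
    rw [← hmul]
    refine monomial_mem_Vd _ (PD_of_swap lam η _ i j hij hη ?_ ?_ ?_ ?_)
    · intro k hki hkj
      simp [hR, Finsupp.erase_apply, hki, hkj, Ne.symm hki, Ne.symm hkj]
    · simp [hRi, hRj, hij, hij.symm, Finsupp.single_apply]; exact h1
    · simp [hRi, hRj, hij, hij.symm, Finsupp.single_apply]; simpa using h2
    · simp [hRi, hRj, hij, hij.symm, Finsupp.single_apply]; simpa using h3
  rw [hsw, hη']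
  rcases le_total (η j) (η i) with hle | hle
  · obtain ⟨n, hn⟩ := Nat.exists_eq_add_of_le hle
    refine ⟨∑ k ∈ range n, monomial R 1 * X i ^ (η j + k + 1) * X j ^ (η j + (n - 1 - k)), ?_, ?_⟩
    · refine Submodule.sum_mem _ fun k hk => hPD _ _ ?_ ?_ ?_ <;>
        · have := mem_range.1 hk; simp [hn]; try omega
    · rw [hn]
      have g := geom_sum₂_mul (X i : MvPolynomial (Fin N) F) (X j) n
      have : ∑ k ∈ range n, monomial R 1 * X i ^ (η j + k + 1) * X j ^ (η j + (n - 1 - k)) =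
          (monomial R 1 * X i ^ (η j) * X i * X j ^ (η j)) *
            ∑ k ∈ range n, (X i : MvPolynomial (Fin N) F) ^ k * X j ^ (n - 1 - k) := by
        rw [Finset.mul_sum]
        refine Finset.sum_congr rfl fun k _ => by ring
      rw [this]
      linear_combination (monomial R 1 * X i ^ (η j) * X i * X j ^ (η j)) * g
  · obtain ⟨n, hn⟩ := Nat.exists_eq_add_of_le hle
    refine ⟨-∑ k ∈ range n, monomial R 1 * X i ^ (η i + k + 1) * X j ^ (η i + (n - 1 - k)), ?_, ?_⟩
    · refine Submodule.neg_mem _ (Submodule.sum_mem _ fun k hk => hPD _ _ ?_ ?_ ?_) <;>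
        · have := mem_range.1 hk; simp [hn]; try omega
    · rw [hn]
      have g := geom_sum₂_mul (X i : MvPolynomial (Fin N) F) (X j) n
      have : ∑ k ∈ range n, monomial R 1 * X i ^ (η i + k + 1) * X j ^ (η i + (n - 1 - k)) =
          (monomial R 1 * X i ^ (η i) * X i * X j ^ (η i)) *
            ∑ k ∈ range n, (X i : MvPolynomial (Fin N) F) ^ k * X j ^ (n - 1 - k) := by
        rw [Finset.mul_sum]
        refine Finset.sum_congr rfl fun k _ => by ring
      rw [this]
      linear_combination -(monomial R 1 * X i ^ (η i) * X i * X j ^ (η i)) * g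

theorem dd_exists {lam : JPartition} {N : ℕ} (i j : Fin N) (hij : i ≠ j)
    (g : MvPolynomial (Fin N) F) (hg : g ∈ Vd lam N) : ∃ h ∈ Vd lam N, (X i - X j) * h =
      X i * (g - rename (Equiv.swap i j) g) := by
  have : ∀ η : g.support, ∃ h ∈ Vd lam N, (X i - X j) * h =
      X i * (monomial η.1 (1 : F) - rename (Equiv.swap i j) (monomial η.1 (1 : F))) :=
    fun η => dd_monomial i j hij η.1 (hg η.1 (mem_support_iff.1 η.2))
  choose h hV hh using this
  refine ⟨∑ η : g.support, coeff η.1 g • h η, Submodule.sum_mem _ fun η _ =>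
    Submodule.smul_mem _ _ (hV η), ?_⟩
  have hg' : g = ∑ η : g.support, coeff η.1 g • monomial η.1 (1 : F) := by
    conv_lhs => rw [g.as_sum]
    rw [← Finset.sum_coe_sort]
    refine Finset.sum_congr rfl fun η _ => by rw [smul_monomial, smul_eq_mul, mul_one]
  conv_rhs => rw [hg']
  rw [map_sum, ← Finset.sum_sub_distrib, Finset.mul_sum, Finset.mul_sum]
  refine Finset.sum_congr rfl fun η _ => ?_
  rw [mul_smul_comm, hh, map_smul, ← smul_sub, mul_smul_comm]

/-- substituting `w = x_i` -/
def evi {N : ℕ} (i : Fin N) : W F ℕ+ →ₗ[F] MvPolynomial (Fin N) F :=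
  Finsupp.lsum F (fun n => LinearMap.mulLeft F (X i ^ (n + 1)) ∘ₗ (evalN N).toLinearMap)

theorem evi_sg {N : ℕ} (i : Fin N) (n : ℕ) (f : SymA) :
    evi i (sg n f) = X i ^ (n + 1) * evalN N f := by simp [evi]

/-- the divided difference -/
def hji {N : ℕ} (i j : Fin N) : W F ℕ+ →ₗ[F] MvPolynomial (Fin N) F :=
  Finsupp.lsum F (fun n => LinearMap.mulLeft F
    (∑ k ∈ range (n + 1), X i ^ (k + 1) * X j ^ (n - k)) ∘ₗ (evalN N).toLinearMap)

theorem hji_sg {N : ℕ} (i j : Fin N) (n : ℕ) (f : SymA) :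
    hji i j (sg n f) = (∑ k ∈ range (n + 1), X i ^ (k + 1) * X j ^ (n - k)) * evalN N f := by
  simp [hji]

theorem rename_evalN {N : ℕ} (e : Equiv.Perm (Fin N)) (f : SymA) :
    rename e (evalN N f) = evalN N f := by
  have : (rename e).comp (evalN N) = evalN N := by
    apply MvPolynomial.algHom_ext
    intro i
    rw [AlgHom.comp_apply, evalN_X, map_sum]
    simp only [map_pow, rename_X]
    exact Equiv.sum_comp e (fun j => (X j : MvPolynomial (Fin N) F) ^ (i : ℕ))
  exact AlgHom.congr_fun this f

theorem hji_mul {N : ℕ} (i j : Fin N) (x : W F ℕ+) :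
    (X i - X j) * hji i j x = X i * (evi i x - rename (Equiv.swap i j) (evi i x)) := by
  have : LinearMap.mulLeft F (X i - X j) ∘ₗ hji i j =
      LinearMap.mulLeft F (X i) ∘ₗ (evi i - (rename (Equiv.swap i j)).toLinearMap ∘ₗ evi i) := by
    apply W_ext
    intro n f
    simp only [LinearMap.comp_apply, LinearMap.mulLeft_apply, LinearMap.sub_apply,
      AlgHom.toLinearMap_apply, hji_sg, evi_sg, map_mul, map_pow, rename_X, rename_evalN,
      Equiv.swap_apply_left]
    have g := geom_sum₂_mul (X i : MvPolynomial (Fin N) F) (X j) (n + 1)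
    have e : ∑ k ∈ range (n + 1), (X i : MvPolynomial (Fin N) F) ^ (k + 1) * X j ^ (n - k) =
        X i * ∑ k ∈ range (n + 1), (X i : MvPolynomial (Fin N) F) ^ k * X j ^ (n + 1 - 1 - k) := by
      rw [Finset.mul_sum]
      refine Finset.sum_congr rfl fun k _ => ?_
      rw [Nat.add_sub_cancel]; ring
    rw [e]
    linear_combination (X i * evalN N f) * g
  exact LinearMap.congr_fun this x

theorem evi_del_aux {N : ℕ} (i : Fin N) (f : SymA) :
    Dsum sP (fun k => LinearMap.mulLeft F (X i ^ (k + 1)) ∘ₗ (evalN N).toLinearMap) f =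
      X i * pderiv i (evalN N f) := by
  induction f using MvPolynomial.induction_on with
  | C a => 
    rw [Dsum_eq_sum _ _ _ ∅ (fun k _ => by simp [dK_apply])]
    simp [evalN]
  | add f g hf hg => rw [map_add, hf, hg, map_add, map_add, mul_add]
  | mul_X f m hf =>
    obtain ⟨n, rfl⟩ : ∃ n, sP n = m := ⟨m.natPred, by simp [sP]⟩
    rw [mul_comm, Dsum_X_mul]
    have e : Dsum sP (fun k => (LinearMap.mulLeft F ((X i : MvPolynomial (Fin N) F) ^ (k + 1)) ∘ₗ (evalN N).toLinearMap) ∘ₗ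
        LinearMap.mulLeft F (X (sP n))) f =
        LinearMap.mulLeft F (evalN N (X (sP n))) (Dsum sP (fun k => LinearMap.mulLeft F (X i ^ (k + 1)) ∘ₗ (evalN N).toLinearMap) f) := by
      rw [Dsum_comp]
      refine Dsum_congr _ _ fun k g => ?_
      simp only [LinearMap.comp_apply, LinearMap.mulLeft_apply, AlgHom.toLinearMap_apply, map_mul]
      ring
    rw [e, hf, map_mul (evalN N), Derivation.leibniz]
    have e2 : pderiv i (evalN N (X (sP n))) = ((n : F) + 1) • (X i : MvPolynomial (Fin N) F) ^ n := by
      rw [evalN_X, map_sum, Finset.sum_eq_single i]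
      · rw [Derivation.leibniz_pow, pderiv_X_self]
        simp [sP, MvPolynomial.smul_eq_C_mul]
      · intro b _ hb
        rw [Derivation.leibniz_pow, pderiv_X_of_ne hb]; simp
      · simp
    rw [e2]
    simp only [LinearMap.comp_apply, LinearMap.mulLeft_apply, AlgHom.toLinearMap_apply, smul_eq_mul,
      MvPolynomial.smul_eq_C_mul]
    ring

theorem evi_del {N : ℕ} (i : Fin N) (f : SymA) :
    evi i (del sP f) = X i * pderiv i (evalN N f) := by
  rw [← evi_del_aux, del, Dsum_comp]
  refine Dsum_congr _ _ fun k g => ?_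
  simp only [LinearMap.comp_apply, Finsupp.lsingle_apply]
  exact evi_sg i k g

theorem sum_hji_sg {N : ℕ} (i : Fin N) (n : ℕ) (f : SymA) :
    ∑ j ∈ Finset.univ.erase i, hji i j (sg n f) - (N : F) • evi i (sg n f) =
      evi i (pPart sP n f) - ((n : F) + 1) • evi i (sg n f) := by
  have hN : (N : F) • evi i (sg n f) = ∑ j : Fin N, evi i (sg n f) := by
    rw [Finset.sum_const, Finset.card_univ, Fintype.card_fin, Nat.cast_smul_eq_nsmul]
  have hd : ∀ j : Fin N, hji i j (sg n f) - evi i (sg n f) =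
      (∑ k ∈ range n, X i ^ (k + 1) * X j ^ (n - k)) * evalN N f := by
    intro j
    rw [hji_sg, evi_sg, Finset.sum_range_succ]
    simp; ring
  have hii : hji i i (sg n f) = ((n : F) + 1) • evi i (sg n f) := by
    rw [hji_sg, evi_sg]
    have : ∑ k ∈ range (n + 1), (X i : MvPolynomial (Fin N) F) ^ (k + 1) * X i ^ (n - k) =
        ((n : F) + 1) • X i ^ (n + 1) := by
      rw [Finset.sum_congr rfl (g := fun _ => (X i : MvPolynomial (Fin N) F) ^ (n + 1))]
      · rw [Finset.sum_const, card_range]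
        rw [← Nat.cast_smul_eq_nsmul F]; push_cast; rfl
      · intro k hk
        rw [← pow_add]; congr 1; have := mem_range.1 hk; omega
    rw [this, smul_mul_assoc]
  have hp : evi i (pPart sP n f) = ∑ j : Fin N, (∑ k ∈ range n, X i ^ (k + 1) * X j ^ (n - k)) * evalN N f := by
    rw [← Finset.sum_mul, Finset.sum_comm]
    cases n with
    | zero => simp [pPart_zero]
    | succ n =>
      rw [pPart_succ, map_sum, Finset.Nat.sum_antidiagonal_eq_sum_range_succ (fun a b => evi i (sg a (X (sP b) * f))), Finset.sum_mul]
      refine Finset.sum_congr rfl fun k hk => ?_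
      rw [evi_sg, map_mul, evalN_X, ← Finset.mul_sum, mul_assoc]
      have : ((sP (n - k) : ℕ+) : ℕ) = n + 1 - k := by
        have := mem_range.1 hk
        simp [sP]; omega
      rw [this]
  rw [hp, hN]
  simp only [← hd]
  rw [Finset.sum_sub_distrib, ← hii, ← Finset.add_sum_erase Finset.univ (fun j => hji i j (sg n f)) (mem_univ i)]
  abel

theorem evi_Mop {N : ℕ} (i : Fin N) (x : W F ℕ+) :
    evi i (Mop alpha sP x) = alpha • (X i * pderiv i (evi i x)) +
      ∑ j ∈ Finset.univ.erase i, hji i j x - (N : F) • evi i x := by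
  have : evi i ∘ₗ Mop alpha sP = alpha • (LinearMap.mulLeft F (X i) ∘ₗ (pderiv i).toLinearMap ∘ₗ evi i)
      + ∑ j ∈ Finset.univ.erase i, hji i j - (N : F) • evi i := by
    apply W_ext
    intro n f
    have h := sum_hji_sg i n f
    simp only [LinearMap.comp_apply, LinearMap.add_apply, LinearMap.sub_apply, LinearMap.smul_apply,
      LinearMap.sum_apply, LinearMap.mulLeft_apply, Mop_sg, map_add, map_smul] 
    have e1 : evi i (Dsum sP (fun k => Finsupp.lsingle (n + 1 + k)) f) =
        X i ^ (n + 1) * (X i * pderiv i (evalN N f)) := by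
      rw [← evi_del_aux, Dsum_comp]
      rw [← LinearMap.mulLeft_apply (R := F), Dsum_comp]
      refine Dsum_congr _ _ fun k g => ?_
      simp only [LinearMap.comp_apply, Finsupp.lsingle_apply, LinearMap.mulLeft_apply, AlgHom.toLinearMap_apply]
      refine (evi_sg i _ g).trans ?_
      ring
    have e2 : (pderiv i : Derivation F (MvPolynomial (Fin N) F) (MvPolynomial (Fin N) F)).toLinearMap (evi i (sg n f)) =
       ((n : F) + 1) • X i ^ n * evalN N f + X i ^ (n + 1) * pderiv i (evalN N f) := by
      rw [evi_sg]
      change pderiv i (X i ^ (n + 1) * evalN N f) = _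
      rw [Derivation.leibniz, Derivation.leibniz_pow, pderiv_X_self]
      simp [MvPolynomial.smul_eq_C_mul]; ring
    rw [e1, e2, add_sub_assoc, h, evi_sg]
    simp only [MvPolynomial.smul_eq_C_mul, C_sub, C_mul, C_add, C_1]
    ring
  have h2 := LinearMap.congr_fun this x
  simp only [LinearMap.comp_apply, LinearMap.add_apply, LinearMap.sub_apply, LinearMap.smul_apply,
      LinearMap.sum_apply, LinearMap.mulLeft_apply] at h2
  exact h2

theorem Mop_good {lam : JPartition} {N : ℕ} (x : W F ℕ+) (h : ∀ i : Fin N, evi i x ∈ Vd lam N)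
    (i : Fin N) : evi i (Mop alpha sP x) ∈ Vd lam N := by
  rw [evi_Mop]
  refine Submodule.sub_mem _ (Submodule.add_mem _ (Submodule.smul_mem _ _ (X_pderiv_mem_Vd i (h i)))
    (Submodule.sum_mem _ fun j hj => ?_)) (Submodule.smul_mem _ _ (h i))
  have hij : i ≠ j := by rintro rfl; simp at hj
  obtain ⟨g, hg, hg'⟩ := dd_exists i j hij _ (h i)
  rw [← hji_mul] at hg'
  have hne : (X i - X j : MvPolynomial (Fin N) F) ≠ 0 := by
    rw [sub_ne_zero]; exact fun e => hij (X_injective e)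
  rw [← mul_left_cancel₀ hne hg']
  exact hg

theorem evalN_eps {N : ℕ} (x : W F ℕ+) : evalN N (eps sP x) = ∑ i : Fin N, evi i x := by
  have : (evalN N).toLinearMap ∘ₗ eps sP = ∑ i : Fin N, evi i := by
    apply W_ext
    intro n f
    simp only [LinearMap.comp_apply, eps_sg, LinearMap.sum_apply, evi_sg, AlgHom.toLinearMap_apply,
      map_mul, evalN_X, Finset.sum_mul]
    simp [sP]
  have h := LinearMap.congr_fun this x
  simpa using h

theorem Top_good {lam : JPartition} {N : ℕ} (f : SymA) (hf : evalN N f ∈ Vd lam N) (j : ℕ) :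
    evalN N (Top j f) ∈ Vd lam N := by
  have h : ∀ i : Fin N, evi i ((Mop alpha sP ^ j) (del sP f)) ∈ Vd lam N := by
    induction j with
    | zero => intro i; rw [pow_zero, Module.End.one_apply, evi_del]; exact X_pderiv_mem_Vd i hf
    | succ j ih => intro i; rw [pow_succ', Module.End.mul_apply]; exact Mop_good _ ih i
  simp only [Top, LinearMap.comp_apply]
  rw [evalN_eps]
  exact Submodule.sum_mem _ fun i _ => h i

end JK
end

section
set_option linter.unusedSectionVars false
set_option linter.unusedSimpArgs false
namespace JK
open MvPolynomial Finset

theorem evalN_zero_of_le {M N : ℕ} (h : M ≤ N) {f : SymA} (hf : evalN N f = 0) : evalN M f = 0 := by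
  rw [← killCompl_evalN (Fin.castLE h) (Fin.castLE_injective h), hf, map_zero]

theorem evalN_dK_zero {f : SymA} (hf : ∀ N, evalN N f = 0) (k N : ℕ) :
    evalN N (dK sP k f) = 0 := by
  obtain ⟨s, hs⟩ := exists_dK_bound sP f
  obtain ⟨B, hB⟩ : ∃ B, ∀ n ∈ s, n < B := ⟨s.sup id + 1, fun n hn =>
    Nat.lt_succ_of_le (Finset.le_sup (f := id) hn)⟩
  set M := max N (max B (k + 1)) with hM
  have h1 : N ≤ M := le_max_left _ _
  have h2 : B ≤ M := (le_max_left _ _).trans (le_max_right _ _)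
  have h3 : k < M := lt_of_lt_of_le (Nat.lt_succ_self k) ((le_max_right _ _).trans (le_max_right _ _))
  refine evalN_zero_of_le h1 ?_
  have key : (fun i : Fin M => evalN M (dK sP i f)) = 0 := by
    refine Matrix.eq_zero_of_forall_index_sum_pow_mul_eq_zero
      (f := fun j : Fin M => (X j : MvPolynomial (Fin M) F)) (X_injective) fun j => ?_
    have e := evi_del_aux j f
    rw [hf M, map_zero, mul_zero, Dsum_eq_sum _ _ _ (range M) (fun n hn => hs n (fun h => hn
      (mem_range.2 (lt_of_lt_of_le (hB n h) h2))))] at e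
    have e' : X j * ∑ i : Fin M, (X j : MvPolynomial (Fin M) F) ^ (i : ℕ) * evalN M (dK sP i f) = 0 := by
      rw [← e, ← Fin.sum_univ_eq_sum_range (fun n => (LinearMap.mulLeft F ((X j : MvPolynomial (Fin M) F) ^ (n + 1)) ∘ₗ (evalN M).toLinearMap) (dK sP n f)), Finset.mul_sum]
      refine Finset.sum_congr rfl fun i _ => ?_
      simp only [LinearMap.comp_apply, LinearMap.mulLeft_apply, AlgHom.toLinearMap_apply]
      ring
    exact (mul_eq_zero.1 e').resolve_left (X_ne_zero j)
  exact congrFun key ⟨k, h3⟩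

theorem natF_ne (n : ℕ) : (n : F) + 1 ≠ 0 := by exact_mod_cast Nat.succ_ne_zero n

theorem eq_zero_of_evalN (f : SymA) (hf : ∀ N, evalN N f = 0) : f = 0 := by
  have main : ∀ n : ℕ, ∀ f : SymA, (∀ e : Exp, coeff e f ≠ 0 → e.degree ≤ n) →
      (∀ N, evalN N f = 0) → f = 0 := by
    intro n
    induction n with
    | zero =>
      intro f hd hf
      have hC : f = C (coeff 0 f) := by
        refine MvPolynomial.ext _ _ fun e => ?_
        rw [coeff_C]
        split_ifs with h
        · rw [h]
        · by_contra h'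
          have := hd e h'
          exact h ((Finsupp.degree_eq_zero_iff e).1 (Nat.le_zero.1 this)).symm
      have h0 := hf 0
      rw [hC] at h0
      rw [evalN, aeval_C] at h0
      rw [hC]
      have : coeff 0 f = 0 := by simpa using h0
      rw [this, C_0]
    | succ n ih =>
      intro f hd hf
      have hz : ∀ k, dK sP k f = 0 := by
        intro k
        refine ih _ ?_ (evalN_dK_zero hf k)
        intro e he
        rw [dK_apply, coeff_smul, coeff_pderiv] at he
        have := hd (e + Finsupp.single (sP k) 1) (fun h => he (by rw [h]; simp))
        rw [map_add, Finsupp.degree_single] at this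
        omega
      refine ih f ?_ hf
      intro e he
      by_contra hlt
      have hne : e ≠ 0 := by rintro rfl; simp at hlt
      obtain ⟨i, hi⟩ := Finsupp.ne_iff.1 hne
      obtain ⟨k, rfl⟩ : ∃ k, sP k = i := ⟨i.natPred, by simp [sP]⟩
      have hi' : 1 ≤ e (sP k) := Nat.one_le_iff_ne_zero.2 hi
      have hsub : e - Finsupp.single (sP k) 1 + Finsupp.single (sP k) 1 = e :=
        tsub_add_cancel_of_le (by simpa using hi')
      have h1 := congrArg (coeff (e - Finsupp.single (sP k) 1)) (hz k)
      rw [dK_apply, coeff_smul, coeff_pderiv, hsub, coeff_zero, smul_eq_mul] at h1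
      rcases mul_eq_zero.1 h1 with h | h
      · exact natF_ne k h
      · rcases mul_eq_zero.1 h with h | h
        · exact he h
        · exact natF_ne _ h
  obtain ⟨n, hn⟩ : ∃ n, ∀ e ∈ f.support, e.degree ≤ n :=
    ⟨f.support.sup (fun e => e.degree), fun e he => Finset.le_sup (f := fun e : Exp => e.degree) he⟩
  exact main n f (fun e he => hn e (mem_support_iff.2 he)) hf

theorem eq_zero_of_mc (f : SymA) (h : ∀ m, mc m f = 0) : f = 0 := by
  refine eq_zero_of_evalN f fun N => MvPolynomial.ext _ _ fun η => ?_
  rw [coeff_evalN, h, coeff_zero]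

/-! ### homogeneity -/

def wN : ℕ+ → ℕ := fun i => (i : ℕ)

theorem mc_monomial (m : JPartition) (e : Exp) (c : F) (h : psize m ≠ Finsupp.weight wN e) :
    mc m (monomial e c) = 0 := by
  rw [mc_apply, evalN, aeval_monomial]
  have hh : (algebraMap F (MvPolynomial (Fin (plen m)) F) c *
      e.prod fun i k => (∑ j : Fin (plen m), (X j : MvPolynomial (Fin (plen m)) F) ^ (i : ℕ)) ^ k).IsHomogeneous
      (0 + Finsupp.weight wN e) := by
    refine IsHomogeneous.mul (isHomogeneous_C _ _) ?_
    rw [Finsupp.weight_apply]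
    refine IsHomogeneous.prod _ _ _ fun i _ => ?_
    change ((∑ j : Fin (plen m), (X j : MvPolynomial (Fin (plen m)) F) ^ (i : ℕ)) ^ (e i)).IsHomogeneous (e i * (i : ℕ))
    rw [mul_comm]
    refine IsHomogeneous.pow (IsHomogeneous.sum _ _ _ fun j _ => ?_) _
    exact isHomogeneous_X_pow _ _
  refine hh.coeff_eq_zero ?_
  rw [zero_add]
  convert h using 1
  rw [Finsupp.degree_eq_sum, ← partOf_psize, partOf_xexp _ _ le_rfl]

theorem mc_hc (m : JPartition) (d : ℕ) (f : SymA) :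
    mc m (weightedHomogeneousComponent wN d f) = if psize m = d then mc m f else 0 := by
  have : mc m ∘ₗ weightedHomogeneousComponent wN d = if psize m = d then mc m else 0 := by
    refine MvPolynomial.linearMap_ext fun e => LinearMap.ext_ring ?_
    simp only [LinearMap.comp_apply]
    by_cases hd : Finsupp.weight wN e = d
    · rw [(isWeightedHomogeneous_monomial wN e (1 : F) hd).weightedHomogeneousComponent_same]
      split_ifs with h
      · rfl
      · rw [mc_monomial _ _ _ (by rwa [hd])]; rfl
    · rw [(isWeightedHomogeneous_monomial wN e (1 : F) rfl).weightedHomogeneousComponent_ne _ (Ne.symm hd), map_zero]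
      split_ifs with h
      · exact (mc_monomial _ _ _ (by rw [h]; exact Ne.symm hd)).symm
      · rfl
  have h := LinearMap.congr_fun this f
  rw [LinearMap.comp_apply] at h
  rw [h]
  split_ifs <;> rfl

theorem exists_mc_bound (f : SymA) : ∃ n, ∀ m, n < psize m → mc m f = 0 := by
  refine ⟨f.support.sup (fun e => Finsupp.weight wN e), fun m hm => ?_⟩
  rw [f.as_sum, map_sum]
  refine Finset.sum_eq_zero fun e he => mc_monomial _ _ _ ?_
  have := Finset.le_sup (f := fun e : Exp => Finsupp.weight wN e) he
  exact ne_of_gt (lt_of_le_of_lt this hm)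

theorem finite_psize (n : ℕ) : {m : JPartition | psize m ≤ n}.Finite := by
  refine (Set.finite_Iic (n • ((Finset.range n).val.map Nat.succPNat) : Multiset ℕ+)).subset ?_
  intro m hm
  rw [Set.mem_ofPred_eq, psize_eq] at hm
  rw [Set.mem_Iic, Multiset.le_iff_count]
  intro a
  by_cases ha : a ∈ m
  · have h1 : (a : ℕ) ≤ n := by
      refine le_trans ?_ hm
      exact Multiset.single_le_sum (fun _ _ => Nat.zero_le _) _ (Multiset.mem_map_of_mem _ ha)
    have h2 : Multiset.card m ≤ n := by
      refine le_trans ?_ hm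
      have := Multiset.card_nsmul_le_sum (s := m.map (fun i : ℕ+ => (i : ℕ))) (a := 1) (by
        intro x hx
        obtain ⟨i, _, rfl⟩ := Multiset.mem_map.1 hx
        exact i.pos)
      simpa using this
    have h3 : 1 ≤ Multiset.count a ((Finset.range n).val.map Nat.succPNat) := by
      rw [Multiset.one_le_count_iff_mem, Multiset.mem_map]
      refine ⟨a.natPred, ?_, by simp⟩
      have := a.natPred_add_one
      simp; omega
    rw [Multiset.count_nsmul]
    calc Multiset.count a m ≤ n := (Multiset.count_le_card _ _).trans h2
      _ ≤ n * _ := Nat.le_mul_of_pos_right _ h3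
  · rw [Multiset.count_eq_zero_of_notMem ha]; exact Nat.zero_le _

section jack
variable {J : JPartition → SymA} (hJ : IsJackFamily J)
include hJ

theorem mc_J {m l : JPartition} (h : ¬ dominates m l) : mc m (J l) = 0 := by
  have := hJ.triangular l m h
  rw [coeff_evalN, partOf_xexp _ _ (by omega)] at this
  exact this

theorem J_ne_zero (l : JPartition) : J l ≠ 0 := by
  intro h
  have := hJ.normalized l
  rw [h] at this
  simp at this

theorem hallB_J_ne {l m : JPartition} (h : l ≠ m) : hallB (J l) (J m) = 0 := hJ.orthogonal l m h

theorem hallB_J_self (l : JPartition) : hallB (J l) (J l) ≠ 0 := hall_self_ne_zero (J_ne_zero hJ l)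

theorem hallB_sum_J (D : Finset JPartition) (c : JPartition → F) (l : JPartition) :
    hallB (∑ m ∈ D, c m • J m) (J l) = if l ∈ D then c l * hallB (J l) (J l) else 0 := by
  rw [map_sum, LinearMap.sum_apply]
  split_ifs with h
  · rw [Finset.sum_eq_single l]
    · simp
    · intro b _ hb
      rw [map_smul, LinearMap.smul_apply, hallB_J_ne hJ hb, smul_zero]
    · intro h'; exact absurd h h'
  · refine Finset.sum_eq_zero fun b hb => ?_
    rw [map_smul, LinearMap.smul_apply, hallB_J_ne hJ (show b ≠ l from fun e => h (e ▸ hb)), smul_zero]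

theorem exists_J_sum (D : Finset JPartition) (hD : ∀ l ∈ D, ∀ m, dominates m l → m ∈ D) (f : SymA)
    (hf : ∀ m, m ∉ D → mc m f = 0) : ∃ c : JPartition → F, f = ∑ m ∈ D, c m • J m := by
  let ext : (D → F) → JPartition → F := fun c m => if h : m ∈ D then c ⟨m, h⟩ else 0
  let S : (D → F) →ₗ[F] SymA := ∑ m : D, (LinearMap.proj m).smulRight (J m)
  have hS : ∀ c, S c = ∑ m ∈ D, ext c m • J m := by
    intro c
    rw [← Finset.sum_coe_sort]
    simp only [S, LinearMap.sum_apply, LinearMap.smulRight_apply, LinearMap.proj_apply]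
    refine Finset.sum_congr rfl fun m _ => ?_
    simp [ext]
  have hoff : ∀ c m, m ∉ D → mc m (S c) = 0 := by
    intro c m hm
    rw [hS, map_sum]
    refine Finset.sum_eq_zero fun l hl => ?_
    rw [map_smul, mc_J hJ (fun h => hm (hD l hl m h)), smul_zero]
  let T : (D → F) →ₗ[F] (D → F) := LinearMap.pi (fun m : D => mc m ∘ₗ S)
  have hinj : Function.Injective T := by
    rw [← LinearMap.ker_eq_bot, LinearMap.ker_eq_bot']
    intro c hc
    have hz : S c = 0 := by
      refine eq_zero_of_mc _ fun m => ?_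
      by_cases hm : m ∈ D
      · exact congrFun hc ⟨m, hm⟩
      · exact hoff c m hm
    funext m
    have h1 := hallB_sum_J hJ D (ext c) m
    rw [← hS, hz, map_zero, LinearMap.zero_apply, if_pos m.2] at h1
    have := (mul_eq_zero.1 h1.symm).resolve_right (hallB_J_self hJ _)
    simpa [ext] using this
  obtain ⟨c, hc⟩ := (LinearMap.injective_iff_surjective.1 hinj) (fun m => mc m f)
  refine ⟨ext c, ?_⟩
  rw [← hS, ← sub_eq_zero]
  refine eq_zero_of_mc _ fun m => ?_
  rw [map_sub, sub_eq_zero]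
  by_cases hm : m ∈ D
  · exact (congrFun hc ⟨m, hm⟩).symm
  · rw [hf m hm, hoff c m hm]

/-- partitions dominated by `l` -/
theorem fin_dom (l : JPartition) : {m | dominates m l}.Finite :=
  (finite_psize (psize l)).subset fun _ h => le_of_eq h.1

theorem J_span (f : SymA) : ∃ (D : Finset JPartition) (c : JPartition → F), f = ∑ m ∈ D, c m • J m := by
  obtain ⟨n, hn⟩ := exists_mc_bound f
  refine ⟨(finite_psize n).toFinset, exists_J_sum hJ _ ?_ f ?_⟩
  · intro l hl m hm
    simp only [Set.Finite.mem_toFinset, Set.mem_ofPred_eq] at hl ⊢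
    rw [hm.1]; exact hl
  · intro m hm
    simp only [Set.Finite.mem_toFinset, Set.mem_ofPred_eq] at hm
    exact hn m (by omega)

theorem tri_Top (j : ℕ) (l m : JPartition) (h : ¬ dominates m l) : mc m (Top j (J l)) = 0 := by
  have hV : ∀ N, evalN N (J l) ∈ Vd l N := by
    intro N η hη
    rw [coeff_evalN] at hη
    rw [← dominates_iff]
    by_contra h'
    exact hη (mc_J hJ h')
  have h1 := Top_good (J l) (hV (plen m)) j
  by_contra h2
  have := h1 _ h2
  rw [← dominates_iff, partOf_xexp _ _ le_rfl] at this
  exact h this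

theorem Top_J (j : ℕ) (l : JPartition) : ∃ t : F, Top j (J l) = t • J l := by
  have hex : ∀ l, ∃ c : JPartition → F, Top j (J l) = ∑ m ∈ (fin_dom hJ l).toFinset, c m • J m := by
    intro l
    refine exists_J_sum hJ _ ?_ _ ?_
    · intro a ha m hm
      simp only [Set.Finite.mem_toFinset, Set.mem_ofPred_eq] at ha ⊢
      exact dominates_trans hm ha
    · intro m hm
      simp only [Set.Finite.mem_toFinset, Set.mem_ofPred_eq] at hm
      exact tri_Top hJ j l m hm
  choose c hc using hex
  refine ⟨c l l, ?_⟩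
  conv_lhs => rw [hc l]
  rw [Finset.sum_eq_single l]
  · intro m hm hne
    simp only [Set.Finite.mem_toFinset, Set.mem_ofPred_eq] at hm
    have h1 := hallB_Top j (J l) (J m)
    rw [hallB_comm (J l) (Top j (J m)), hc l, hc m, hallB_sum_J hJ, hallB_sum_J hJ, if_pos (by simpa using hm),
      if_neg] at h1
    · rw [(mul_eq_zero.1 h1).resolve_right (hallB_J_self hJ _), zero_smul]
    · simp only [Set.Finite.mem_toFinset, Set.mem_ofPred_eq]
      intro h'
      exact hne (dominates_antisymm hm h')
  · intro h; simp [dominates_refl] at h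

theorem J_homog (l : JPartition) (e : Exp) (he : coeff e (J l) ≠ 0) :
    Finsupp.weight wN e = psize l := by
  by_contra h
  have : weightedHomogeneousComponent wN (Finsupp.weight wN e) (J l) = 0 := by
    refine eq_zero_of_mc _ fun m => ?_
    rw [mc_hc]
    split_ifs with h'
    · exact mc_J hJ (fun hd => h (by rw [← h', hd.1]))
    · rfl
  have h2 := congrArg (coeff e) this
  rw [coeff_weightedHomogeneousComponent, if_pos rfl, coeff_zero] at h2
  exact he h2

end jack

end JK
end

section
set_option linter.unusedSectionVars false
set_option linter.unusedSimpArgs false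
namespace JK
open MvPolynomial Finset

section
variable {K : Type*} [Field K] {σ τ : Type*}

theorem dK_C (ι : ℕ ↪ σ) (k : ℕ) (a : K) : dK ι k (C a : MvPolynomial σ K) = 0 := by
  rw [dK_apply, pderiv_C, smul_zero]

theorem dK_algHom (ι : ℕ ↪ σ) (ι' : ℕ ↪ τ) (Φ : MvPolynomial σ K →ₐ[K] MvPolynomial τ K)
    (h : ∀ k i, dK ι' k (Φ (X i)) = Φ (dK ι k (X i))) (k : ℕ) (f : MvPolynomial σ K) :
    dK ι' k (Φ f) = Φ (dK ι k f) := by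
  induction f using MvPolynomial.induction_on with
  | C a =>
    rw [dK_C, map_zero]
    have : Φ (C a) = C a := AlgHom.commutes Φ a
    rw [this, dK_C]
  | add f g hf hg => simp only [map_add, hf, hg]
  | mul_X f i hf => rw [map_mul, dK_mul, dK_mul, map_add, map_mul, map_mul, hf, h]

theorem dK_algHom_zero (ι' : ℕ ↪ τ) (Φ : MvPolynomial σ K →ₐ[K] MvPolynomial τ K)
    (h : ∀ k i, dK ι' k (Φ (X i)) = 0) (k : ℕ) (f : MvPolynomial σ K) :
    dK ι' k (Φ f) = 0 := by
  induction f using MvPolynomial.induction_on with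
  | C a =>
    have : Φ (C a) = C a := AlgHom.commutes Φ a
    rw [this, dK_C]
  | add f g hf hg => simp only [map_add, hf, hg, add_zero]
  | mul_X f i hf => rw [map_mul, dK_mul, hf, h]; simp

theorem Hop_transport (al : K) (ι : ℕ ↪ σ) (ι' : ℕ ↪ τ)
    (Φ : MvPolynomial σ K →ₗ[K] MvPolynomial τ K)
    (h : ∀ k f, dK ι' k (Φ f) = Φ (dK ι k f)) (h' : ∀ n f, Φ (X (ι n) * f) = X (ι' n) * Φ f)
    (j : ℕ) (f : MvPolynomial σ K) : Hop al ι' j (Φ f) = Φ (Hop al ι j f) := by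
  have hdel : del ι' (Φ f) = mapW Φ (del ι f) := by
    rw [del, Dsum_transport ι ι' Φ h, del, Dsum_comp]
    refine Dsum_congr _ _ fun k g => ?_
    exact (mapW_sg Φ k g).symm
  have hlam : ∀ x, LamP al ι' (mapW Φ x) = mapW Φ (LamP al ι x) := by
    intro x
    have : LamP al ι' ∘ₗ mapW Φ = mapW Φ ∘ₗ LamP al ι := by
      apply W_ext
      intro n f
      simp only [LinearMap.comp_apply, LamP, LinearMap.add_apply, map_add, Sop_mapW]
      congr 1
      rw [mapW_sg, Mop_sg, Mop_sg, map_add, map_add, map_smul, map_smul, mapW_sg]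
      congr 2
      · cases n with
        | zero => rw [pPart_zero, pPart_zero, map_zero]
        | succ n =>
          rw [pPart_succ, pPart_succ, map_sum]
          refine Finset.sum_congr rfl fun x _ => by rw [mapW_sg, h']
      · rw [Dsum_transport ι ι' Φ h, Dsum_comp]
        refine Dsum_congr _ _ fun k g => ?_
        exact (mapW_sg Φ _ g).symm
    exact LinearMap.congr_fun this x
  have hlamj : ∀ j x, (LamP al ι' ^ j) (mapW Φ x) = mapW Φ ((LamP al ι ^ j) x) := by
    intro j
    induction j with
    | zero => intro x; rfl
    | succ j ih => intro x; rw [pow_succ', pow_succ', Module.End.mul_apply, Module.End.mul_apply, ih, hlam]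
  have heps : ∀ x, epsP ι' (mapW Φ x) = Φ (epsP ι x) := by
    intro x
    have : eps ι' ∘ₗ mapW Φ = Φ ∘ₗ eps ι := by
      apply W_ext
      intro n f
      simp only [LinearMap.comp_apply, mapW_sg, eps_sg, h']
    have h2 := LinearMap.congr_fun this x
    simp only [LinearMap.comp_apply] at h2
    simp only [epsP, LinearMap.add_apply, map_add, eps1_mapW, h2]
  simp only [Hop, LinearMap.comp_apply, hdel, hlamj, heps]

end

/-- the shift `p₁ ↦ p₁ + 1` -/
def sh : SymA →ₐ[F] SymA := aeval fun i : ℕ+ => X i + if i = 1 then 1 else 0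
def shi : SymA →ₐ[F] SymA := aeval fun i : ℕ+ => X i - if i = 1 then 1 else 0

theorem sh_X (i : ℕ+) : sh (X i) = X i + if i = 1 then 1 else 0 := by simp [sh]
theorem shi_X (i : ℕ+) : shi (X i) = X i - if i = 1 then 1 else 0 := by simp [shi]

theorem sh_shi (f : SymA) : sh (shi f) = f := by
  have : sh.comp shi = AlgHom.id F SymA := by
    apply MvPolynomial.algHom_ext
    intro i
    rw [AlgHom.comp_apply, shi_X, map_sub, sh_X]
    split_ifs <;> simp
  exact AlgHom.congr_fun this f

theorem shi_sh (f : SymA) : shi (sh f) = f := by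
  have : shi.comp sh = AlgHom.id F SymA := by
    apply MvPolynomial.algHom_ext
    intro i
    rw [AlgHom.comp_apply, sh_X, map_add, shi_X]
    split_ifs <;> simp
  exact AlgHom.congr_fun this f

theorem dK_sh (k : ℕ) (f : SymA) : dK sP k (sh f) = sh (dK sP k f) := by
  refine dK_algHom sP sP sh ?_ k f
  intro k i
  rw [sh_X, map_add]
  have h0 : dK sP k (if i = 1 then (1 : SymA) else 0) = 0 := by
    split_ifs
    · rw [← C_1, dK_C]
    · rw [map_zero]
  rw [h0, add_zero]
  by_cases h : sP k = i
  · subst h; rw [dK_X_self]; exact (AlgHom.commutes sh _).symm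
  · rw [dK_X_of_ne _ _ _ h, map_zero]

theorem sh_X_sP (n : ℕ) : sh (X (sP n)) = X (sP n) + if n = 0 then 1 else 0 := by
  rw [sh_X]
  congr 1
  have : sP n = 1 ↔ n = 0 := by
    rw [← PNat.coe_inj]; simp [sP]
  simp only [this]

theorem pPart_sh (n : ℕ) (f : SymA) : mapW sh.toLinearMap (pPart sP n f) =
    pPart sP n (sh f) + Sop (sg n (sh f)) := by
  cases n with
  | zero => rw [pPart_zero, pPart_zero, map_zero, Sop_zero, add_zero]
  | succ n =>
    rw [pPart_succ, pPart_succ, map_sum, Sop_succ]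
    have : ∀ x ∈ antidiagonal n, mapW sh.toLinearMap (sg x.1 (X (sP x.2) * f)) =
        sg x.1 (X (sP x.2) * sh f) + if x = (n, 0) then sg n (sh f) else 0 := by
      intro x hx
      have hx' := Finset.HasAntidiagonal.mem_antidiagonal.1 hx
      rw [mapW_sg, AlgHom.toLinearMap_apply, map_mul, sh_X_sP, add_mul]
      have e : x = (n, 0) ↔ x.2 = 0 := by
        constructor
        · rintro rfl; rfl
        · intro h; ext
          · simp; omega
          · simp [h]
      simp only [e]
      split_ifs with h
      · have : x.1 = n := by omega
        rw [one_mul, this, sg_add]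
      · rw [zero_mul, add_zero, add_zero]
    rw [Finset.sum_congr rfl this, Finset.sum_add_distrib]
    congr 1
    rw [Finset.sum_ite_eq', if_pos]
    exact Finset.HasAntidiagonal.mem_antidiagonal.2 rfl

theorem Hop_sh (j : ℕ) (f : SymA) : Hop alpha sP j (sh f) = sh (Top j f) := by
  have h : ∀ k f, dK sP k (sh.toLinearMap f) = sh.toLinearMap (dK sP k f) := dK_sh
  have hdel : del sP (sh f) = mapW sh.toLinearMap (del sP f) := by
    have := Dsum_transport (X := W F ℕ+) sP sP sh.toLinearMap h (fun k => Finsupp.lsingle k) f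
    rw [AlgHom.toLinearMap_apply] at this
    rw [del, this, Dsum_comp]
    refine Dsum_congr _ _ fun k g => ?_
    exact (mapW_sg sh.toLinearMap k g).symm
  have hlam : ∀ x, LamP alpha sP (mapW sh.toLinearMap x) = mapW sh.toLinearMap (Mop alpha sP x) := by
    intro x
    have : LamP alpha sP ∘ₗ mapW sh.toLinearMap = mapW sh.toLinearMap ∘ₗ Mop alpha sP := by
      apply W_ext
      intro n f
      simp only [LinearMap.comp_apply, LamP, LinearMap.add_apply]
      rw [mapW_sg, Mop_sg, Mop_sg, map_add, map_add, map_smul, map_smul, mapW_sg, pPart_sh]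
      have e : Dsum sP (fun k => Finsupp.lsingle (n + 1 + k)) (sh.toLinearMap f) =
          mapW sh.toLinearMap (Dsum sP (fun k => (Finsupp.lsingle (n + 1 + k) : SymA →ₗ[F] W F ℕ+)) f) := by
        rw [Dsum_transport sP sP sh.toLinearMap h, Dsum_comp]
        refine Dsum_congr _ _ fun k g => ?_
        exact (mapW_sg sh.toLinearMap _ g).symm
      rw [e, AlgHom.toLinearMap_apply]
      abel
    exact LinearMap.congr_fun this x
  have hlamj : ∀ j x, (LamP alpha sP ^ j) (mapW sh.toLinearMap x) = mapW sh.toLinearMap ((Mop alpha sP ^ j) x) := by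
    intro j
    induction j with
    | zero => intro x; rfl
    | succ j ih => intro x; rw [pow_succ', pow_succ', Module.End.mul_apply, Module.End.mul_apply, ih, hlam]
  have heps : ∀ x, epsP sP (mapW sh.toLinearMap x) = sh (eps sP x) := by
    intro x
    have : epsP sP ∘ₗ mapW sh.toLinearMap = sh.toLinearMap ∘ₗ eps sP := by
      apply W_ext
      intro n f
      simp only [LinearMap.comp_apply, mapW_sg, epsP, LinearMap.add_apply, eps_sg,
        AlgHom.toLinearMap_apply, map_mul, sh_X_sP, add_mul]
      congr 1
      cases n with
      | zero => rw [eps1_sg_zero, if_pos rfl, one_mul]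
      | succ n => rw [eps1_sg_succ, if_neg (Nat.succ_ne_zero n), zero_mul]
    exact LinearMap.congr_fun this x
  simp only [Hop, Top, LinearMap.comp_apply, hdel, hlamj, heps]

/-! ### partitions and exponents -/

theorem toExp_apply (l : JPartition) (i : ℕ+) : toExp l i = Multiset.count i l := by
  rw [toExp, Finsupp.finsetSum_apply]
  simp only [Finsupp.single_apply]
  rw [Finset.sum_ite_eq']
  split_ifs with h
  · rfl
  · rw [Multiset.count_eq_zero_of_notMem (by simpa using h)]

theorem toExp_eq (l : JPartition) : toExp l = Multiset.toFinsupp l := by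
  refine Finsupp.ext fun i => ?_
  rw [toExp_apply, Multiset.toFinsupp_apply]

theorem toPart_eq (m : Exp) : toPart m = Finsupp.toMultiset m := by
  rw [toPart, Finsupp.toMultiset_apply]
  refine Finset.sum_congr rfl fun i _ => ?_
  exact (Multiset.nsmul_singleton _ _).symm

theorem toPart_toExp (l : JPartition) : toPart (toExp l) = l := by
  rw [toPart_eq, toExp_eq, Multiset.toFinsupp_toMultiset]

theorem toExp_toPart (m : Exp) : toExp (toPart m) = m := by
  rw [toPart_eq, toExp_eq, Finsupp.toMultiset_toFinsupp]

theorem toExp_injective : Function.Injective toExp := fun a b h => by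
  rw [← toPart_toExp a, h, toPart_toExp]

theorem wt_eq (m : Exp) : wt m = Finsupp.weight wN m := by
  rw [wt, Finsupp.weight_apply]; rfl

theorem weight_toExp (l : JPartition) : Finsupp.weight wN (toExp l) = psize l := by
  rw [psize_eq]
  induction l using Multiset.induction_on with
  | empty => rw [toExp_eq]; simp
  | cons a l ih =>
    rw [toExp_eq] at ih ⊢
    rw [← Multiset.singleton_add, map_add, map_add, ih, Multiset.toFinsupp_singleton, Finsupp.weight_single]
    simp [wN]

theorem coeff_sh_monomial (e m : Exp) (a : F) : coeff m (sh (monomial e a)) =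
    if m.erase 1 = e.erase 1 then ((e 1).choose (m 1) : F) * a else 0 := by
  have hdec : ∀ e : Exp, e.erase 1 + Finsupp.single 1 (e 1) = e := fun e => Finsupp.erase_add_single 1 e
  have h1 : monomial e a = monomial (e.erase 1) a * X 1 ^ (e 1) := by
    rw [X_pow_eq_monomial, monomial_mul, mul_one, hdec]
  have h2 : sh (monomial (e.erase 1) a) = monomial (e.erase 1) a := by
    rw [sh, aeval_monomial, monomial_eq (s := e.erase 1)]
    congr 1
    refine Finset.prod_congr rfl fun i hi => ?_
    have : i ≠ 1 := by rintro rfl; simp at hi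
    change (X i + if i = 1 then 1 else 0 : SymA) ^ _ = X i ^ _
    rw [if_neg this, add_zero]
  rw [h1, map_mul, map_pow, h2, sh_X, if_pos rfl, add_pow, Finset.mul_sum, coeff_sum]
  have h3 : ∀ k, coeff m (monomial (e.erase 1) a * ((X 1 : SymA) ^ k * 1 ^ (e 1 - k) * ((e 1).choose k : SymA))) =
      if e.erase 1 + Finsupp.single 1 k = m then ((e 1).choose k : F) * a else 0 := by
    intro k
    have : monomial (e.erase 1) a * ((X 1 : SymA) ^ k * 1 ^ (e 1 - k) * ((e 1).choose k : SymA)) =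
        monomial (e.erase 1 + Finsupp.single 1 k) (((e 1).choose k : F) * a) := by
      have hc : ((e 1).choose k : SymA) = C ((e 1).choose k : F) := by simp
      rw [one_pow, mul_one, hc, ← mul_assoc, X_pow_eq_monomial, monomial_mul, mul_one, mul_comm, C_mul_monomial]
    rw [this, coeff_monomial]
  simp only [h3]
  have h4 : ∀ k, e.erase 1 + Finsupp.single 1 k = m ↔ (m.erase 1 = e.erase 1 ∧ k = m 1) := by
    intro k
    constructor
    · rintro rfl
      constructor
      · refine Finsupp.ext fun i => ?_
        by_cases hi : i = 1
        · subst hi; simp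
        · simp [Finsupp.erase_ne hi, Finsupp.single_apply, Ne.symm hi]
      · simp
    · rintro ⟨h, rfl⟩
      rw [← h, hdec]
  simp only [h4]
  split_ifs with h
  · simp only [h, true_and]
    rw [Finset.sum_ite_eq']
    split_ifs with h5
    · rfl
    · rw [Nat.choose_eq_zero_of_lt (by simpa using h5)]; simp
  · simp [h]

theorem weight_erase (m : Exp) : Finsupp.weight wN m = Finsupp.weight wN (m.erase 1) + m 1 := by
  conv_lhs => rw [← Finsupp.erase_add_single 1 m]
  rw [map_add, Finsupp.weight_single]; simp [wN]

theorem coeff_sh_J {J : JPartition → SymA} (hJ : IsJackFamily J) (mu lam : JPartition) :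
    coeff (toExp mu) (sh (J lam)) = theta J mu lam := by
  set m := toExp mu with hm
  have hw : Finsupp.weight wN m = psize mu := weight_toExp mu
  have hm1 : m 1 = pmult mu 1 := toExp_apply mu 1
  conv_lhs => rw [(J lam).as_sum]
  rw [map_sum, coeff_sum]
  simp only [coeff_sh_monomial]
  rw [theta]
  split_ifs with hlt
  · refine Finset.sum_eq_zero fun e he => ?_
    split_ifs with h
    · have h1 := J_homog hJ lam e (mem_support_iff.1 he)
      rw [weight_erase, ← h] at h1
      rw [weight_erase] at hw
      rw [Nat.choose_eq_zero_of_lt (by omega)]; simp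
    · rfl
  · set e0 := toExp (addOnes mu (psize lam - psize mu)) with he0
    have e01 : e0 1 = psize lam - psize mu + pmult mu 1 := by
      rw [he0, toExp_apply, addOnes, Multiset.count_add, Multiset.count_replicate_self, pmult, add_comm]
    have e0e : e0.erase 1 = m.erase 1 := by
      refine Finsupp.ext fun i => ?_
      by_cases hi : i = 1
      · subst hi; simp
      · rw [Finsupp.erase_ne hi, Finsupp.erase_ne hi, he0, hm, toExp_apply, toExp_apply, addOnes,
          Multiset.count_add, Multiset.count_replicate, if_neg (Ne.symm hi), add_zero]
    rw [Finset.sum_eq_single e0]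
    · rw [if_pos e0e.symm, e01, hm1]
    · intro e he hne
      rw [if_neg]
      intro h
      apply hne
      have h1 := J_homog hJ lam e (mem_support_iff.1 he)
      rw [weight_erase, ← h] at h1
      rw [weight_erase] at hw
      rw [← Finsupp.erase_add_single 1 e, ← Finsupp.erase_add_single 1 e0, ← h, e0e, e01]
      congr 2
      omega
    · intro h
      rw [notMem_support_iff.1 h]; simp

end JK
end

section
set_option linter.unusedSectionVars false
set_option linter.unusedSimpArgs false
namespace JK
open MvPolynomial Finset

/-! ### exponents in two alphabets -/

abbrev Exp2 : Type := (ℕ+ ⊕ ℕ+) →₀ ℕ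

def qre (a b : Exp) : Exp2 := a.mapDomain Sum.inl + b.mapDomain Sum.inr

theorem qre_inl (a b : Exp) (i : ℕ+) : qre a b (Sum.inl i) = a i := by
  rw [qre, Finsupp.add_apply, Finsupp.mapDomain_apply Sum.inl_injective,
    Finsupp.mapDomain_of_notMem_range _ _ (by simp), add_zero]

theorem qre_inr (a b : Exp) (i : ℕ+) : qre a b (Sum.inr i) = b i := by
  rw [qre, Finsupp.add_apply, Finsupp.mapDomain_apply Sum.inr_injective,
    Finsupp.mapDomain_of_notMem_range _ _ (by simp), zero_add]

theorem qre_inj {a b a' b' : Exp} (h : qre a b = qre a' b') : a = a' ∧ b = b' := by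
  constructor
  · refine Finsupp.ext fun i => ?_
    rw [← qre_inl a b, h, qre_inl]
  · refine Finsupp.ext fun i => ?_
    rw [← qre_inr a b, h, qre_inr]

theorem qre_surj (η : Exp2) : ∃ a b, η = qre a b := by
  refine ⟨η.comapDomain Sum.inl Sum.inl_injective.injOn, η.comapDomain Sum.inr Sum.inr_injective.injOn,
    Finsupp.ext fun i => ?_⟩
  rcases i with i | i
  · rw [qre_inl, Finsupp.comapDomain_apply]
  · rw [qre_inr, Finsupp.comapDomain_apply]

theorem coeff_qre_mul (a b : Exp) (f g : SymA) :
    coeff (qre a b) (rename Sum.inl f * rename Sum.inr g : QR) = coeff a f * coeff b g := by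
  induction f using MvPolynomial.induction_on' with
  | add f f' hf hf' => rw [map_add, add_mul, coeff_add, hf, hf', coeff_add, add_mul]
  | monomial a' c =>
    induction g using MvPolynomial.induction_on' with
    | add f f' hf hf' => rw [map_add, mul_add, coeff_add, hf, hf', coeff_add, mul_add]
    | monomial b' d =>
      rw [rename_monomial, rename_monomial, monomial_mul, coeff_monomial, coeff_monomial, coeff_monomial]
      have : a'.mapDomain Sum.inl + b'.mapDomain Sum.inr = qre a' b' := rfl
      rw [this]
      by_cases h : a' = a
      · by_cases h2 : b' = b
        · subst h h2; simp
        · rw [if_neg, if_neg h2, mul_zero]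
          exact fun h' => h2 (qre_inj h').2
      · rw [if_neg, if_neg h, zero_mul]
        exact fun h' => h (qre_inj h').1

theorem prod_X_map (l : JPartition) : (l.map fun i => (X i : SymA)).prod = monomial (toExp l) 1 := by
  rw [toExp_eq]
  induction l using Multiset.induction_on with
  | empty => simp
  | cons a l ih =>
    rw [Multiset.map_cons, Multiset.prod_cons, ih, ← Multiset.singleton_add, map_add,
      Multiset.toFinsupp_singleton, X, monomial_mul, one_mul]

theorem qrMon_eq (mu nu : JPartition) : qrMon mu nu = monomial (qre (toExp mu) (toExp nu)) 1 := by
  have h1 : (mu.map fun i => qv i).prod = rename Sum.inl ((mu.map fun i => (X i : SymA)).prod) := by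
    rw [map_multiset_prod, Multiset.map_map]
    congr 1
    refine Multiset.map_congr rfl fun i _ => ?_
    simp [qv]
  have h2 : (nu.map fun i => rv i).prod = rename Sum.inr ((nu.map fun i => (X i : SymA)).prod) := by
    rw [map_multiset_prod, Multiset.map_map]
    congr 1
    refine Multiset.map_congr rfl fun i _ => ?_
    simp [rv]
  rw [qrMon, h1, h2, prod_X_map, prod_X_map, rename_monomial, rename_monomial, monomial_mul, one_mul]
  rfl

/-! ### the operator -/

def iq : ℕ ↪ ℕ+ ⊕ ℕ+ := sP.trans ⟨Sum.inl, Sum.inl_injective⟩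
def ir : ℕ ↪ ℕ+ ⊕ ℕ+ := sP.trans ⟨Sum.inr, Sum.inr_injective⟩

theorem iq_apply (n : ℕ) : iq n = Sum.inl (sP n) := rfl
theorem ir_apply (n : ℕ) : ir n = Sum.inr (sP n) := rfl
theorem iq_ne_ir (i j : ℕ) : iq i ≠ ir j := by simp [iq_apply, ir_apply]

theorem dK_iq_inl (k : ℕ) (f : SymA) : dK iq k (rename Sum.inl f : QR) = rename Sum.inl (dK sP k f) := by
  refine dK_algHom sP iq (rename Sum.inl) ?_ k f
  intro k i
  rw [rename_X]
  by_cases h : sP k = i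
  · subst h
    have := dK_X_self (K := F) iq k
    rw [iq_apply] at this
    rw [dK_X_self, this]; exact (AlgHom.commutes (rename Sum.inl) _).symm
  · rw [dK_X_of_ne _ _ _ h, dK_X_of_ne, map_zero]
    rw [iq_apply]; simpa using h

theorem dK_ir_inr (k : ℕ) (f : SymA) : dK ir k (rename Sum.inr f : QR) = rename Sum.inr (dK sP k f) := by
  refine dK_algHom sP ir (rename Sum.inr) ?_ k f
  intro k i
  rw [rename_X]
  by_cases h : sP k = i
  · subst h
    have := dK_X_self (K := F) ir k
    rw [ir_apply] at this
    rw [dK_X_self, this]; exact (AlgHom.commutes (rename Sum.inr) _).symm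
  · rw [dK_X_of_ne _ _ _ h, dK_X_of_ne, map_zero]
    rw [ir_apply]; simpa using h

theorem dK_iq_inr (k : ℕ) (f : SymA) : dK iq k (rename Sum.inr f : QR) = 0 := by
  refine dK_algHom_zero iq (rename Sum.inr) ?_ k f
  intro k i
  rw [rename_X, dK_X_of_ne]
  simp [iq_apply]

theorem dK_ir_inl (k : ℕ) (f : SymA) : dK ir k (rename Sum.inl f : QR) = 0 := by
  refine dK_algHom_zero ir (rename Sum.inl) ?_ k f
  intro k i
  rw [rename_X, dK_X_of_ne]
  simp [ir_apply]

theorem Hop_transport_mul {K : Type*} [Field K] {σ τ : Type*} (al : K) (ι : ℕ ↪ σ) (ι' : ℕ ↪ τ)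
    (φ : MvPolynomial σ K →ₐ[K] MvPolynomial τ K) (c : MvPolynomial τ K)
    (h : ∀ k f, dK ι' k (φ f) = φ (dK ι k f)) (hc : ∀ k, dK ι' k c = 0)
    (hX : ∀ n, φ (X (ι n)) = X (ι' n)) (j : ℕ) (f : MvPolynomial σ K) :
    Hop al ι' j (φ f * c) = φ (Hop al ι j f) * c := by
  have e : ∀ f, (LinearMap.mulRight K c ∘ₗ φ.toLinearMap) f = φ f * c := fun f => by
    rw [LinearMap.comp_apply, LinearMap.mulRight_apply, AlgHom.toLinearMap_apply]
  have := Hop_transport al ι ι' (LinearMap.mulRight K c ∘ₗ φ.toLinearMap) ?_ ?_ j f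
  · rwa [e, e] at this
  · intro k f
    rw [e, e, dK_mul, h, hc, mul_zero, add_zero]
  · intro n f
    rw [e, e, map_mul, hX, mul_assoc]

theorem Hop_iq (j : ℕ) (f g : SymA) : Hop alpha iq j (rename Sum.inl f * rename Sum.inr g : QR) =
    rename Sum.inl (Hop alpha sP j f) * rename Sum.inr g :=
  Hop_transport_mul alpha sP iq (rename Sum.inl) _ dK_iq_inl (fun k => dK_iq_inr k g)
    (fun n => rename_X _ _) j f

theorem Hop_ir (j : ℕ) (f g : SymA) : Hop alpha ir j (rename Sum.inl f * rename Sum.inr g : QR) =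
    rename Sum.inl f * rename Sum.inr (Hop alpha sP j g) := by
  rw [mul_comm, mul_comm (rename Sum.inl f)]
  exact Hop_transport_mul alpha sP ir (rename Sum.inr) _ dK_ir_inr (fun k => dK_ir_inl k f)
    (fun n => rename_X _ _) j g

section
variable {J : JPartition → SymA} (hJ : IsJackFamily J)
include hJ

theorem J_linInd : LinearIndependent F J := by
  rw [linearIndependent_iff']
  intro s c h l hl
  have := hallB_sum_J hJ s c l
  rw [h, if_pos hl, map_zero, LinearMap.zero_apply] at this
  exact (mul_eq_zero.1 this.symm).resolve_right (hallB_J_self hJ l)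

theorem J_top : ⊤ ≤ Submodule.span F (Set.range J) := by
  intro f _
  obtain ⟨D, c, rfl⟩ := J_span hJ f
  exact Submodule.sum_mem _ fun m _ => Submodule.smul_mem _ _ (Submodule.subset_span ⟨m, rfl⟩)

theorem exists_G : ∃ G : SymA →ₗ[F] QR, ∀ l, G (sh (J l)) =
    rename Sum.inl (sh (J l)) * rename Sum.inr (sh (J l)) := by
  let B := Module.Basis.mk (J_linInd hJ) (J_top hJ)
  refine ⟨(B.constr F fun l => (rename Sum.inl (sh (J l)) * rename Sum.inr (sh (J l)) : QR)) ∘ₗ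
    shi.toLinearMap, fun l => ?_⟩
  rw [LinearMap.comp_apply, AlgHom.toLinearMap_apply, shi_sh]
  have : J l = B l := by simp [B]
  conv_lhs => rw [this]
  rw [Module.Basis.constr_basis]

theorem shJ_ext {X : Type*} [AddCommGroup X] [Module F X] {A B : SymA →ₗ[F] X}
    (h : ∀ l, A (sh (J l)) = B (sh (J l))) : A = B := by
  refine LinearMap.ext fun f => ?_
  obtain ⟨D, c, h1⟩ := J_span hJ (shi f)
  have : f = ∑ m ∈ D, c m • sh (J m) := by
    rw [← sh_shi f, h1, map_sum]; simp only [map_smul]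
  rw [this, map_sum, map_sum]
  simp only [map_smul, h]

variable {G : SymA →ₗ[F] QR} (hG : ∀ l, G (sh (J l)) =
    rename Sum.inl (sh (J l)) * rename Sum.inr (sh (J l)))
include hG

theorem G_Hop_iq (j : ℕ) : G ∘ₗ Hop alpha sP j = Hop alpha iq j ∘ₗ G := by
  refine shJ_ext hJ fun l => ?_
  obtain ⟨t, ht⟩ := Top_J hJ j l
  have e : Hop alpha sP j (sh (J l)) = t • sh (J l) := by rw [Hop_sh, ht, map_smul]
  rw [LinearMap.comp_apply, LinearMap.comp_apply, hG, Hop_iq, e, map_smul, map_smul, hG, smul_mul_assoc]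

theorem G_Hop_ir (j : ℕ) : G ∘ₗ Hop alpha sP j = Hop alpha ir j ∘ₗ G := by
  refine shJ_ext hJ fun l => ?_
  obtain ⟨t, ht⟩ := Top_J hJ j l
  have e : Hop alpha sP j (sh (J l)) = t • sh (J l) := by rw [Hop_sh, ht, map_smul]
  rw [LinearMap.comp_apply, LinearMap.comp_apply, hG, Hop_ir, e, map_smul, map_smul, hG, mul_smul_comm]

theorem G_coeff {g : JPartition → JPartition → JPartition → F} (hg : IsStructCoeffs J g)
    (pi mu nu : JPartition) :
    coeff (qre (toExp mu) (toExp nu)) (G (monomial (toExp pi) 1)) = g pi mu nu := by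
  set s := (hg.1 mu nu).toFinset with hs
  have key : lcoeff F (qre (toExp mu) (toExp nu)) ∘ₗ G =
      ∑ p ∈ s, g p mu nu • lcoeff F (toExp p) := by
    refine shJ_ext hJ fun l => ?_
    rw [LinearMap.comp_apply, hG, lcoeff_apply, coeff_qre_mul, coeff_sh_J hJ, coeff_sh_J hJ, hg.2,
      LinearMap.sum_apply, finsum_eq_sum_of_support_subset (s := s)]
    · refine Finset.sum_congr rfl fun p _ => ?_
      rw [LinearMap.smul_apply, lcoeff_apply, coeff_sh_J hJ, smul_eq_mul]
    · intro p hp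
      rw [Finset.mem_coe, hs, Set.Finite.mem_toFinset]
      intro h
      exact hp (by simp [h])
  have := LinearMap.congr_fun key (monomial (toExp pi) 1)
  rw [LinearMap.comp_apply, lcoeff_apply] at this
  rw [this, LinearMap.sum_apply]
  simp only [LinearMap.smul_apply, lcoeff_apply, coeff_monomial, toExp_injective.eq_iff, smul_eq_mul, mul_ite,
    mul_one, mul_zero]
  rw [Finset.sum_ite_eq]
  split_ifs with h
  · rfl
  · rw [hs, Set.Finite.mem_toFinset] at h
    by_contra h'
    exact h (fun h'' => h' h''.symm)

theorem G_coeff_zero (f : SymA) : coeff 0 (G f) = coeff 0 f := by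
  have key : lcoeff F (0 : Exp2) ∘ₗ G = lcoeff F (0 : Exp) := by
    refine shJ_ext hJ fun l => ?_
    have h0 : (0 : Exp2) = qre (toExp 0) (toExp 0) := by
      rw [toExp_eq, map_zero, qre, Finsupp.mapDomain_zero, Finsupp.mapDomain_zero, add_zero]
    have h1 : (0 : Exp) = toExp 0 := by rw [toExp_eq, map_zero]
    have h2 : theta J 0 l = 1 := by
      have hz : psize 0 = 0 := rfl
      rw [theta, hz, if_neg (by omega)]
      have : toExp (addOnes 0 (psize l - 0)) = Finsupp.single 1 (psize l) := by
        rw [addOnes, zero_add, Nat.sub_zero, toExp_eq, ← Multiset.nsmul_singleton, map_nsmul,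
          Multiset.toFinsupp_singleton, Finsupp.smul_single, smul_eq_mul, mul_one]
      rw [this, hJ.normalized]
      simp [pmult]
    rw [LinearMap.comp_apply, hG, lcoeff_apply, lcoeff_apply, h0, coeff_qre_mul, h1, coeff_sh_J hJ, h2, one_mul]
  exact LinearMap.congr_fun key f

end

end JK
end

section
set_option linter.unusedSectionVars false
set_option linter.unusedSimpArgs false
namespace JK
open MvPolynomial Finset

section
variable {K : Type*} [Field K] {σ : Type*}

theorem weight_vP (s : ℤ) (e : Exp) : Finsupp.weight (vP s) e = s * (Finsupp.weight wN e : ℕ) := by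
  rw [Finsupp.weight_apply, Finsupp.weight_apply, Finsupp.sum, Finsupp.sum, Nat.cast_sum, Finset.mul_sum]
  refine Finset.sum_congr rfl fun i _ => ?_
  simp only [vP, wN, smul_eq_mul, nsmul_eq_mul]
  push_cast
  ring

theorem coeff_pderiv_sub (i : σ) (m : σ →₀ ℕ) (f : MvPolynomial σ K) :
    coeff m (pderiv i f) = (m i + 1 : K) * coeff (m + Finsupp.single i 1) f := by
  induction f using MvPolynomial.induction_on' with
  | add f g hf hg => rw [map_add, coeff_add, coeff_add, hf, hg, mul_add]
  | monomial e a =>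
    rw [pderiv_monomial, coeff_monomial, coeff_monomial]
    by_cases h : e = m + Finsupp.single i 1
    · subst h
      rw [if_pos (by simp), if_pos rfl]
      simp [mul_comm]
    · rw [if_neg h, mul_zero]
      split_ifs with h2
      · have : e i = 0 := by
          by_contra h3
          apply h
          rw [← h2]
          refine Finsupp.ext fun t => ?_
          by_cases ht : t = i
          · subst ht; simp; omega
          · simp [Finsupp.single_apply, Ne.symm ht]
        simp [this]
      · rfl

theorem euler_mem [CharZero K] (ι κ : ℕ ↪ σ) (hcov : ∀ t, (∃ n, t = ι n) ∨ ∃ n, t = κ n) (v : σ → ℤ)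
    (hι : ∀ n : ℕ, v (ι n) = 1 * ((n : ℤ) + 1)) (hκ : ∀ n : ℕ, v (κ n) = 1 * ((n : ℤ) + 1))
    (k : ℤ) (f : MvPolynomial σ K) (h0 : coeff 0 f = 0)
    (h1 : ∀ j : ℕ, dK ι j f ∈ Fil K v (k - (j + 1))) (h2 : ∀ j : ℕ, dK κ j f ∈ Fil K v (k - (j + 1))) :
    f ∈ Fil K v k := by
  have aux : ∀ (ι : ℕ ↪ σ) (hι : ∀ n : ℕ, v (ι n) = 1 * ((n : ℤ) + 1))
      (_ : ∀ j : ℕ, dK ι j f ∈ Fil K v (k - (j + 1))) (m : σ →₀ ℕ) (_ : coeff m f ≠ 0) (j : ℕ) (_ : m (ι j) ≠ 0),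
      k ≤ Finsupp.weight v m := by
    intro ι hι h1 m hm j hj
    obtain ⟨m', rfl⟩ : ∃ m' : σ →₀ ℕ, m = m' + Finsupp.single (ι j) 1 := by
      refine ⟨m - Finsupp.single (ι j) 1, (tsub_add_cancel_of_le ?_).symm⟩
      rw [Finsupp.single_le_iff]; omega
    have h3 : coeff m' (dK ι j f) ≠ 0 := by
      rw [dK_apply, coeff_smul, coeff_pderiv_sub, smul_eq_mul]
      have ha : ((j : K) + 1) ≠ 0 := by exact_mod_cast Nat.succ_ne_zero j
      have hb : ((m' (ι j) : K) + 1) ≠ 0 := by exact_mod_cast Nat.succ_ne_zero (m' (ι j))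
      exact mul_ne_zero ha (mul_ne_zero hb hm)
    have h4 := h1 j m' h3
    rw [map_add, Finsupp.weight_single, hι, one_smul]
    omega
  intro m hm
  have hm0 : m ≠ 0 := by rintro rfl; exact hm h0
  obtain ⟨t, ht⟩ : ∃ t, m t ≠ 0 := by
    by_contra h; push Not at h; exact hm0 (Finsupp.ext h)
  rcases hcov t with ⟨n, rfl⟩ | ⟨n, rfl⟩
  · exact aux ι hι h1 m hm n ht
  · exact aux κ hκ h2 m hm n ht

theorem weight_nonneg (v : σ → ℤ) (hv : ∀ t, 0 ≤ v t) (m : σ →₀ ℕ) : 0 ≤ Finsupp.weight v m := by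
  rw [Finsupp.weight_apply]
  exact Finset.sum_nonneg fun i _ => nsmul_nonneg (hv i) _

theorem mem_Fil_nonpos (v : σ → ℤ) (hv : ∀ t, 0 ≤ v t) (k : ℤ) (hk : k ≤ 0) (f : MvPolynomial σ K) :
    f ∈ Fil K v k := fun m _ => hk.trans (weight_nonneg v hv m)

theorem coeff_zero_of_Fil (v : σ → ℤ) (k : ℤ) (hk : 0 < k) (f : MvPolynomial σ K) (hf : f ∈ Fil K v k) :
    coeff 0 f = 0 := by
  by_contra h
  have := hf 0 h
  rw [map_zero] at this
  omega

theorem vP_nonneg (t : ℕ+) : 0 ≤ vP 1 t := by simp [vP]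

/-- homogeneous -/
def Hm (K : Type*) [Field K] (N : ℤ) : Submodule K (SP K) := Fil K (vP 1) N ⊓ Fil K (vP (-1)) (-N)

theorem monomial_mem_Hm (e : Exp) (a : K) : monomial e a ∈ Hm K (Finsupp.weight wN e : ℕ) := by
  constructor
  · have := monomial_mem_Fil (vP 1) e a
    rwa [weight_vP, one_mul] at this
  · have := monomial_mem_Fil (vP (-1)) e a
    rwa [weight_vP, neg_one_mul] at this

theorem Hm_neg (N : ℤ) (hN : N < 0) (f : SP K) (hf : f ∈ Hm K N) : f = 0 := by
  refine MvPolynomial.ext _ _ fun m => ?_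
  rw [coeff_zero]
  by_contra h
  have := hf.2 m h
  rw [weight_vP] at this
  omega

theorem dK_Hm (N : ℤ) (f : SP K) (hf : f ∈ Hm K N) (j : ℕ) : dK sP j f ∈ Hm K (N - (j + 1)) := by
  constructor
  · have := Op_dK (vP 1) sP j _ _ hf.1
    rw [vP_sP] at this
    refine Fil_antitone _ (le_of_eq ?_) this; ring
  · have := Op_dK (vP (-1)) sP j _ _ hf.2
    rw [vP_sP] at this
    refine Fil_antitone _ (le_of_eq ?_) this; ring

theorem Ps_coeff_zero {τ : Type*} (ι κ : ℕ ↪ τ) (f : SP K) : coeff 0 (Ps ι κ f) = coeff 0 f := by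
  have : (constantCoeff.comp (Ps ι κ : SP K →ₐ[K] MvPolynomial τ K).toRingHom) = constantCoeff := by
    apply MvPolynomial.ringHom_ext
    · intro a
      have : Ps ι κ (C a : SP K) = C a := AlgHom.commutes _ a
      change constantCoeff (Ps ι κ (C a : SP K)) = _
      rw [this]; simp
    · intro i
      obtain ⟨n, rfl⟩ : ∃ n, i = sP n := ⟨PNat.natPred i, by simp [sP]⟩
      change constantCoeff (Ps ι κ (X (sP n) : SP K)) = _
      rw [Ps_X]; simp
  exact RingHom.congr_fun this f

variable [CharZero K] {τ : Type*} (al : K) (ι κ : ℕ ↪ τ) (v : τ → ℤ)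
  (hι : ∀ n : ℕ, v (ι n) = 1 * ((n : ℤ) + 1)) (hκ : ∀ n : ℕ, v (κ n) = 1 * ((n : ℤ) + 1))
include hι hκ

theorem Ft_coeff_zero (f : SP K) : coeff 0 (Ft al ι κ f) = coeff 0 f := by
  have h := mem_Fil_nonpos (vP 1) vP_nonneg 0 le_rfl f
  have h1 := coeff_zero_of_Fil v _ (by norm_num) _ (Op_F1 1 v ι κ hι hκ _ _ h)
  have h2 := coeff_zero_of_Fil v _ (by norm_num) _ (Op_F2 al 1 v ι κ hι hκ _ _ h)
  rw [Ft, LinearMap.add_apply, LinearMap.add_apply, coeff_add, coeff_add, h1, h2, add_zero, add_zero]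
  exact Ps_coeff_zero ι κ f

variable (hcov : ∀ t, (∃ n, t = ι n) ∨ ∃ n, t = κ n) (hd : ∀ i j, ι i ≠ κ j)
  (G : SP K →ₗ[K] MvPolynomial τ K)
  (hGι : ∀ j, G ∘ₗ Hop al sP j = Hop al ι j ∘ₗ G)
  (hGκ : ∀ j, G ∘ₗ Hop al sP j = Hop al κ j ∘ₗ G) (hG0 : ∀ f, coeff 0 (G f) = coeff 0 f)

omit hκ hι in
theorem step_ext (n : ℕ) (d : ℤ) (D : SP K →ₗ[K] MvPolynomial τ K)
    (h : ∀ N : ℕ, N ≤ n → ∀ f ∈ Hm K N, D f ∈ Fil K v (N + d)) (k : ℤ) (f : SP K)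
    (h1 : f ∈ Fil K (vP 1) k) (h2 : f ∈ Fil K (vP (-1)) (-n)) : D f ∈ Fil K v (k + d) := by
  rw [f.as_sum, map_sum]
  refine Submodule.sum_mem _ fun e he => ?_
  rw [mem_support_iff] at he
  have a1 := h1 e he
  have a2 := h2 e he
  rw [weight_vP] at a1 a2
  exact Fil_antitone v (by omega) (h (Finsupp.weight wN e) (by omega) _ (monomial_mem_Hm e _))

theorem step_dK (hd : ∀ i j, ι i ≠ κ j) (hGι : ∀ j, G ∘ₗ Hop al sP j = Hop al ι j ∘ₗ G)
    (n : ℕ) (d : ℤ) (hdn : d ≤ 2)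
    (h : ∀ N : ℕ, N ≤ n → ∀ f ∈ Hm K N, (G - Ft al ι κ) f ∈ Fil K v (N + d))
    (N : ℕ) (hN : N ≤ n)
    (ih : ∀ M : ℕ, M < N → ∀ f ∈ Hm K M, (G - Ft al ι κ) f ∈ Fil K v (M + (d + 1)))
    (f : SP K) (hf : f ∈ Hm K N) (j : ℕ) : dK ι j ((G - Ft al ι κ) f) ∈ Fil K v (N + (d + 1) - (j + 1)) := by
  set D := G - Ft al ι κ with hD
  have e : dK ι j (D f) = D (dK sP j f) + D ((Hop al sP j - dK sP j : SP K →ₗ[K] SP K) f)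
      - (Hop al ι j ∘ₗ Ft al ι κ - Ft al ι κ ∘ₗ Hop al sP j) f - (Hop al ι j - dK ι j : MvPolynomial τ K →ₗ[K] MvPolynomial τ K) (D f) := by
    have hg := LinearMap.congr_fun (hGι j) f
    simp only [LinearMap.comp_apply] at hg
    rw [← map_add]
    simp only [hD, LinearMap.sub_apply, LinearMap.comp_apply, map_sub, map_add, hg]
    abel
  rw [e]
  refine Submodule.sub_mem _ (Submodule.sub_mem _ (Submodule.add_mem _ ?_ ?_) ?_) ?_
  · have h1 := dK_Hm _ f hf j
    by_cases hj : N < j + 1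
    · rw [Hm_neg _ (by omega) _ h1, map_zero]; exact Submodule.zero_mem _
    · have h2 := ih (N - (j + 1)) (by omega) (dK sP j f) (by
        convert h1 using 1
        push_cast [Nat.cast_sub (not_lt.1 hj)]; ring)
      refine Fil_antitone v ?_ h2
      push_cast [Nat.cast_sub (not_lt.1 hj)]; linarith
  · refine Fil_antitone v ?_ (step_ext v n d D h (N - j) _ ?_ ?_)
    · linarith
    · have := Op_Hop_sub al sP (vP 1) (vP_sP 1) j _ _ hf.1
      exact this
    · have h1 := Op_Hop_neg al sP (vP (-1)) (vP_sP (-1)) j _ _ hf.2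
      have h2 := (dK_Hm _ f hf j).2
      rw [LinearMap.sub_apply]
      exact Submodule.sub_mem _ (Fil_antitone _ (by omega) h1) (Fil_antitone _ (by omega) h2)
  · refine Fil_antitone v ?_ (Op_Hop_Ft al ι κ hd v hι hκ j _ _ hf.1)
    linarith
  · refine Fil_antitone v ?_ (Op_Hop_sub al ι v hι j _ _ (h N hN f hf))
    linarith

include hcov hd hGι hGκ hG0 in
theorem step_main (n : ℕ) (d : ℤ) (hdn : d ≤ 2)
    (h : ∀ N : ℕ, N ≤ n → ∀ f ∈ Hm K N, (G - Ft al ι κ) f ∈ Fil K v (N + d)) :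
    ∀ N : ℕ, N ≤ n → ∀ f ∈ Hm K N, (G - Ft al ι κ) f ∈ Fil K v (N + (d + 1)) := by
  intro N
  induction N using Nat.strong_induction_on with
  | _ N ih =>
    intro hN f hf
    have ih' : ∀ M : ℕ, M < N → ∀ f ∈ Hm K M, (G - Ft al ι κ) f ∈ Fil K v (M + (d + 1)) :=
      fun M hM f hf => ih M hM (by omega) f hf
    refine euler_mem ι κ hcov v hι hκ _ _ ?_ ?_ ?_
    · rw [LinearMap.sub_apply, coeff_sub, hG0, Ft_coeff_zero al ι κ v hι hκ, sub_self]
    · exact step_dK al ι κ v hι hκ G hd hGι n d hdn h N hN ih' f hf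
    · intro j
      have := step_dK al κ ι v hκ hι G (fun i j => (hd j i).symm) hGκ n d hdn
      rw [← Ft_symm] at this
      exact this h N hN ih' f hf j

include hcov hd hGι hGκ hG0 in
theorem main_ind (N : ℕ) (f : SP K) (hf : f ∈ Hm K N) : (G - Ft al ι κ) f ∈ Fil K v (N + 3) := by
  have key : ∀ d : ℕ, d ≤ N + 3 → ∀ M : ℕ, M ≤ N → ∀ f ∈ Hm K M,
      (G - Ft al ι κ) f ∈ Fil K v (M + ((d : ℤ) - N)) := by
    intro d
    induction d with
    | zero =>
      intro _ M hM f _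
      refine mem_Fil_nonpos v ?_ _ (by omega) _
      intro t
      rcases hcov t with ⟨n, rfl⟩ | ⟨n, rfl⟩
      · rw [hι]; omega
      · rw [hκ]; omega
    | succ d ih =>
      intro hd' M hM f hf
      have := step_main al ι κ v hι hκ hcov hd G hGι hGκ hG0 N ((d : ℤ) - N) (by omega)
        (fun M hM f hf => ih (by omega) M hM f hf) M hM f hf
      refine Fil_antitone v ?_ this
      push_cast; linarith
  refine Fil_antitone v ?_ (key (N + 3) le_rfl N le_rfl f hf)
  push_cast; linarith

end

end JK
end

section
set_option linter.unusedSectionVars false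
set_option linter.unusedSimpArgs false
namespace JK
open MvPolynomial Finset

def vQ (s : ℤ) : ℕ+ ⊕ ℕ+ → ℤ := Sum.elim (vP s) (vP s)

theorem vQ_iq (s : ℤ) (n : ℕ) : vQ s (iq n) = s * ((n : ℤ) + 1) := vP_sP s n
theorem vQ_ir (s : ℤ) (n : ℕ) : vQ s (ir n) = s * ((n : ℤ) + 1) := vP_sP s n

theorem cov_iq_ir (t : ℕ+ ⊕ ℕ+) : (∃ n, t = iq n) ∨ ∃ n, t = ir n := by
  rcases t with i | i
  · exact Or.inl ⟨PNat.natPred i, by simp [iq_apply, sP]⟩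
  · exact Or.inr ⟨PNat.natPred i, by simp [ir_apply, sP]⟩

theorem weight_mapDomain_inl (s : ℤ) (a : Exp) :
    Finsupp.weight (vQ s) (a.mapDomain Sum.inl) = Finsupp.weight (vP s) a := by
  induction a using Finsupp.induction_linear with
  | zero => simp
  | add f g hf hg => rw [Finsupp.mapDomain_add, map_add, map_add, hf, hg]
  | single i n => rw [Finsupp.mapDomain_single, Finsupp.weight_single, Finsupp.weight_single]; rfl

theorem weight_mapDomain_inr (s : ℤ) (a : Exp) :
    Finsupp.weight (vQ s) (a.mapDomain Sum.inr) = Finsupp.weight (vP s) a := by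
  induction a using Finsupp.induction_linear with
  | zero => simp
  | add f g hf hg => rw [Finsupp.mapDomain_add, map_add, map_add, hf, hg]
  | single i n => rw [Finsupp.mapDomain_single, Finsupp.weight_single, Finsupp.weight_single]; rfl

theorem weight_qre (s : ℤ) (mu nu : JPartition) :
    Finsupp.weight (vQ s) (qre (toExp mu) (toExp nu)) = s * (psize mu + psize nu) := by
  rw [qre, map_add, weight_mapDomain_inl, weight_mapDomain_inr, weight_vP, weight_vP, weight_toExp,
    weight_toExp]
  ring

theorem coeff_Gk_aux (g : JPartition → JPartition → JPartition → F) (pi mu nu : JPartition) (N : ℕ) :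
    coeff (qre (toExp mu) (toExp nu)) (∑ᶠ mu : JPartition, ∑ᶠ nu : JPartition,
      if psize mu + psize nu = N then g pi mu nu • qrMon mu nu else 0) =
    if psize mu + psize nu = N then g pi mu nu else 0 := by
  set s := (finite_psize N).toFinset with hs
  have mem : ∀ l, l ∈ s ↔ psize l ≤ N := fun l => by rw [hs, Set.Finite.mem_toFinset]; rfl
  have h1 : ∀ mu : JPartition, (∑ᶠ nu : JPartition,
      if psize mu + psize nu = N then g pi mu nu • qrMon mu nu else 0) =
      ∑ nu ∈ s, if psize mu + psize nu = N then g pi mu nu • qrMon mu nu else 0 := by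
    intro mu
    refine finsum_eq_sum_of_support_subset _ fun nu h => ?_
    rw [Finset.mem_coe, mem]
    by_contra h'
    exact h (if_neg (by omega))
  simp only [h1]
  rw [finsum_eq_sum_of_support_subset (s := s), coeff_sum]
  · have h2 : ∀ mu' nu' : JPartition, coeff (qre (toExp mu) (toExp nu))
        (if psize mu' + psize nu' = N then g pi mu' nu' • qrMon mu' nu' else 0) =
        if mu' = mu then (if nu' = nu then (if psize mu + psize nu = N then g pi mu nu else 0) else 0)
          else 0 := by
      intro mu' nu'
      have h3 : coeff (qre (toExp mu) (toExp nu)) (qrMon mu' nu') =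
          if mu' = mu then (if nu' = nu then 1 else 0) else 0 := by
        rw [qrMon_eq, coeff_monomial]
        by_cases b : mu' = mu
        · by_cases c : nu' = nu
          · subst b c; simp
          · rw [if_neg (fun a => c (toExp_injective (qre_inj a).2)), if_neg c, if_pos b]
        · rw [if_neg (fun a => b (toExp_injective (qre_inj a).1)), if_neg b]
      by_cases hm : mu' = mu
      · subst hm
        by_cases hn : nu' = nu
        · subst hn
          simp only [if_true] at h3 ⊢
          split_ifs
          · rw [coeff_smul, h3, smul_eq_mul, mul_one]
          · rw [coeff_zero]
        · simp only [if_true, if_neg hn] at h3 ⊢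
          split_ifs
          · rw [coeff_smul, h3, smul_zero]
          · rw [coeff_zero]
      · simp only [if_neg hm] at h3 ⊢
        split_ifs
        · rw [coeff_smul, h3, smul_zero]
        · rw [coeff_zero]
    simp only [coeff_sum, h2]
    by_cases hc : psize mu + psize nu = N
    · have m1 : mu ∈ s := (mem _).2 (by omega)
      have m2 : nu ∈ s := (mem _).2 (by omega)
      rw [Finset.sum_eq_single_of_mem mu m1, Finset.sum_eq_single_of_mem nu m2]
      · simp
      · intro b _ hb; simp [hb]
      · intro b _ hb; simp [hb]
    · simp [hc]
  · intro mu' h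
    rw [Finset.mem_coe, mem]
    by_contra h'
    exact h (Finset.sum_eq_zero fun nu' _ => if_neg (by omega))

theorem Gk_eq_F2 {J : JPartition → SymA} (hJ : IsJackFamily J)
    {g : JPartition → JPartition → JPartition → F} (hg : IsStructCoeffs J g) (f : SymA) :
    Gk g 2 f = F2 alpha iq ir f := by
  obtain ⟨G, hG⟩ := exists_G hJ
  have key : ∀ m : Exp, (∑ᶠ mu : JPartition, ∑ᶠ nu : JPartition,
      if psize mu + psize nu = wt m + 2 then g (toPart m) mu nu • qrMon mu nu else 0) =
      F2 alpha iq ir (monomial m 1) := by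
    intro m
    refine MvPolynomial.ext _ _ fun η => ?_
    obtain ⟨a, b, rfl⟩ := qre_surj η
    obtain ⟨mu, rfl⟩ : ∃ mu, a = toExp mu := ⟨_, (toExp_toPart a).symm⟩
    obtain ⟨nu, rfl⟩ : ∃ mu, b = toExp mu := ⟨_, (toExp_toPart b).symm⟩
    have hm : monomial m (1 : F) ∈ Hm F (wt m : ℕ) := by rw [wt_eq]; exact monomial_mem_Hm m 1
    have hmain := main_ind alpha iq ir (vQ 1) (vQ_iq 1) (vQ_ir 1) cov_iq_ir iq_ne_ir G
      (G_Hop_iq hJ hG) (G_Hop_ir hJ hG) (G_coeff_zero hJ hG) (wt m) _ hm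
    rw [coeff_Gk_aux]
    have hp := Op_F2 alpha 1 (vQ 1) iq ir (vQ_iq 1) (vQ_ir 1) _ _ hm.1
    have hn := Op_F2 alpha (-1) (vQ (-1)) iq ir (vQ_iq (-1)) (vQ_ir (-1)) _ _ hm.2
    have w1 := weight_qre 1 mu nu
    have w2 := weight_qre (-1) mu nu
    split_ifs with hc
    · have hGc : coeff (qre (toExp mu) (toExp nu)) (G (monomial m 1)) = g (toPart m) mu nu := by
        have := G_coeff hJ hG hg (toPart m) mu nu
        rwa [toExp_toPart] at this
      have n0 := Op_Ps (K := F) (-1) (vQ (-1)) iq ir (vQ_iq (-1)) (vQ_ir (-1)) _ _ hm.2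
      have n1 := Op_F1 (K := F) (-1) (vQ (-1)) iq ir (vQ_iq (-1)) (vQ_ir (-1)) _ _ hm.2
      have c0 : coeff (qre (toExp mu) (toExp nu)) (PsL iq ir (monomial m (1 : F))) = 0 := by
        by_contra h
        have := n0 _ h
        omega
      have c1 : coeff (qre (toExp mu) (toExp nu)) (F1 iq ir (monomial m (1 : F))) = 0 := by
        by_contra h
        have := n1 _ h
        omega
      have c2 : coeff (qre (toExp mu) (toExp nu)) ((G - Ft alpha iq ir) (monomial m (1 : F))) = 0 := by
        by_contra h
        have := hmain _ h
        omega
      rw [LinearMap.sub_apply, coeff_sub, hGc, Ft, LinearMap.add_apply, LinearMap.add_apply, coeff_add,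
        coeff_add, c0, c1, zero_add, zero_add, sub_eq_zero] at c2
      exact c2
    · symm
      by_contra h
      have a1 := hp _ h
      have a2 := hn _ h
      omega
  rw [Gk]
  simp only [key]
  conv_rhs => rw [f.as_sum, map_sum]
  refine Finset.sum_congr rfl fun m _ => ?_
  rw [← map_smul, smul_monomial, smul_eq_mul, mul_one]

end JK
end

section
set_option linter.unusedSectionVars false
set_option linter.unusedSimpArgs false
namespace JK
open MvPolynomial Finset

theorem sP_coe (n : ℕ) : ((sP n : ℕ+) : ℕ) = n + 1 := rfl

section
variable {M : Type*} [AddCommMonoid M]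

theorem finsum_pnat (φ : ℕ+ → M) : ∑ᶠ m : ℕ+, φ m = ∑ᶠ n : ℕ, φ (sP n) :=
  (finsum_comp_equiv (f := φ) Equiv.pnatEquivNat.symm).symm

theorem fs1 (a N : ℕ) (h : ℕ+ → M) : (∑ᶠ b : ℕ+, if a + (b : ℕ) = N + 1 then h b else 0) =
    if a ≤ N then h (sP (N - a)) else 0 := by
  rw [finsum_pnat]
  rw [finsum_eq_single _ (N - a)]
  · refine if_congr ?_ rfl rfl
    rw [sP_coe]; omega
  · intro b hb
    refine if_neg ?_
    rw [sP_coe]; omega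

theorem fs2 (N : ℕ) (h : ℕ+ → ℕ+ → M) :
    (∑ᶠ a : ℕ+, ∑ᶠ b : ℕ+, if (a : ℕ) + (b : ℕ) = N + 2 then h a b else 0) =
    ∑ x ∈ antidiagonal N, h (sP x.1) (sP x.2) := by
  have e : ∀ a : ℕ+, (∑ᶠ b : ℕ+, if (a : ℕ) + (b : ℕ) = N + 2 then h a b else 0) =
      if (a : ℕ) ≤ N + 1 then h a (sP (N + 1 - a)) else 0 := fun a => fs1 _ (N + 1) _
  simp only [e]
  rw [finsum_pnat, finsum_eq_sum_of_support_subset (s := range (N + 1)),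
    Finset.Nat.sum_antidiagonal_eq_sum_range_succ (fun i j => h (sP i) (sP j))]
  · refine Finset.sum_congr rfl fun i hi => ?_
    rw [Finset.mem_range] at hi
    rw [sP_coe, if_pos (by omega)]
    congr 2; omega
  · intro i hi
    rw [Finset.mem_coe, Finset.mem_range]
    by_contra h'
    refine hi (if_neg ?_)
    rw [sP_coe]; omega

theorem fs3 (N : ℕ) (h : ℕ+ → ℕ+ → ℕ+ → M) :
    (∑ᶠ a : ℕ+, ∑ᶠ b : ℕ+, ∑ᶠ c : ℕ+, if (a : ℕ) + (b : ℕ) + (c : ℕ) = N + 3 then h a b c else 0) =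
    ∑ x ∈ antidiagonal N, ∑ y ∈ antidiagonal x.2, h (sP x.1) (sP y.1) (sP y.2) := by
  rw [finsum_pnat, finsum_eq_sum_of_support_subset (s := range (N + 1)),
    Finset.Nat.sum_antidiagonal_eq_sum_range_succ
      (fun i j => ∑ y ∈ antidiagonal j, h (sP i) (sP y.1) (sP y.2))]
  · refine Finset.sum_congr rfl fun i hi => ?_
    rw [Finset.mem_range] at hi
    rw [← fs2]
    refine finsum_congr fun b => finsum_congr fun c => ?_
    rw [sP_coe]
    exact if_congr (by omega) rfl rfl
  · intro i hi
    rw [Finset.mem_coe, Finset.mem_range]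
    by_contra h'
    refine hi ?_
    have : ∀ b c : ℕ+, ¬ ((sP i : ℕ) + (b : ℕ) + (c : ℕ) = N + 3) := by
      intro b c
      have := b.pos; have := c.pos
      rw [sP_coe]; omega
    simp only [this, if_false, finsum_zero]

theorem fs4 (N P : ℕ) (h : ℕ+ → ℕ+ → ℕ+ → ℕ+ → M) :
    (∑ᶠ a : ℕ+, ∑ᶠ b : ℕ+, ∑ᶠ c : ℕ+, ∑ᶠ d : ℕ+,
      if (a : ℕ) + (b : ℕ) = N + 2 ∧ (c : ℕ) + (d : ℕ) = P + 2 then h a b c d else 0) =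
    ∑ x ∈ antidiagonal N, ∑ y ∈ antidiagonal P, h (sP x.1) (sP x.2) (sP y.1) (sP y.2) := by
  rw [← fs2 N (fun a b => ∑ y ∈ antidiagonal P, h a b (sP y.1) (sP y.2))]
  refine finsum_congr fun a => finsum_congr fun b => ?_
  split_ifs with hc
  · simp only [hc, true_and]
    exact fs2 P _
  · simp only [hc, false_and, if_false, finsum_zero]

end

theorem Psi_eq (f : SymA) : Psi f = Ps iq ir f := by
  conv_rhs => rw [f.as_sum, map_sum]
  rw [Psi]
  refine Finset.sum_congr rfl fun m _ => ?_
  have h1 : monomial m (coeff m f) = coeff m f • (((toPart m).map fun i => (X i : SymA)).prod) := by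
    rw [prod_X_map, toExp_toPart, smul_monomial, smul_eq_mul, mul_one]
  rw [h1, map_smul, map_multiset_prod, Multiset.map_map]
  congr 2
  refine Multiset.map_congr rfl fun i _ => ?_
  obtain ⟨n, rfl⟩ : ∃ n, i = sP n := ⟨PNat.natPred i, by simp [sP]⟩
  rw [Function.comp_apply, Ps_X]
  rfl

theorem pd_eq (n : ℕ) (f : SymA) : (((sP n : ℕ+) : ℕ) : F) • pderiv (sP n) f = dK sP n f := by
  rw [dK_apply, sP_coe]; push_cast; rfl

theorem qv_sP (n : ℕ) : qv (sP n) = X (iq n) := rfl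
theorem rv_sP (n : ℕ) : rv (sP n) = X (ir n) := rfl

theorem term1 (f : SymA) : (∑ᶠ m : ℕ+, ∑ᶠ m1 : ℕ+, ∑ᶠ m2 : ℕ+,
        if (m1 : ℕ) + (m2 : ℕ) = (m : ℕ) + 2 then
          ((alpha - 1) * (((m1 : ℕ) - 1 : ℕ) : F) * (((m2 : ℕ) - 1 : ℕ) : F)) •
            (qv m1 * rv m2 * Psi (((m : ℕ) : F) • MvPolynomial.pderiv m f))
        else 0) = Dsum sP (fun n => cP iq ir ((alpha - 1) • ∑ x ∈ antidiagonal (n + 1),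
          ((x.1 : F) * (x.2 : F)) • (X (iq x.1) * X (ir x.2)))) f := by
  rw [finsum_pnat, Dsum_eq_finsum]
  refine finsum_congr fun n => ?_
  rw [pd_eq, Psi_eq, cP_apply]
  refine (fs2 (n + 1) _).trans ?_
  rw [Finset.smul_sum, Finset.sum_mul]
  refine Finset.sum_congr rfl fun x _ => ?_
  simp only [sP_coe, Nat.add_sub_cancel, qv_sP, rv_sP]
  rw [mul_assoc (alpha - 1), mul_smul, smul_mul_assoc, smul_mul_assoc]

theorem term2 (f : SymA) : (∑ᶠ m : ℕ+, ∑ᶠ m1 : ℕ+, ∑ᶠ m2 : ℕ+, ∑ᶠ m3 : ℕ+,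
        if (m1 : ℕ) + (m2 : ℕ) + (m3 : ℕ) = (m : ℕ) + 2 then
          ((((m1 : ℕ) - 1 : ℕ) : F)) •
            ((qv m1 * rv m2 * rv m3 + rv m1 * qv m2 * qv m3) *
              Psi (((m : ℕ) : F) • MvPolynomial.pderiv m f))
        else 0) = Dsum sP (fun n => cP iq ir (∑ x ∈ antidiagonal n, ∑ y ∈ antidiagonal x.2,
    (x.1 : F) • (X (iq x.1) * X (ir y.1) * X (ir y.2) + X (ir x.1) * X (iq y.1) * X (iq y.2)))) f := by
  rw [finsum_pnat, Dsum_eq_finsum]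
  refine finsum_congr fun n => ?_
  rw [pd_eq, Psi_eq, cP_apply]
  refine (fs3 n _).trans ?_
  rw [Finset.sum_mul]
  refine Finset.sum_congr rfl fun x _ => ?_
  rw [Finset.sum_mul]
  refine Finset.sum_congr rfl fun y _ => ?_
  simp only [sP_coe, Nat.add_sub_cancel, qv_sP, rv_sP]
  rw [smul_mul_assoc]

theorem term3 (f : SymA) : (∑ᶠ k : ℕ+, ∑ᶠ m : ℕ+, ∑ᶠ i1 : ℕ+, ∑ᶠ i2 : ℕ+,
        if (i1 : ℕ) + (i2 : ℕ) = (k : ℕ) + (m : ℕ) + 2 then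
          (alpha * ((min (min (m : ℕ) (k : ℕ)) (min ((i1 : ℕ) - 1) ((i2 : ℕ) - 1)) : ℕ) : F)) •
            (qv i1 * rv i2 *
              Psi (((m : ℕ) : F) • MvPolynomial.pderiv m
                (((k : ℕ) : F) • MvPolynomial.pderiv k f)))
        else 0) = Dsum sP (fun k => Dsum sP (fun m => cP iq ir (alpha • ∑ x ∈ antidiagonal (m + k + 2),
          (mn m k x.1 x.2 : F) • (X (iq x.1) * X (ir x.2))))) f := by
  rw [finsum_pnat, Dsum_eq_finsum]
  refine finsum_congr fun k => ?_
  rw [finsum_pnat, Dsum_eq_finsum]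
  refine finsum_congr fun m => ?_
  rw [pd_eq, pd_eq, Psi_eq, cP_apply]
  have e : ((sP k : ℕ+) : ℕ) + ((sP m : ℕ+) : ℕ) + 2 = (m + k + 2) + 2 := by
    rw [sP_coe, sP_coe]; ring
  rw [e]
  refine (fs2 (m + k + 2) _).trans ?_
  rw [Finset.smul_sum, Finset.sum_mul]
  refine Finset.sum_congr rfl fun x _ => ?_
  simp only [sP_coe, Nat.add_sub_cancel, qv_sP, rv_sP]
  rw [mul_smul, smul_mul_assoc, smul_mul_assoc]
  rfl

theorem term4 (f : SymA) : (∑ᶠ m : ℕ+, ∑ᶠ k : ℕ+, ∑ᶠ m1 : ℕ+, ∑ᶠ m2 : ℕ+, ∑ᶠ k1 : ℕ+, ∑ᶠ k2 : ℕ+,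
        if (m1 : ℕ) + (m2 : ℕ) = (m : ℕ) + 1 ∧ (k1 : ℕ) + (k2 : ℕ) = (k : ℕ) + 1 then
          qv m1 * qv k1 * rv m2 * rv k2 *
            Psi (((m : ℕ) : F) • MvPolynomial.pderiv m
              (((k : ℕ) : F) • MvPolynomial.pderiv k f))
        else 0) = Dsum sP (fun k => Dsum sP (fun m => cP iq ir (Q1 iq ir m * Q1 iq ir k))) f := by
  rw [finsum_pnat, Dsum_eq_finsum]
  refine finsum_congr fun m => ?_
  rw [finsum_pnat, Dsum_eq_finsum]
  refine finsum_congr fun k => ?_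
  rw [pd_eq, pd_eq, Psi_eq, cP_apply, dK_comm sP m k]
  refine (fs4 m k _).trans ?_
  rw [mul_comm (Q1 iq ir k), Q1, Q1, Finset.sum_mul_sum, Finset.sum_mul]
  refine Finset.sum_congr rfl fun x _ => ?_
  rw [Finset.sum_mul]
  refine Finset.sum_congr rfl fun y _ => ?_
  simp only [qv_sP, rv_sP]
  ring

theorem cP_add {K : Type*} [Field K] {τ : Type*} (ι κ : ℕ ↪ τ) (a b : MvPolynomial τ K) :
    cP ι κ (a + b) = cP ι κ a + cP ι κ b := by
  refine LinearMap.ext fun f => ?_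
  rw [LinearMap.add_apply, cP_apply, cP_apply, cP_apply, add_mul]

theorem Dsum_add {K : Type*} [Field K] {σ X : Type*} [AddCommGroup X] [Module K X] (ι : ℕ ↪ σ)
    (V V' : ℕ → (MvPolynomial σ K →ₗ[K] X)) :
    Dsum ι (fun n => V n + V' n) = Dsum ι V + Dsum ι V' := map_add (Dsum ι) V V'

end JK
end

/-- **Theorem 1.11, degree 2.**  The differential expression for `𝒢_2^{(α)}`, with
`b = α - 1`:
`𝒢_2^{(α)} = (1/2)∑ b(m₁-1)(m₂-1) q_{m₁} r_{m₂} Ψ (m∂/∂p_m)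
 + (1/2)∑ (m₁-1)(q_{m₁}r_{m₂}r_{m₃} + r_{m₁}q_{m₂}q_{m₃}) Ψ (m∂/∂p_m)
 + (1/2)∑ α min(m,k,i₁-1,i₂-1) q_{i₁} r_{i₂} Ψ (m∂/∂p_m)(k∂/∂p_k)
 + (1/2)∑ q_{m₁}q_{k₁}r_{m₂}r_{k₂} Ψ (m∂/∂p_m)(k∂/∂p_k)`. -/
theorem statement3
    (J : JPartition → SymA) (hJ : IsJackFamily J)
    (g : JPartition → JPartition → JPartition → F) (hg : IsStructCoeffs J g)
    (f : SymA) :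
    Gk g 2 f =
      (2 : F)⁻¹ • (∑ᶠ m : ℕ+, ∑ᶠ m1 : ℕ+, ∑ᶠ m2 : ℕ+,
        if (m1 : ℕ) + (m2 : ℕ) = (m : ℕ) + 2 then
          ((alpha - 1) * (((m1 : ℕ) - 1 : ℕ) : F) * (((m2 : ℕ) - 1 : ℕ) : F)) •
            (qv m1 * rv m2 * Psi (((m : ℕ) : F) • MvPolynomial.pderiv m f))
        else 0)
      + (2 : F)⁻¹ • (∑ᶠ m : ℕ+, ∑ᶠ m1 : ℕ+, ∑ᶠ m2 : ℕ+, ∑ᶠ m3 : ℕ+,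
        if (m1 : ℕ) + (m2 : ℕ) + (m3 : ℕ) = (m : ℕ) + 2 then
          ((((m1 : ℕ) - 1 : ℕ) : F)) •
            ((qv m1 * rv m2 * rv m3 + rv m1 * qv m2 * qv m3) *
              Psi (((m : ℕ) : F) • MvPolynomial.pderiv m f))
        else 0)
      + (2 : F)⁻¹ • (∑ᶠ k : ℕ+, ∑ᶠ m : ℕ+, ∑ᶠ i1 : ℕ+, ∑ᶠ i2 : ℕ+,
        if (i1 : ℕ) + (i2 : ℕ) = (k : ℕ) + (m : ℕ) + 2 then
          (alpha * ((min (min (m : ℕ) (k : ℕ)) (min ((i1 : ℕ) - 1) ((i2 : ℕ) - 1)) : ℕ) : F)) •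
            (qv i1 * rv i2 *
              Psi (((m : ℕ) : F) • MvPolynomial.pderiv m
                (((k : ℕ) : F) • MvPolynomial.pderiv k f)))
        else 0)
      + (2 : F)⁻¹ • (∑ᶠ m : ℕ+, ∑ᶠ k : ℕ+, ∑ᶠ m1 : ℕ+, ∑ᶠ m2 : ℕ+, ∑ᶠ k1 : ℕ+, ∑ᶠ k2 : ℕ+,
        if (m1 : ℕ) + (m2 : ℕ) = (m : ℕ) + 1 ∧ (k1 : ℕ) + (k2 : ℕ) = (k : ℕ) + 1 then
          qv m1 * qv k1 * rv m2 * rv k2 *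
            Psi (((m : ℕ) : F) • MvPolynomial.pderiv m
              (((k : ℕ) : F) • MvPolynomial.pderiv k f))
        else 0) := by
  rw [JK.term1, JK.term2, JK.term3, JK.term4, JK.Gk_eq_F2 hJ hg, JK.F2, JK.F2a, JK.F2b]
  simp only [JK.A2c, JK.B2c, JK.cP_add, JK.Dsum_add, LinearMap.smul_apply, LinearMap.add_apply, smul_add]
  rw [add_assoc, add_assoc, add_assoc]

end
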